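/- The affine rational points on the genus-2 hyperelliptic curve y^2 + y = x^6 + 3x^5 - 5x^3 + 3x are exactly the twelve points (0,0), (0,-1), (1,1), (1,-2), (-1,0), (-1,-1), (-2,1), (-2,-2), (3,36), (3,-37), (-4,36), (-4,-37). That is, for x, y ∈ ℚ, one has y^2 + y = x^6 + 3x^5 - 5x^3 + 3x if and only if (x,y) is one of these twelve pairs. -/

import Mathlib

universe u

section CubicFields

set_option linter.unusedSectionVars false

open NumberField Module IsDedekindDomain WithZero

section CubicField

variable {K : Type*} [Field K] [NumberField K] {α : K} (b : Basis (Fin 3) ℚ K)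

theorem repr_of_eq_combination (hb : ∀ i, b i = α ^ (i : ℕ)) {x : K} {c₀ c₁ c₂ : ℚ}
    (hx : x = c₀ + c₁ * α + c₂ * α ^ 2) : b.repr x = ![c₀, c₁, c₂] := by
  have : x = ∑ i, (![c₀, c₁, c₂] : Fin 3 → ℚ) i • b i := by
    simp [Fin.sum_univ_three, hb, hx, Algebra.smul_def]
  ext i
  rw [this, b.repr_sum_self]

theorem leftMulMatrix_of_cube_eq_ten (hb : ∀ i, b i = α ^ (i : ℕ)) (hα : α ^ 3 = 10) {x : K}
    {c₀ c₁ c₂ : ℚ} (hx : x = c₀ + c₁ * α + c₂ * α ^ 2) :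
    Algebra.leftMulMatrix b x = !![c₀, 10 * c₂, 10 * c₁; c₁, c₀, 10 * c₂; c₂, c₁, c₀] := by
  have h0 := repr_of_eq_combination b hb (x := x * b 0) (c₀ := c₀) (c₁ := c₁) (c₂ := c₂)
    (by rw [hb, hx]; simp)
  have h1 := repr_of_eq_combination b hb (x := x * b 1) (c₀ := 10 * c₂) (c₁ := c₀) (c₂ := c₁)
    (by rw [hb, hx]; push_cast; simp only [Fin.val_one]; linear_combination (c₂ : K) * hα)
  have h2 := repr_of_eq_combination b hb (x := x * b 2) (c₀ := 10 * c₁) (c₁ := 10 * c₂) (c₂ := c₀)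
    (by rw [hb, hx]; push_cast; simp only [Fin.val_two]
        linear_combination ((c₁ : K) + c₂ * α) * hα)
  ext i j
  rw [Algebra.leftMulMatrix_eq_repr_mul]
  fin_cases j <;> [rw [show (⟨0, by decide⟩ : Fin 3) = 0 from rfl, h0]; 
    rw [show (⟨1, by decide⟩ : Fin 3) = 1 from rfl, h1];
    rw [show (⟨2, by decide⟩ : Fin 3) = 2 from rfl, h2]] <;> fin_cases i <;> rfl

theorem norm_of_cube_eq_ten (hb : ∀ i, b i = α ^ (i : ℕ)) (hα : α ^ 3 = 10) {x : K}
    {c₀ c₁ c₂ : ℚ} (hx : x = c₀ + c₁ * α + c₂ * α ^ 2) :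
    Algebra.norm ℚ x = c₀ ^ 3 + 10 * c₁ ^ 3 + 100 * c₂ ^ 3 - 30 * c₀ * c₁ * c₂ := by
  rw [Algebra.norm_eq_matrix_det b, leftMulMatrix_of_cube_eq_ten b hb hα hx, Matrix.det_fin_three]
  simp
  ring

theorem trace_of_cube_eq_ten (hb : ∀ i, b i = α ^ (i : ℕ)) (hα : α ^ 3 = 10) {x : K}
    {c₀ c₁ c₂ : ℚ} (hx : x = c₀ + c₁ * α + c₂ * α ^ 2) : Algebra.trace ℚ K x = 3 * c₀ := by
  rw [Algebra.trace_eq_matrix_trace b, leftMulMatrix_of_cube_eq_ten b hb hα hx, Matrix.trace_fin_three]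
  simp
  ring

theorem discr_one_alpha_beta (hb : ∀ i, b i = α ^ (i : ℕ)) (hα : α ^ 3 = 10) :
    Algebra.discr ℚ ![1, α, (1 + α + α ^ 2) / 3] = -300 := by
  have t11 := trace_of_cube_eq_ten b hb hα (x := 1 * 1) (c₀ := 1) (c₁ := 0) (c₂ := 0) (by simp)
  have t12 := trace_of_cube_eq_ten b hb hα (x := 1 * α) (c₀ := 0) (c₁ := 1) (c₂ := 0) (by simp)
  have t21 := trace_of_cube_eq_ten b hb hα (x := α * 1) (c₀ := 0) (c₁ := 1) (c₂ := 0) (by simp)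
  have t13 := trace_of_cube_eq_ten b hb hα (x := 1 * ((1 + α + α ^ 2) / 3)) (c₀ := 1 / 3)
    (c₁ := 1 / 3) (c₂ := 1 / 3) (by push_cast; ring)
  have t31 := trace_of_cube_eq_ten b hb hα (x := ((1 + α + α ^ 2) / 3) * 1) (c₀ := 1 / 3)
    (c₁ := 1 / 3) (c₂ := 1 / 3) (by push_cast; ring)
  have t22 := trace_of_cube_eq_ten b hb hα (x := α * α) (c₀ := 0) (c₁ := 0) (c₂ := 1)
    (by push_cast; ring)
  have t23 := trace_of_cube_eq_ten b hb hα (x := α * ((1 + α + α ^ 2) / 3)) (c₀ := 10 / 3)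
    (c₁ := 1 / 3) (c₂ := 1 / 3) (by push_cast; linear_combination (1 / 3 : K) * hα)
  have t32 := trace_of_cube_eq_ten b hb hα (x := ((1 + α + α ^ 2) / 3) * α) (c₀ := 10 / 3)
    (c₁ := 1 / 3) (c₂ := 1 / 3) (by push_cast; linear_combination (1 / 3 : K) * hα)
  have t33 := trace_of_cube_eq_ten b hb hα
    (x := ((1 + α + α ^ 2) / 3) * ((1 + α + α ^ 2) / 3)) (c₀ := 21 / 9) (c₁ := 12 / 9)
    (c₂ := 3 / 9) (by push_cast; linear_combination ((2 + α) / 9 : K) * hα)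
  rw [Algebra.discr_def, Matrix.det_fin_three]
  simp only [Algebra.traceMatrix_apply, Algebra.traceForm_apply, Matrix.cons_val_zero,
    Matrix.cons_val_one, Matrix.cons_val]
  rw [t11, t12, t13, t21, t22, t23, t31, t32, t33]
  norm_num

theorem exists_sq_mul_discr_eq (v : Fin 3 → K) (e : Fin 3 ≃ Free.ChooseBasisIndex ℤ (𝓞 K))
    (hv : ∀ i, IsIntegral ℤ (v i)) : ∃ n : ℤ, Algebra.discr ℚ v = n ^ 2 * discr K := by
  classical
  set B := (integralBasis K).reindex e.symm with hB
  have hint : IsIntegral ℤ (B.toMatrix v).det := by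
    refine IsIntegral.det fun i j => ?_
    have := integralBasis_repr_apply K ⟨v j, hv j⟩ (e i)
    rw [Basis.toMatrix_apply, hB, Basis.repr_reindex_apply, Equiv.symm_symm]
    erw [this]
    exact isIntegral_algebraMap
  obtain ⟨n, hn⟩ := IsIntegrallyClosed.isIntegral_iff.1 hint
  refine ⟨n, ?_⟩
  rw [← B.toMatrix_map_vecMul v, Algebra.discr_of_matrix_vecMul, ← hn, hB, Basis.coe_reindex,
    Algebra.discr_reindex, coe_discr]
  simp

end CubicField

section CubicIntegers

variable {K : Type*} [Field K] [NumberField K] {α : K} (b : Basis (Fin 3) ℚ K)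

theorem isIntegral_of_cube_eq_ten (hα : α ^ 3 = 10) : IsIntegral ℤ α := by
  refine IsIntegral.of_pow (n := 3) (by norm_num) ?_
  rw [hα]
  simpa using isIntegral_algebraMap (R := ℤ) (A := K) (x := 10)

theorem isIntegral_beta (hα : α ^ 3 = 10) : IsIntegral ℤ ((1 + α + α ^ 2) / 3) := by
  refine ⟨Polynomial.X ^ 3 - (Polynomial.X ^ 2 + 3 * Polynomial.X + 3), ?_, ?_⟩
  · monicity!
  · simp only [Polynomial.eval₂_sub, Polynomial.eval₂_add, Polynomial.eval₂_pow,
      Polynomial.eval₂_X, Polynomial.eval₂_mul, Polynomial.eval₂_ofNat]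
    linear_combination ((α ^ 3 + 3 * α ^ 2 + 3 * α + 11) / 27 : K) * hα

theorem exists_ringOfIntegers_generators (hα : α ^ 3 = 10) :
    ∃ a e : 𝓞 K, (a : K) = α ∧ (e : K) = (1 + α + α ^ 2) / 3 ∧
      a * a = 3 * e - 1 - a ∧ a * e = e + 3 ∧ e * e = e + 2 + a := by
  have h2 : algebraMap (𝓞 K) K 2 = 2 := map_ofNat _ 2
  have h3 : algebraMap (𝓞 K) K 3 = 3 := map_ofNat _ 3
  obtain ⟨a, ha⟩ : ∃ a : 𝓞 K, algebraMap (𝓞 K) K a = α := ⟨⟨α, isIntegral_of_cube_eq_ten hα⟩, rfl⟩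
  obtain ⟨e, he⟩ : ∃ e : 𝓞 K, algebraMap (𝓞 K) K e = (1 + α + α ^ 2) / 3 :=
    ⟨⟨_, isIntegral_beta hα⟩, rfl⟩
  refine ⟨a, e, ha, he, ?_, ?_, ?_⟩ <;> apply RingOfIntegers.ext <;>
    simp only [RingOfIntegers.val, map_mul, map_add, map_sub, map_one, h2, h3, ha, he]
  · ring
  · linear_combination (1 / 3 : K) * hα
  · linear_combination ((2 + α) / 9 : K) * hα

theorem norm_of_eq_int_combination (hb : ∀ i, b i = α ^ (i : ℕ)) (hα : α ^ 3 = 10) {a e : 𝓞 K}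
    (ha : (a : K) = α) (he : (e : K) = (1 + α + α ^ 2) / 3) {x : 𝓞 K} {c₀ c₁ c₂ : ℤ}
    (hx : x = c₀ + c₁ * a + c₂ * e) :
    Algebra.norm ℚ (x : K) = (c₀ + c₂ / 3 : ℚ) ^ 3 + 10 * (c₁ + c₂ / 3 : ℚ) ^ 3
      + 100 * (c₂ / 3 : ℚ) ^ 3 - 30 * (c₀ + c₂ / 3 : ℚ) * (c₁ + c₂ / 3 : ℚ) * (c₂ / 3 : ℚ) := by
  apply norm_of_cube_eq_ten b hb hα
  have h : ∀ n : ℤ, algebraMap (𝓞 K) K n = n := fun n => map_intCast _ n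
  rw [hx]
  simp only [RingOfIntegers.val, map_add, map_mul, h]
  simp only [RingOfIntegers.val] at ha he
  rw [ha, he]
  push_cast
  ring

include b in
theorem finrank_eq_three : finrank ℚ K = 3 := by
  simp [finrank_eq_card_basis b]

theorem discr_neg_and_abs_le (hb : ∀ i, b i = α ^ (i : ℕ)) (hα : α ^ 3 = 10) :
    discr K < 0 ∧ |discr K| ≤ 300 := by
  have e : Fin 3 ≃ Free.ChooseBasisIndex ℤ (𝓞 K) := Fintype.equivOfCardEq (by
    rw [← finrank_eq_card_chooseBasisIndex, RingOfIntegers.rank, finrank_eq_three b,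
      Fintype.card_fin])
  obtain ⟨n, hn⟩ := exists_sq_mul_discr_eq ![1, α, (1 + α + α ^ 2) / 3] e (fun i => by
    fin_cases i
    · exact isIntegral_one
    · exact isIntegral_of_cube_eq_ten hα
    · exact isIntegral_beta hα)
  rw [discr_one_alpha_beta b hb hα] at hn
  have hn : (n ^ 2 * discr K : ℤ) = -300 := by exact_mod_cast hn.symm
  have hn1 : 1 ≤ n ^ 2 := by
    by_contra! h
    have : n ^ 2 = 0 := by nlinarith [sq_nonneg n]
    simp [this] at hn
  have hd : discr K < 0 := by nlinarith
  exact ⟨hd, by rw [abs_of_neg hd]; nlinarith⟩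

theorem nrComplexPlaces_eq_one (hb : ∀ i, b i = α ^ (i : ℕ)) (hα : α ^ 3 = 10) :
    InfinitePlace.nrComplexPlaces K = 1 := by
  have h := sign_discr K
  rw [Int.sign_eq_neg_one_of_neg (discr_neg_and_abs_le b hb hα).1] at h
  have h2 := InfinitePlace.card_add_two_mul_card_eq_rank K
  rw [finrank_eq_three b] at h2
  have : InfinitePlace.nrComplexPlaces K ≠ 0 := fun h0 => by rw [h0] at h; norm_num at h
  omega

theorem absNorm_span_of_norm {x : 𝓞 K} {p : ℕ} (h : |Algebra.norm ℚ (x : K)| = p) :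
    Ideal.absNorm (Ideal.span {x}) = p := by
  rw [Ideal.absNorm_span_singleton]
  rw [← Algebra.coe_norm_int] at h
  have h : |Algebra.norm ℤ x| = p := by exact_mod_cast h
  rw [Int.abs_eq_natAbs] at h
  exact_mod_cast h

theorem prime_of_norm {x : 𝓞 K} {p : ℕ} (hp : p.Prime)
    (h : |Algebra.norm ℚ (x : K)| = p) : Prime x := by
  have h' := absNorm_span_of_norm h
  have hx : x ≠ 0 := by
    rintro rfl
    simp at h'
    exact hp.ne_zero h'.symm
  rw [← Ideal.span_singleton_prime hx]
  exact Ideal.isPrime_of_irreducible_absNorm (by rw [h']; exact hp)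

theorem span_eq_of_norm {x : 𝓞 K} {p : ℕ} (hp : p.Prime)
    (h : |Algebra.norm ℚ (x : K)| = p) {P : Ideal (𝓞 K)} (hP : P ≠ ⊤) (hx : x ∈ P) :
    Ideal.span {x} = P := by
  have hpr := prime_of_norm hp h
  have : (Ideal.span {x}).IsPrime := (Ideal.span_singleton_prime hpr.ne_zero).2 hpr
  have hm := this.isMaximal (by simpa using hpr.ne_zero)
  exact hm.eq_of_le hP (by simpa [Ideal.span_le] using hx)

theorem isPrincipalIdealRing_of_cube_eq_ten (hb : ∀ i, b i = α ^ (i : ℕ)) (hα : α ^ 3 = 10) :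
    IsPrincipalIdealRing (𝓞 K) := by
  apply RingOfIntegers.isPrincipalIdealRing_of_isPrincipal_of_pow_le_of_mem_primesOver_of_mem_Icc
  rw [nrComplexPlaces_eq_one b hb hα, finrank_eq_three b]
  intro p hp hpp P hP _
  obtain ⟨hPp, hPl⟩ := hP
  have hpP : (p : 𝓞 K) ∈ P := by
    have h1 : (p : ℤ) ∈ Ideal.span {(p : ℤ)} := Ideal.mem_span_singleton_self _
    rw [hPl.over, Ideal.under_def, Ideal.mem_comap] at h1
    simpa using h1
  have hp4 : p ≤ 4 := by
    have h := (Finset.mem_Icc.1 hp).2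
    have hs : √(|discr K| : ℝ) ≤ 17.33 := by
      rw [Real.sqrt_le_left (by norm_num)]
      have : (|discr K| : ℝ) ≤ 300 := by exact_mod_cast (discr_neg_and_abs_le b hb hα).2
      exact this.trans (by norm_num)
    have hM : (4 / Real.pi) ^ 1 * ((Nat.factorial 3 : ℝ) / (3 : ℕ) ^ 3 * √(|discr K| : ℝ)) < 5 := by
      have h4 : 4 / Real.pi ≤ 1.28 := by
        rw [div_le_iff₀ Real.pi_pos]
        nlinarith [Real.pi_gt_d2]
      have h5 : 0 ≤ 4 / Real.pi := by positivity
      norm_num [Nat.factorial]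
      nlinarith [Real.sqrt_nonneg (|discr K| : ℝ)]
    have := (Nat.floor_lt' (by norm_num)).2 hM
    push_cast at h this
    omega
  obtain ⟨a, e, ha, he, haa, hae, hee⟩ := exists_ringOfIntegers_generators hα
  have key : ∀ (x : 𝓞 K) (q : ℕ), q.Prime → |Algebra.norm ℚ (x : K)| = q → x ∈ P →
      Submodule.IsPrincipal P := fun x q hq hN hx =>
    ⟨x, (span_eq_of_norm hq hN hPp.ne_top hx).symm⟩
  have : p = 2 ∨ p = 3 := by
    have := hpp.two_le
    interval_cases p <;> first | omega | exact absurd hpp (by norm_num)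
  rcases this with rfl | rfl
  · refine key (a - 2) 2 (by norm_num) ?_ (hPp.mem_of_pow_mem 3 ?_)
    · rw [norm_of_eq_int_combination b hb hα ha he (c₀ := -2) (c₁ := 1) (c₂ := 0)
        (by push_cast; ring)]
      norm_num
    · have : (a - 2) ^ 3 = (2 : ℕ) * (1 - 3 * (a * a) + 6 * a) := by
        push_cast
        linear_combination a * haa + 3 * hae - haa
      rw [this]
      exact P.mul_mem_right _ hpP
  · have h3 : e * e * (e - a) ∈ P := by
      have : e * e * (e - a) = (3 : ℕ) := by
        push_cast
        linear_combination (e - a) * hee + hee - haa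
      rwa [this]
    rcases hPp.mem_or_mem h3 with h | h
    · refine key e 3 (by norm_num) ?_ ((hPp.mem_or_mem h).elim id id)
      rw [norm_of_eq_int_combination b hb hα ha he (c₀ := 0) (c₁ := 0) (c₂ := 1)
        (by push_cast; ring)]
      norm_num
    · refine key (e - a) 3 (by norm_num) ?_ h
      rw [norm_of_eq_int_combination b hb hα ha he (c₀ := 0) (c₁ := -1) (c₂ := 1)
        (by push_cast; ring)]
      norm_num

end CubicIntegers

/-- The valuation of `x` is a square in the value group. -/
def Valuation.IsSquareAt {K : Type*} [Field K] (v : Valuation K ℤᵐ⁰) (x : K) : Prop :=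
  ∃ c, v x = v c ^ 2

theorem WithZero.exp_neg_one_ne_sq (g : ℤᵐ⁰) : g ^ 2 ≠ exp (-1 : ℤ) := by
  intro h
  have hg : g ≠ 0 := by rintro rfl; exact exp_ne_zero (h.symm.trans (zero_pow two_ne_zero))
  rw [← exp_log hg, ← exp_nsmul, exp_inj] at h
  simp at h
  omega

section Squarefree

variable {R : Type*} [CommRing R] [IsDomain R] [IsPrincipalIdealRing R]

theorem exists_squarefree_mul_sq {a : R} (ha : a ≠ 0) :
    ∃ s t : R, a = s * t ^ 2 ∧ Squarefree s ∧ t ≠ 0 := by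
  induction a using UniqueFactorizationMonoid.induction_on_prime with
  | h₁ => exact absurd rfl ha
  | h₂ x hx => exact ⟨x, 1, by simp, hx.squarefree, one_ne_zero⟩
  | h₃ a p ha0 hp ih =>
    obtain ⟨s, t, rfl, hs, ht⟩ := ih ha0
    by_cases hps : p ∣ s
    · obtain ⟨s, rfl⟩ := hps
      exact ⟨s, p * t, by ring, hs.of_mul_right, mul_ne_zero hp.ne_zero ht⟩
    · refine ⟨p * s, t, by ring, ?_, ht⟩
      rw [squarefree_mul_iff]
      exact ⟨(hp.irreducible.isRelPrime_iff_not_dvd).2 hps, hp.irreducible.squarefree, hs⟩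

theorem exists_unit_mul_of_squarefree {s p₁ p₂ p₃ : R} (hs : Squarefree s) (hs0 : s ≠ 0)
    (h : ∀ q, Prime q → q ∣ s → q ∣ p₁ ∨ q ∣ p₂ ∨ q ∣ p₃)
    (h₁ : Prime p₁) (h₂ : Prime p₂) (h₃ : Prime p₃) :
    ∃ (u : Rˣ) (i j k : ℕ), s = u * p₁ ^ i * p₂ ^ j * p₃ ^ k ∧ i ≤ 1 ∧ j ≤ 1 ∧ k ≤ 1 := by
  have strip : ∀ {p s : R}, Prime p → Squarefree s → s ≠ 0 → ∃ (i : ℕ) (s' : R), i ≤ 1 ∧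
      s = p ^ i * s' ∧ Squarefree s' ∧ s' ≠ 0 ∧ ¬ p ∣ s' := by
    intro p s hp hs hs0
    by_cases hps : p ∣ s
    · obtain ⟨s', rfl⟩ := hps
      refine ⟨1, s', le_rfl, by ring, hs.of_mul_right, right_ne_zero_of_mul hs0, ?_⟩
      rintro ⟨r, rfl⟩
      exact hp.not_isUnit (hs p ⟨r, by ring⟩)
    · exact ⟨0, s, by norm_num, by ring, hs, hs0, hps⟩
  obtain ⟨i, s₁, hi, rfl, hs₁, h01, hd1⟩ := strip h₁ hs hs0
  obtain ⟨j, s₂, hj, rfl, hs₂, h02, hd2⟩ := strip h₂ hs₁ h01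
  obtain ⟨k, s₃, hk, rfl, hs₃, h03, hd3⟩ := strip h₃ hs₂ h02
  have hu : IsUnit s₃ := by
    by_contra hu
    obtain ⟨q, hq, hqs⟩ := WfDvdMonoid.exists_irreducible_factor hu h03
    have hq := hq.prime
    rcases h q hq (((hqs.mul_left _).mul_left _).mul_left _) with h | h | h
    · exact hd1 (((((hq.associated_of_dvd h₁ h).symm.dvd).trans hqs).mul_left _).mul_left _)
    · exact hd2 ((((hq.associated_of_dvd h₂ h).symm.dvd).trans hqs).mul_left _)
    · exact hd3 (((hq.associated_of_dvd h₃ h).symm.dvd).trans hqs)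
  obtain ⟨u, rfl⟩ := hu
  exact ⟨u, i, j, k, by ring, hi, hj, hk⟩

/-- The height one prime generated by a prime element. -/
def Prime.heightOneSpectrum {q : R} (hq : Prime q) : HeightOneSpectrum R where
  asIdeal := Ideal.span {q}
  isPrime := (Ideal.span_singleton_prime hq.ne_zero).2 hq
  ne_bot := by simpa using hq.ne_zero

variable (K : Type*) [Field K] [Algebra R K] [IsFractionRing R K]

theorem Prime.valuation_self {q : R} (hq : Prime q) :
    hq.heightOneSpectrum.valuation K (algebraMap R K q) = exp (-1 : ℤ) := by
  rw [HeightOneSpectrum.valuation_of_algebraMap]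
  exact HeightOneSpectrum.intValuation_singleton _ hq.ne_zero rfl

theorem Prime.valuation_eq_one {q : R} (hq : Prime q) {a : R} (ha : ¬ q ∣ a) :
    hq.heightOneSpectrum.valuation K (algebraMap R K a) = 1 := by
  rw [HeightOneSpectrum.valuation_eq_one_iff_notMem]
  simpa [Prime.heightOneSpectrum, Ideal.mem_span_singleton] using ha

theorem Prime.not_isSquareAt_of_squarefree {q : R} (hq : Prime q) {s : R} (hs : Squarefree s)
    (hqs : q ∣ s) : ¬ (hq.heightOneSpectrum.valuation K).IsSquareAt (algebraMap R K s) := by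
  rintro ⟨c, hc⟩
  obtain ⟨s', rfl⟩ := hqs
  have h : ¬ q ∣ s' := by
    rintro ⟨r, rfl⟩
    exact hq.not_isUnit (hs q ⟨r, by ring⟩)
  rw [map_mul, map_mul, hq.valuation_self K, hq.valuation_eq_one K h, mul_one] at hc
  exact exp_neg_one_ne_sq _ hc.symm

theorem exists_unit_mul_sq_of_isSquareAt {p₁ p₂ p₃ : R} (h₁ : Prime p₁) (h₂ : Prime p₂)
    (h₃ : Prime p₃) {x : K} (hx : x ≠ 0)
    (h : ∀ q (hq : Prime q), ¬ q ∣ p₁ → ¬ q ∣ p₂ → ¬ q ∣ p₃ →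
      (hq.heightOneSpectrum.valuation K).IsSquareAt x) :
    ∃ (u : Rˣ) (i j k : ℕ) (t : K), t ≠ 0 ∧ x = algebraMap R K (u * p₁ ^ i * p₂ ^ j * p₃ ^ k) * t ^ 2
      ∧ i ≤ 1 ∧ j ≤ 1 ∧ k ≤ 1 := by
  obtain ⟨a, b, hb, rfl⟩ := IsFractionRing.div_surjective (A := R) x
  have hb0 : b ≠ 0 := nonZeroDivisors.ne_zero hb
  have ha0 : a ≠ 0 := by rintro rfl; simp at hx
  have inj : ∀ {r : R}, r ≠ 0 → algebraMap R K r ≠ 0 := fun {r} hr => by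
    simpa using hr
  obtain ⟨s, t, hst, hs, ht⟩ := exists_squarefree_mul_sq (mul_ne_zero ha0 hb0)
  have hs0 : s ≠ 0 := by rintro rfl; simp [ha0, hb0] at hst
  have hst' : algebraMap R K a * algebraMap R K b = algebraMap R K s * algebraMap R K t ^ 2 := by
    rw [← map_mul, hst]; simp
  have hx' : algebraMap R K a / algebraMap R K b
      = algebraMap R K s * (algebraMap R K t / algebraMap R K b) ^ 2 := by
    have := inj hb0
    field_simp
    linear_combination hst'
  have ht' : algebraMap R K t / algebraMap R K b ≠ 0 := div_ne_zero (inj ht) (inj hb0)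
  rw [hx'] at h ⊢
  generalize algebraMap R K t / algebraMap R K b = t' at h ht'
  obtain ⟨u, i, j, k, rfl, hi⟩ := exists_unit_mul_of_squarefree hs hs0 (fun q hq hqs => by
    by_contra! hn
    refine hq.not_isSquareAt_of_squarefree K hs hqs ?_
    obtain ⟨c, hc⟩ := h q hq hn.1 hn.2.1 hn.2.2
    refine ⟨c / t', ?_⟩
    rw [map_mul, map_pow] at hc
    have : hq.heightOneSpectrum.valuation K t' ≠ 0 := by simpa using ht'
    rw [map_div₀, div_pow, ← hc]
    field_simp) h₁ h₂ h₃
  exact ⟨u, i, j, k, t', ht', rfl, hi⟩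

end Squarefree

section Residue

variable {K : Type*} [Field K] [NumberField K]

theorem Ideal.exists_int_sub_mem_of_absNorm_prime {P : Ideal (𝓞 K)} {p : ℕ} (hp : p.Prime)
    (h : Ideal.absNorm P = p) (r : 𝓞 K) : ∃ n : ℤ, r - n ∈ P := by
  rw [Ideal.absNorm_apply, Submodule.cardQuot_apply] at h
  have : Fact p.Prime := ⟨hp⟩
  have h1 : (1 : 𝓞 K ⧸ P) ≠ 0 := by
    intro h0
    have : Subsingleton (𝓞 K ⧸ P) := subsingleton_of_zero_eq_one h0.symm
    have := Nat.card_of_subsingleton (1 : 𝓞 K ⧸ P)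
    exact hp.one_lt.ne' (h.symm.trans this)
  have ht := zmultiples_eq_top_of_prime_card (G := 𝓞 K ⧸ P) h h1
  have hr : (Ideal.Quotient.mk P r) ∈ AddSubgroup.zmultiples (1 : 𝓞 K ⧸ P) := ht ▸ AddSubgroup.mem_top _
  obtain ⟨n, hn⟩ := AddSubgroup.mem_zmultiples_iff.1 hr
  refine ⟨n, ?_⟩
  rw [← Ideal.Quotient.eq, ← hn]
  simp

theorem Prime.exists_int_valuation_sub_lt [IsPrincipalIdealRing (𝓞 K)] {q : 𝓞 K} (hq : Prime q)
    {p : ℕ} (hp : p.Prime) (h : |Algebra.norm ℚ (q : K)| = p) {x : K}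
    (hx : hq.heightOneSpectrum.valuation K x ≤ 1) :
    ∃ n : ℤ, hq.heightOneSpectrum.valuation K (x - n) < 1 := by
  obtain ⟨r, hr⟩ := hq.heightOneSpectrum.exists_valuation_sub_lt_of_integer hx 1
  obtain ⟨n, hn⟩ := Ideal.exists_int_sub_mem_of_absNorm_prime hp (absNorm_span_of_norm h) r
  refine ⟨n, ?_⟩
  have hn' : hq.heightOneSpectrum.valuation K (algebraMap (𝓞 K) K (r - n)) < 1 :=
    (hq.heightOneSpectrum.valuation_lt_one_iff_mem _).2 hn
  rw [map_sub, map_intCast] at hn'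
  have := Valuation.map_sub_lt _ hn' hr
  simpa using this

theorem Units.eq_mul_sq_of_rank_le_one (hodd : Odd (finrank ℚ K)) (hr : Units.rank K ≤ 1)
    (η : (𝓞 K)ˣ) (h₁ : ¬ IsSquare η) (h₂ : ¬ IsSquare (-η)) (u : (𝓞 K)ˣ) :
    ∃ (h i : ℕ) (t : (𝓞 K)ˣ), u = (-1) ^ h * η ^ i * t ^ 2 ∧ h ≤ 1 ∧ i ≤ 1 := by
  obtain ⟨ε, hε⟩ : ∃ ε : (𝓞 K)ˣ, ∀ u : (𝓞 K)ˣ, ∃ n : ℤ, u = ε ^ n ∨ u = -ε ^ n := by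
    have key : ∀ u : (𝓞 K)ˣ, ∃ f : Fin (Units.rank K) → ℤ,
        u = ∏ i, (Units.fundSystem K i) ^ (f i) ∨ u = -∏ i, (Units.fundSystem K i) ^ (f i) := by
      intro u
      obtain ⟨⟨ζ, f⟩, hu, -⟩ := Units.exist_unique_eq_mul_prod K u
      refine ⟨f, ?_⟩
      rcases Units.torsion_eq_one_or_neg_one_of_odd_finrank hodd ζ with h | h
      · left; simpa [h] using hu
      · right; simpa [h] using hu
    rcases Nat.le_one_iff_eq_zero_or_eq_one.1 hr with h0 | h1
    · refine ⟨1, fun u => ⟨0, ?_⟩⟩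
      obtain ⟨f, hf⟩ := key u
      have : IsEmpty (Fin (Units.rank K)) := by rw [h0]; infer_instance
      simpa using hf
    · have e : Unique (Fin (Units.rank K)) := by rw [h1]; infer_instance
      refine ⟨Units.fundSystem K default, fun u => ?_⟩
      obtain ⟨f, hf⟩ := key u
      exact ⟨f default, by simpa [Fintype.prod_unique] using hf⟩
  have even_sq : ∀ n : ℤ, Even n → ∃ t : (𝓞 K)ˣ, ε ^ n = t ^ 2 := by
    rintro n ⟨m, rfl⟩
    exact ⟨ε ^ m, by rw [zpow_add, sq]⟩
  obtain ⟨m, hm⟩ := hε η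
  have hmodd : Odd m := by
    rw [← Int.not_even_iff_odd]
    intro he
    obtain ⟨t, ht⟩ := even_sq m he
    rcases hm with hm | hm
    · exact h₁ ⟨t, by rw [hm, ht, sq]⟩
    · exact h₂ ⟨t, by rw [hm, ht, neg_neg, sq]⟩
  obtain ⟨n, hn⟩ := hε u
  rcases Int.even_or_odd n with he | ho
  · obtain ⟨t, ht⟩ := even_sq n he
    rcases hn with hn | hn
    · exact ⟨0, 0, t, by simp [hn, ht]⟩
    · exact ⟨1, 0, t, by simp [hn, ht]⟩
  · obtain ⟨t, ht⟩ := even_sq (n - m) (ho.sub_odd hmodd)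
    have hnm : ε ^ n = ε ^ m * t ^ 2 := by rw [← ht, ← zpow_add]; congr 1; ring
    rcases hm with hm | hm <;> rcases hn with hn | hn
    · exact ⟨0, 1, t, by simp [hn, hm, hnm]⟩
    · exact ⟨1, 1, t, by simp [hn, hm, hnm]⟩
    · exact ⟨1, 1, t, by simp [hn, hm, hnm]⟩
    · exact ⟨0, 1, t, by simp [hn, hm, hnm]⟩

theorem not_dvd_of_norm {x y : 𝓞 K} {p : ℕ} {m : ℤ} (hx : |Algebra.norm ℚ (x : K)| = p)
    (hy : Algebra.norm ℚ (y : K) = m) (h : ¬ (p : ℤ) ∣ m) : ¬ x ∣ y := by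
  rintro ⟨z, rfl⟩
  rw [← Algebra.coe_norm_int] at hx hy
  have hx : |Algebra.norm ℤ x| = p := by exact_mod_cast hx
  have hy : Algebra.norm ℤ (x * z) = m := by exact_mod_cast hy
  refine h ?_
  rw [← hx, ← hy, map_mul, abs_dvd]
  exact dvd_mul_right _ _

end Residue

/-- The arithmetic of a field generated by a cube root `α` of `10`: a real embedding, the
valuations at the primes above `2`, `3` (two of them, `v₃` being the ramified one) and `5`,
and the description, modulo squares, of the elements having even valuation outside `3` and `5`. -/
structure CubeRootTenArithmetic (K : Type*) [Field K] where
  α : K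
  cube : α ^ 3 = 10
  φ : K →+* ℝ
  v₂ : Valuation K ℤᵐ⁰
  v₃ : Valuation K ℤᵐ⁰
  v₃' : Valuation K ℤᵐ⁰
  v₅ : Valuation K ℤᵐ⁰
  v₂_alpha : v₂ α = exp (-1 : ℤ)
  v₂_two : v₂ 2 < 1
  v₂_residue : ∀ x, v₂ x ≤ 1 → ∃ n : ℤ, v₂ (x - n) < 1
  v₃_alpha_sub_one : v₃ (α - 1) = exp (-1 : ℤ)
  v₃_three : v₃ 3 = exp (-1 : ℤ) ^ 2
  v₃_residue : ∀ x, v₃ x ≤ 1 → ∃ n : ℤ, v₃ (x - n) < 1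
  v₃'_alpha_sub_one : v₃' (α - 1) = exp (-1 : ℤ)
  v₃'_three : v₃' 3 = exp (-1 : ℤ)
  v₃'_residue : ∀ x, v₃' x ≤ 1 → ∃ n : ℤ, v₃' (x - n) < 1
  v₅_alpha : v₅ α = exp (-1 : ℤ)
  v₅_five : v₅ 5 < 1
  v₅_residue : ∀ x, v₅ x ≤ 1 → ∃ n : ℤ, v₅ (x - n) < 1
  classes : ∀ x, x ≠ 0 → v₂.IsSquareAt x →
    (∀ v : Valuation K ℤᵐ⁰, v 2 = 1 → v 3 = 1 → v 5 = 1 → v α ≤ 1 → v.IsSquareAt x) →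
    ∃ (h i j k l : ℕ) (t : K), t ≠ 0 ∧ h ≤ 1 ∧ i ≤ 1 ∧ j ≤ 1 ∧ k ≤ 1 ∧ l ≤ 1 ∧
      x = (-1) ^ h * ((23 + 11 * α + 5 * α ^ 2) / 3) ^ i * ((1 + α + α ^ 2) / 3) ^ j *
        ((1 - 2 * α + α ^ 2) / 3) ^ k * (5 + 2 * α + α ^ 2) ^ l * t ^ 2

variable {K : Type*} [Field K] [NumberField K] {α : K}

theorem exists_real_embedding (b : Basis (Fin 3) ℚ K) (hb : ∀ i, b i = α ^ (i : ℕ))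
    (hα : α ^ 3 = 10) : Nonempty (K →+* ℝ) := by
  have h2 := InfinitePlace.card_add_two_mul_card_eq_rank K
  rw [finrank_eq_three b, nrComplexPlaces_eq_one b hb hα] at h2
  classical
  have h1 : 0 < InfinitePlace.nrRealPlaces K := by omega
  obtain ⟨w, hw⟩ := Fintype.card_pos_iff.1 h1
  exact ⟨InfinitePlace.embedding_of_isReal hw⟩

theorem nonempty_arithmetic (b : Basis (Fin 3) ℚ K) (hb : ∀ i, b i = α ^ (i : ℕ))
    (hα : α ^ 3 = 10) : Nonempty (CubeRootTenArithmetic K) := by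
  have hpid := isPrincipalIdealRing_of_cube_eq_ten b hb hα
  obtain ⟨φ⟩ := exists_real_embedding b hb hα
  obtain ⟨a, e, ha, he, haa, hae, hee⟩ := exists_ringOfIntegers_generators hα
  simp only [RingOfIntegers.val] at ha he
  have norm_eq : ∀ (x : 𝓞 K) (c₀ c₁ c₂ : ℤ) (_ : x = c₀ + c₁ * a + c₂ * e), _ := fun x c₀ c₁ c₂ h =>
    norm_of_eq_int_combination b hb hα ha he h
  have n2 : |Algebra.norm ℚ ((a - 2 : 𝓞 K) : K)| = (2 : ℕ) := by
    rw [norm_eq _ (-2) 1 0 (by push_cast; ring)]; norm_num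
  have n3 : |Algebra.norm ℚ ((e : 𝓞 K) : K)| = (3 : ℕ) := by
    rw [norm_eq _ 0 0 1 (by push_cast; ring)]; norm_num
  have n3' : |Algebra.norm ℚ ((e - a : 𝓞 K) : K)| = (3 : ℕ) := by
    rw [norm_eq _ 0 (-1) 1 (by push_cast; ring)]; norm_num
  have n5 : |Algebra.norm ℚ ((4 + a + 3 * e : 𝓞 K) : K)| = (5 : ℕ) := by
    rw [norm_eq _ 4 1 3 (by push_cast; ring)]; norm_num
  have p2 := prime_of_norm Nat.prime_two n2
  have p3 := prime_of_norm Nat.prime_three n3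
  have p3' := prime_of_norm Nat.prime_three n3'
  have p5 := prime_of_norm Nat.prime_five n5
  have E3 : (3 : 𝓞 K) = e * e * (e - a) := by grind
  have Ew : (a - 1 : 𝓞 K) = e * (e - a) := by grind
  have Ea : a = (a - 2) * (4 + a + 3 * e) := by grind
  have E10 : a * a * a = 2 * 5 := by grind
  have N1 : Algebra.norm ℚ ((1 : 𝓞 K) : K) = (1 : ℤ) := by
    rw [norm_eq _ 1 0 0 (by push_cast; ring)]; norm_num
  have N2 : Algebra.norm ℚ ((2 : 𝓞 K) : K) = (8 : ℤ) := by
    rw [norm_eq _ 2 0 0 (by push_cast; ring)]; norm_num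
  have N5 : Algebra.norm ℚ ((5 : 𝓞 K) : K) = (125 : ℤ) := by
    rw [norm_eq _ 5 0 0 (by push_cast; ring)]; norm_num
  have Na : Algebra.norm ℚ ((a : 𝓞 K) : K) = (10 : ℤ) := by
    rw [norm_eq _ 0 1 0 (by push_cast; ring)]; norm_num
  have Na2 : Algebra.norm ℚ ((a - 2 : 𝓞 K) : K) = (2 : ℤ) := by
    rw [norm_eq _ (-2) 1 0 (by push_cast; ring)]; norm_num
  have Np5 : Algebra.norm ℚ ((4 + a + 3 * e : 𝓞 K) : K) = (5 : ℤ) := by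
    rw [norm_eq _ 4 1 3 (by push_cast; ring)]; norm_num
  have d1 : ¬ e ∣ a := not_dvd_of_norm n3 Na (by norm_num)
  have d2 : ¬ (a - 2) ∣ (4 + a + 3 * e) := not_dvd_of_norm n2 Np5 (by norm_num)
  have d3 : ¬ (a - 2) ∣ 5 := not_dvd_of_norm n2 N5 (by norm_num)
  have d4 : ¬ (4 + a + 3 * e) ∣ 2 := not_dvd_of_norm n5 N2 (by norm_num)
  have d5 : ¬ (4 + a + 3 * e) ∣ (a - 2) := not_dvd_of_norm n5 Na2 (by norm_num)
  have d6 : ¬ e ∣ e - a := fun h => d1 (by simpa using dvd_sub (dvd_refl e) h)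
  have d7 : ¬ (e - a) ∣ e := fun h => by
    have h' : e - a ∣ a := by simpa using dvd_sub h (dvd_refl (e - a))
    exact not_dvd_of_norm n3' Na (by norm_num) h'
  have c2 : algebraMap (𝓞 K) K 2 = 2 := map_ofNat _ 2
  have c3 : algebraMap (𝓞 K) K 3 = 3 := map_ofNat _ 3
  have c4 : algebraMap (𝓞 K) K 4 = 4 := map_ofNat _ 4
  have c5 : algebraMap (𝓞 K) K 5 = 5 := map_ofNat _ 5
  have c6 : algebraMap (𝓞 K) K 6 = 6 := map_ofNat _ 6
  have cw : algebraMap (𝓞 K) K (a - 1) = α - 1 := by rw [map_sub, ha, map_one]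
  have K3 : (3 : K) = algebraMap (𝓞 K) K (e * e * (e - a)) := by rw [← E3, c3]
  have Kw : (α - 1 : K) = algebraMap (𝓞 K) K (e * (e - a)) := by rw [← Ew, cw]
  have Ka : α = algebraMap (𝓞 K) K ((a - 2) * (4 + a + 3 * e)) := by rw [← Ea, ha]
  have K10 : α ^ 3 = 2 * 5 := by rw [hα]; norm_num
  have V5 : p2.heightOneSpectrum.valuation K 5 = 1 := by rw [← c5, p2.valuation_eq_one K d3]
  have V2 : p5.heightOneSpectrum.valuation K 2 = 1 := by rw [← c2, p5.valuation_eq_one K d4]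
  have lt1 : exp (-1 : ℤ) < 1 := by rw [← exp_zero, exp_lt_exp]; norm_num
  have Va2 : p2.heightOneSpectrum.valuation K α = exp (-1 : ℤ) := by
    rw [Ka, map_mul, map_mul, p2.valuation_self K, p2.valuation_eq_one K d2, mul_one]
  have Va5 : p5.heightOneSpectrum.valuation K α = exp (-1 : ℤ) := by
    rw [Ka, map_mul, map_mul, p5.valuation_self K, p5.valuation_eq_one K d5, one_mul]
  let η : (𝓞 K)ˣ := ⟨6 + 2 * a + 5 * e, -3 - a + 2 * e, by grind, by grind⟩
  have hη : ((η : 𝓞 K) : K) = (23 + 11 * α + 5 * α ^ 2) / 3 := by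
    simp only [η, map_add, map_mul, RingOfIntegers.val, ha, he, c2, c5, c6]
    ring
  have hη₁ : ¬ IsSquare η := by
    rintro ⟨t, ht⟩
    obtain ⟨n, hn⟩ := Ideal.exists_int_sub_mem_of_absNorm_prime Nat.prime_three
      (absNorm_span_of_norm n3) (t : 𝓞 K)
    rw [Ideal.mem_span_singleton] at hn
    have hn2 : e ∣ ((n ^ 2 - 2 : ℤ) : 𝓞 K) := by
      have h1 : (6 + 2 * a + 5 * e : 𝓞 K) = t * t := by rw [← Units.val_mul, ← ht]
      have h2 : ((n ^ 2 - 2 : ℤ) : 𝓞 K)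
          = e * (2 * (e - a) + 5) + 6 - (t - n) * (t + n) := by
        push_cast
        linear_combination -h1 + 2 * Ew
      have h3 : (6 : 𝓞 K) = e * (2 * (e * (e - a))) := by linear_combination 2 * E3
      rw [h2]
      exact dvd_sub (dvd_add (dvd_mul_right _ _) ⟨_, h3⟩) (hn.mul_right _)
    have h3 : e ∣ (3 : 𝓞 K) := ⟨e * (e - a), by linear_combination E3⟩
    have h : e ∣ ((1 : 𝓞 K)) ∨ e ∣ (2 : 𝓞 K) := by
      have h4 : ∃ m : ℤ, n ^ 2 - 2 = 3 * m - 2 ∨ n ^ 2 - 2 = 3 * m - 1 := by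
        obtain ⟨m, hm | hm | hm⟩ : ∃ m : ℤ, n = 3 * m ∨ n = 3 * m + 1 ∨ n = 3 * m + 2 :=
          ⟨n / 3, by omega⟩
        · exact ⟨3 * m ^ 2, Or.inl (by rw [hm]; ring)⟩
        · exact ⟨3 * m ^ 2 + 2 * m, Or.inr (by rw [hm]; ring)⟩
        · exact ⟨3 * m ^ 2 + 4 * m + 1, Or.inr (by rw [hm]; ring)⟩
      obtain ⟨m, hm | hm⟩ := h4
      · right
        rw [hm] at hn2
        have := dvd_sub (h3.mul_right (m : 𝓞 K)) hn2
        push_cast at this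
        simpa using this
      · left
        rw [hm] at hn2
        have := dvd_sub (h3.mul_right (m : 𝓞 K)) hn2
        push_cast at this
        simpa using this
    rcases h with h | h
    · exact not_dvd_of_norm n3 N1 (by norm_num) h
    · exact not_dvd_of_norm n3 N2 (by norm_num) h
  have hη₂ : ¬ IsSquare (-η) := by
    rintro ⟨t, ht⟩
    have h1 : -((η : 𝓞 K) : K) = ((t : 𝓞 K) : K) ^ 2 := by
      rw [← map_neg, ← Units.val_neg, ht, Units.val_mul, map_mul, sq]
    rw [hη] at h1
    have h2 := congrArg φ h1
    have h3 := congrArg φ hα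
    simp only [map_neg, map_div₀, map_add, map_mul, map_ofNat, map_pow] at h2 h3
    have h4 : 0 < φ α := by
      by_contra! h
      have := pow_nonneg (neg_nonneg.2 h) 3
      nlinarith
    have h5 : 0 < (23 + 11 * φ α + 5 * φ α ^ 2) / 3 := by positivity
    nlinarith [sq_nonneg (φ ((t : 𝓞 K) : K))]
  have hrank : Units.rank K ≤ 1 := by
    have h2 := InfinitePlace.card_add_two_mul_card_eq_rank K
    rw [finrank_eq_three b, nrComplexPlaces_eq_one b hb hα] at h2
    have h3 := InfinitePlace.card_eq_nrRealPlaces_add_nrComplexPlaces K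
    rw [nrComplexPlaces_eq_one b hb hα] at h3
    rw [Units.rank]
    omega
  refine ⟨{
    α := α
    cube := hα
    φ := φ
    v₂ := p2.heightOneSpectrum.valuation K
    v₃ := p3.heightOneSpectrum.valuation K
    v₃' := p3'.heightOneSpectrum.valuation K
    v₅ := p5.heightOneSpectrum.valuation K
    v₂_alpha := Va2
    v₂_two := ?_
    v₂_residue := fun x => p2.exists_int_valuation_sub_lt Nat.prime_two n2
    v₃_alpha_sub_one := ?_
    v₃_three := ?_
    v₃_residue := fun x => p3.exists_int_valuation_sub_lt Nat.prime_three n3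
    v₃'_alpha_sub_one := ?_
    v₃'_three := ?_
    v₃'_residue := fun x => p3'.exists_int_valuation_sub_lt Nat.prime_three n3'
    v₅_alpha := Va5
    v₅_five := ?_
    v₅_residue := fun x => p5.exists_int_valuation_sub_lt Nat.prime_five n5
    classes := ?_ }⟩
  · have h := congrArg (p2.heightOneSpectrum.valuation K) K10
    rw [map_mul, V5, mul_one, map_pow, Va2] at h
    rw [← h]
    exact pow_lt_one₀ zero_le lt1 (by norm_num)
  · rw [Kw, map_mul, map_mul, p3.valuation_self K, p3.valuation_eq_one K d6, mul_one]
  · rw [K3, map_mul, map_mul, map_mul, map_mul, p3.valuation_self K, p3.valuation_eq_one K d6,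
      mul_one, sq]
  · rw [Kw, map_mul, map_mul, p3'.valuation_self K, p3'.valuation_eq_one K d7, one_mul]
  · rw [K3, map_mul, map_mul, map_mul, map_mul, p3'.valuation_self K, p3'.valuation_eq_one K d7,
      one_mul, one_mul]
  · have h := congrArg (p5.heightOneSpectrum.valuation K) K10
    rw [map_mul, V2, one_mul, map_pow, Va5] at h
    rw [← h]
    exact pow_lt_one₀ zero_le lt1 (by norm_num)
  intro x hx hx2 hv
  obtain ⟨u, j, k, l, t, ht, hxt, hj, hk, hl⟩ := exists_unit_mul_sq_of_isSquareAt K p3 p3' p5 hx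
    (fun q hq q3 q3' q5 => by
      have u3 : hq.heightOneSpectrum.valuation K 3 = 1 := by
        rw [← c3, hq.valuation_eq_one K]
        rw [E3]
        intro h
        rcases hq.dvd_or_dvd h with h | h
        · exact (hq.dvd_or_dvd h).elim q3 q3
        · exact q3' h
      by_cases q2 : q ∣ a - 2
      · have : hq.heightOneSpectrum = p2.heightOneSpectrum := by
          ext1
          exact Ideal.span_singleton_eq_span_singleton.2 (hq.associated_of_dvd p2 q2)
        rwa [this]
      have qa : ¬ q ∣ a := by
        rw [Ea]
        intro h
        exact (hq.dvd_or_dvd h).elim q2 q5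
      have q10 : ¬ q ∣ 2 * 5 := by
        rw [← E10]
        intro h
        rcases hq.dvd_or_dvd h with h | h
        · exact (hq.dvd_or_dvd h).elim qa qa
        · exact qa h
      refine hv _ ?_ u3 ?_ ?_
      · rw [← c2, hq.valuation_eq_one K (fun h => q10 (h.mul_right _))]
      · rw [← c5, hq.valuation_eq_one K (fun h => q10 (h.mul_left _))]
      · rw [← ha, hq.valuation_eq_one K qa])
  obtain ⟨h, i, s, rfl, hh, hi⟩ := Units.eq_mul_sq_of_rank_le_one
    (by rw [finrank_eq_three b]; decide) hrank η hη₁ hη₂ u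
  refine ⟨h, i, j, k, l, ((s : 𝓞 K) : K) * t, mul_ne_zero ?_ ht, hh, hi, hj, hk, hl, ?_⟩
  · simp
  · rw [hxt, ← hη]
    simp only [Units.val_mul, Units.val_pow_eq_pow_val, Units.val_neg, Units.val_one, map_mul,
      map_pow, map_neg, map_one, map_add, map_sub, ha, he, c4, c3, RingOfIntegers.val]
    ring

open Polynomial in
theorem exists_cubeRootTenArithmetic :
    ∃ (K : Type) (_ : Field K) (_ : CharZero K), Nonempty (CubeRootTenArithmetic K) := by
  have hirr : Irreducible (X ^ 3 - C 10 : ℚ[X]) := by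
    refine X_pow_sub_C_irreducible_of_prime Nat.prime_three fun r hr => ?_
    have h : padicValRat 2 (r ^ 3) = padicValRat 2 (10 : ℚ) := by rw [hr]
    have hr0 : r ≠ 0 := by rintro rfl; norm_num at hr
    have : Fact (Nat.Prime 2) := ⟨Nat.prime_two⟩
    have h10 : padicValRat 2 (10 : ℚ) = 1 := by
      rw [show (10 : ℚ) = 2 * ((5 : ℕ) : ℚ) by norm_num, padicValRat.mul (by norm_num) (by norm_num),
        padicValRat.of_nat, padicValNat.eq_zero_of_not_dvd (by norm_num)]
      have := padicValRat.self (p := 2) (by norm_num)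
      push_cast at this
      rw [this]
      norm_num
    rw [padicValRat.pow, h10] at h
    push_cast at h
    omega
  have : Fact (Irreducible (X ^ 3 - C 10 : ℚ[X])) := ⟨hirr⟩
  have hdeg : (X ^ 3 - C 10 : ℚ[X]).natDegree = 3 := natDegree_X_pow_sub_C
  let K := AdjoinRoot (X ^ 3 - C 10 : ℚ[X])
  let pb := AdjoinRoot.powerBasis (f := (X ^ 3 - C 10 : ℚ[X])) hirr.ne_zero
  have hdim : pb.dim = 3 := by rw [AdjoinRoot.powerBasis_dim, hdeg]
  let b : Module.Basis (Fin 3) ℚ K := pb.basis.reindex (finCongr hdim)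
  have : NumberField K := { to_finiteDimensional := Module.Finite.of_basis b }
  have hα : (AdjoinRoot.root (X ^ 3 - C 10 : ℚ[X])) ^ 3 = 10 := by
    have h := AdjoinRoot.eval₂_root (X ^ 3 - C 10 : ℚ[X])
    rw [eval₂_sub, eval₂_pow, eval₂_X, eval₂_C, sub_eq_zero] at h
    exact h.trans (map_ofNat _ 10)
  refine ⟨K, inferInstance, inferInstance,
    nonempty_arithmetic (α := AdjoinRoot.root (X ^ 3 - C 10 : ℚ[X])) b (fun i => ?_) hα⟩
  simp only [b, Module.Basis.reindex_apply, PowerBasis.coe_basis]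
  simp [pb]

end CubicFields

open WithZero

namespace Valuation

variable {K : Type*} [Field K] {v : Valuation K ℤᵐ⁰} {γ : ℤᵐ⁰} {x y c : K}

variable (v γ) in
/-- `x` agrees with a square up to a relative error smaller than `γ`. -/
def NearSq (x : K) : Prop := ∃ t, v (x * t ^ 2 - 1) < γ

theorem map_eq_one_of_sub_one_lt (h : v (x - 1) < 1) : v x = 1 := by
  have := v.map_one_add_of_lt h
  simpa using this

theorem NearSq.valuation_eq (hγ : γ ≤ 1) {t : K} (h : v (x * t ^ 2 - 1) < γ) :
    v x * v t ^ 2 = 1 := by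
  rw [← map_pow, ← map_mul]
  exact map_eq_one_of_sub_one_lt (h.trans_le hγ)

theorem NearSq.ne_zero (hγ : γ ≤ 1) (h : v.NearSq γ x) : x ≠ 0 := by
  rintro rfl
  obtain ⟨t, ht⟩ := h
  have := NearSq.valuation_eq hγ ht
  simp at this

theorem NearSq.isSquareAt (hγ : γ ≤ 1) (h : v.NearSq γ x) : v.IsSquareAt x := by
  obtain ⟨t, ht⟩ := h
  have h1 := NearSq.valuation_eq hγ ht
  refine ⟨t⁻¹, ?_⟩
  rw [map_inv₀, inv_pow]
  exact eq_inv_of_mul_eq_one_left h1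

theorem NearSq.mul (hγ : γ ≤ 1) (hx : v.NearSq γ x) (hy : v.NearSq γ y) : v.NearSq γ (x * y) := by
  obtain ⟨t, ht⟩ := hx
  obtain ⟨s, hs⟩ := hy
  refine ⟨t * s, ?_⟩
  have e : x * y * (t * s) ^ 2 - 1 = (x * t ^ 2 - 1) * (y * s ^ 2) + (y * s ^ 2 - 1) := by ring
  rw [e]
  refine v.map_add_lt ?_ hs
  rwa [map_mul, map_mul, map_pow, NearSq.valuation_eq hγ hs, mul_one]

theorem nearSq_mul_sq (hc : c ≠ 0) : v.NearSq γ (x * c ^ 2) ↔ v.NearSq γ x := by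
  constructor
  · rintro ⟨t, ht⟩
    exact ⟨c * t, by rwa [mul_pow, ← mul_assoc]⟩
  · rintro ⟨t, ht⟩
    exact ⟨t / c, by rwa [div_pow, mul_assoc, mul_div_cancel₀ _ (pow_ne_zero 2 hc)]⟩

theorem nearSq_sq (h0 : 0 < γ) (hc : c ≠ 0) : v.NearSq γ (c ^ 2) := by
  rw [← one_mul (c ^ 2), nearSq_mul_sq hc]
  exact ⟨1, by simpa using h0⟩

theorem NearSq.of_mul (hγ : γ ≤ 1) (hxy : v.NearSq γ (x * y)) (hy : v.NearSq γ y) :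
    v.NearSq γ x := by
  have h := hxy.mul hγ hy
  rwa [mul_assoc, ← sq, nearSq_mul_sq (hy.ne_zero hγ)] at h

theorem NearSq.of_lt (hγ : γ ≤ 1) (hy : v.NearSq γ y) (h : v (x - y) < γ * v y) :
    v.NearSq γ x := by
  obtain ⟨t, ht⟩ := hy
  have h1 := NearSq.valuation_eq hγ ht
  refine ⟨t, ?_⟩
  have e : x * t ^ 2 - 1 = (y * t ^ 2 - 1) + (x - y) * t ^ 2 := by ring
  rw [e]
  refine v.map_add_lt ht ?_
  rw [map_mul, map_pow]
  have ht0 : 0 < v t ^ 2 := by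
    rw [zero_lt_iff]
    intro h0
    rw [h0, mul_zero] at h1
    exact zero_ne_one h1
  calc v (x - y) * v t ^ 2 < γ * v y * v t ^ 2 := by gcongr
    _ = γ := by rw [mul_assoc, h1, mul_one]

theorem nearSq_of_sub_one_lt (h : v (x - 1) < γ) : v.NearSq γ x := ⟨1, by simpa using h⟩

/-- If `x * y` is a square up to a small relative error, the factor `y` being replaced by `c`. -/
theorem NearSq.of_mul_eq_sq (hγ : γ ≤ 1) (h0 : 0 < γ) {d e : K} (he : e ≠ 0) (hy : y ≠ 0)
    (h : c * e ^ 2 = x * y) (hd : v (y - d) < γ * v d) (hdne : d ≠ 0) (hc : c ≠ 0) :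
    v.NearSq γ (c * x * d) := by
  have hyd : v.NearSq γ (y * d) := by
    refine (nearSq_sq h0 hdne).of_lt hγ ?_
    rw [show y * d - d ^ 2 = (y - d) * d by ring, map_mul, map_pow, sq, ← mul_assoc]
    have : 0 < v d := by simpa [zero_lt_iff] using hdne
    gcongr
  have h1 : v.NearSq γ (c * x * y) := by
    rw [mul_assoc, ← h, show c * (c * e ^ 2) = (c * e) ^ 2 by ring]
    exact nearSq_sq h0 (mul_ne_zero hc he)
  have h2 := h1.mul hγ hyd
  rwa [show c * x * y * (y * d) = c * x * d * y ^ 2 by ring, nearSq_mul_sq hy] at h2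

theorem exists_int_of_nearSq_one (hres : ∀ x, v x ≤ 1 → ∃ n : ℤ, v (x - n) < 1) (hx : v x = 1)
    (h : v.NearSq 1 x) : ∃ n : ℤ, v (x * n ^ 2 - 1) < 1 := by
  obtain ⟨t, ht⟩ := h
  have h1 := NearSq.valuation_eq le_rfl ht
  rw [hx, one_mul] at h1
  have ht1 : v t = 1 := by
    rcases lt_trichotomy (v t) 1 with h | h | h
    · exact absurd h1 (pow_lt_one₀ zero_le h two_ne_zero).ne
    · exact h
    · exact absurd h1 (one_lt_pow₀ h two_ne_zero).ne'
  obtain ⟨n, hn⟩ := hres t ht1.le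
  refine ⟨n, ?_⟩
  have hn1 : v ((n : K) + t) ≤ 1 := by
    rw [show (n : K) + t = -(t - n) + (t + t) by ring]
    refine v.map_add_le ?_ (v.map_add_le ht1.le ht1.le)
    rw [v.map_neg]; exact hn.le
  rw [show x * (n : K) ^ 2 - 1 = (x * t ^ 2 - 1) - x * ((t - n) * (n + t)) by ring]
  refine v.map_sub_lt ht ?_
  rw [map_mul, map_mul, hx, one_mul]
  exact mul_lt_one_of_lt_of_le hn hn1

theorem intCast_le_one (n : ℤ) : v (n : K) ≤ 1 := by
  induction n using Int.induction_on with
  | zero => simp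
  | succ n ih => push_cast at ih ⊢; exact v.map_add_le ih v.map_one.le
  | pred n ih => push_cast at ih ⊢; exact v.map_sub_le ih v.map_one.le

theorem dvd_of_intCast_lt_one {p : ℕ} (hp : p.Prime) (hvp : v (p : K) < 1) {n : ℤ}
    (h : v (n : K) < 1) : (p : ℤ) ∣ n := by
  by_contra hn
  have hcop : IsCoprime (p : ℤ) n := (Prime.coprime_iff_not_dvd (Nat.prime_iff_prime_int.1 hp)).2 hn
  obtain ⟨a, b, hab⟩ := hcop
  have h1 : ((a : K) * p + b * n) = 1 := by exact_mod_cast congrArg (Int.cast : ℤ → K) hab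
  have : v ((a : K) * p + b * n) < 1 := by
    refine v.map_add_lt ?_ ?_ <;> rw [map_mul, mul_comm]
    · exact mul_lt_one_of_lt_of_le hvp (intCast_le_one _)
    · exact mul_lt_one_of_lt_of_le h (intCast_le_one _)
  rw [h1, map_one] at this
  exact lt_irrefl _ this

theorem not_nearSq_of_residue (hres : ∀ x, v x ≤ 1 → ∃ n : ℤ, v (x - n) < 1) {p : ℕ}
    (hp : p.Prime) (hvp : v (p : K) < 1) {m : ℤ} (hx : v (x - m) < 1)
    (hm : ∀ n : ℤ, ¬ (p : ℤ) ∣ m * n ^ 2 - 1) (hxv : v x = 1) : ¬ v.NearSq 1 x := by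
  intro h
  obtain ⟨n, hn⟩ := exists_int_of_nearSq_one hres hxv h
  refine hm n (dvd_of_intCast_lt_one (v := v) hp hvp ?_)
  push_cast
  rw [show (m : K) * n ^ 2 - 1 = (x * n ^ 2 - 1) - (x - m) * n ^ 2 by ring]
  refine v.map_sub_lt hn ?_
  rw [map_mul, map_pow]
  exact mul_lt_one_of_lt_of_le hx (pow_le_one₀ zero_le (intCast_le_one _))

/-- Evenness of the valuation of the first coordinate of a point of `c y² = x (x² + A x + B)`. -/
theorem isSquareAt_of_eq {A B m : K} (hc : v c = 1) (hm0 : m ≠ 0) (hm : v.IsSquareAt m)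
    (hA : v A ≤ v m) (hB : v B = v m ^ 2) (hx : x ≠ 0) (h : c * y ^ 2 = x * (x ^ 2 + A * x + B)) :
    v.IsSquareAt x := by
  have hx0 : 0 < v x := by simpa [zero_lt_iff] using hx
  have hm0' : 0 < v m := by simpa [zero_lt_iff] using hm0
  have h' := congrArg v h
  rw [map_mul, hc, one_mul, map_pow, map_mul] at h'
  rcases lt_trichotomy (v x) (v m) with hlt | heq | hgt
  · have e : v (x ^ 2 + A * x + B) = v m ^ 2 := by
      rw [← hB]
      refine v.map_add_eq_of_lt_right ?_
      rw [hB]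
      refine v.map_add_lt ?_ ?_
      · rw [map_pow]; gcongr
      · rw [map_mul, sq]
        exact mul_lt_mul_of_le_of_lt_of_nonneg_of_pos hA hlt zero_le hm0'
    rw [e] at h'
    refine ⟨y / m, ?_⟩
    rw [map_div₀, div_pow, h']
    field_simp
  · obtain ⟨d, hd⟩ := hm
    exact ⟨d, by rw [heq, hd]⟩
  · have e : v (x ^ 2 + A * x + B) = v x ^ 2 := by
      rw [← map_pow, add_assoc]
      refine v.map_add_eq_of_lt_left ?_
      rw [map_pow]
      refine v.map_add_lt ?_ ?_
      · rw [map_mul, sq]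
        exact mul_lt_mul_of_pos_right (hA.trans_lt hgt) hx0
      · rw [hB]; gcongr
    rw [e] at h'
    refine ⟨y / x, ?_⟩
    rw [map_div₀, div_pow, h']
    field_simp

theorem eq_one_of_mul (hx : v x ≤ 1) (hy : v y ≤ 1) (h : v (x * y) = 1) : v x = 1 := by
  refine le_antisymm hx (not_lt.1 fun hlt => ?_)
  rw [map_mul] at h
  exact absurd h (mul_lt_one_of_lt_of_le hlt hy).ne

theorem intCast_eq_one {p : ℕ} (hp : p.Prime) (hvp : v (p : K) < 1) {n : ℤ}
    (hn : ¬ (p : ℤ) ∣ n) : v (n : K) = 1 :=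
  le_antisymm (intCast_le_one n) (not_lt.1 fun h => hn (dvd_of_intCast_lt_one hp hvp h))

theorem intCast_le_of_dvd {p : ℕ} {n : ℤ} (hn : (p : ℤ) ∣ n) : v (n : K) ≤ v (p : K) := by
  obtain ⟨m, rfl⟩ := hn
  push_cast
  rw [map_mul]
  exact mul_le_of_le_one_right' (intCast_le_one m)

theorem ratCast_le_of_dvd_num [CharZero K] {p : ℕ} (hp : p.Prime) (hvp : v (p : K) < 1) {q : ℚ}
    (hq : (p : ℤ) ∣ q.num) : v (q : K) ≤ v (p : K) := by
  have hd : ¬ (p : ℤ) ∣ (q.den : ℤ) := fun h => by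
    have := Int.natCast_dvd.1 hq
    exact hp.one_lt.ne' (Nat.dvd_one.1 (q.reduced ▸ Nat.dvd_gcd this (Int.natCast_dvd_natCast.1 h)))
  have h1 := intCast_eq_one (v := v) hp hvp hd
  rw [Rat.cast_def, map_div₀, show ((q.den : ℕ) : K) = ((q.den : ℤ) : K) by simp, h1, div_one]
  exact intCast_le_of_dvd hq

theorem one_le_ratCast [CharZero K] {p : ℕ} (hp : p.Prime) (hvp : v (p : K) < 1) {q : ℚ}
    (hq : ¬ (p : ℤ) ∣ q.num) : 1 ≤ v (q : K) := by
  have h1 := intCast_eq_one (v := v) hp hvp hq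
  have h2 : v ((q.den : ℤ) : K) ≤ 1 := intCast_le_one _
  have h3 : (q : K) * ((q.den : ℤ) : K) = (q.num : K) := by
    exact_mod_cast congrArg (Rat.cast : ℚ → K) (Rat.mul_den_eq_num q)
  have h4 := congrArg v h3
  rw [map_mul, h1] at h4
  by_contra! h
  exact absurd h4 (mul_lt_one_of_lt_of_le h h2).ne

theorem nearSq_mul_of_lt (hγ : γ ≤ 1) (h0 : 0 < γ) (hy : y ≠ 0) (h : v (x - y) < γ * v y) :
    v.NearSq γ (x * y) := by
  refine (nearSq_sq h0 hy).of_lt hγ ?_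
  rw [show x * y - y ^ 2 = (x - y) * y by ring, map_mul, map_pow, sq, ← mul_assoc]
  have : 0 < v y := by simpa [zero_lt_iff] using hy
  gcongr

theorem IsSquareAt.mul (hx : v.IsSquareAt x) (hy : v.IsSquareAt y) : v.IsSquareAt (x * y) := by
  obtain ⟨c, hc⟩ := hx
  obtain ⟨d, hd⟩ := hy
  exact ⟨c * d, by rw [map_mul, map_mul, mul_pow, hc, hd]⟩

theorem isSquareAt_of_eq_one (hx : v x = 1) : v.IsSquareAt x := ⟨1, by simp [hx]⟩

theorem isSquareAt_sq : v.IsSquareAt (x ^ 2) := ⟨x, by simp⟩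

theorem IsSquareAt.of_mul (hxy : v.IsSquareAt (x * y)) (hy : v.IsSquareAt y) (hy0 : y ≠ 0) :
    v.IsSquareAt x := by
  obtain ⟨c, hc⟩ := hxy
  obtain ⟨d, hd⟩ := hy
  refine ⟨c / d, ?_⟩
  have hd0 : v d ^ 2 ≠ 0 := by rw [← hd]; simpa using hy0
  rw [map_div₀, div_pow, ← hc, ← hd, map_mul, mul_div_cancel_right₀]
  rwa [hd]

theorem not_isSquareAt_of_eq_exp (hx : v x = exp (-1 : ℤ)) : ¬ v.IsSquareAt x :=
  fun ⟨c, hc⟩ => exp_neg_one_ne_sq (v c) (by rw [← hc, hx])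

theorem sub_mul_lt_one {m n : ℤ} (hx : v (x - m) < 1) (hy : v (y - n) < 1) :
    v (x * y - (m * n : ℤ)) < 1 := by
  have hx1 : v x ≤ 1 := by
    rw [show x = (x - m) + m by ring]
    exact v.map_add_le hx.le (intCast_le_one m)
  push_cast
  rw [show x * y - m * n = (y - n) * x + (x - m) * n by ring]
  refine v.map_add_lt ?_ ?_ <;> rw [map_mul]
  · exact mul_lt_one_of_lt_of_le hy hx1
  · exact mul_lt_one_of_lt_of_le hx (intCast_le_one n)

theorem eq_one_of_residue {p : ℕ} (hp : p.Prime) (hvp : v (p : K) < 1) {m : ℤ}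
    (hm : ¬ (p : ℤ) ∣ m) (hx : v (x - m) < 1) : v x = 1 := by
  have h1 := intCast_eq_one (v := v) hp hvp hm
  have := v.map_add_eq_of_lt_left (x := m) (y := x - m) (by rwa [h1])
  rw [← h1, ← this]; congr 1; ring

theorem lt_exp_iff {g : ℤᵐ⁰} {n : ℤ} : g < exp n ↔ g ≤ exp (n - 1) := by
  rcases eq_or_ne g 0 with rfl | hg
  · simp
  · rw [← exp_log hg, exp_lt_exp, exp_le_exp]; omega

theorem lt_one_iff {g : ℤᵐ⁰} : g < 1 ↔ g ≤ exp (-1 : ℤ) := by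
  rw [← exp_zero, lt_exp_iff, zero_sub]

theorem not_nearSq_of_residue_three
    (hres : ∀ x, v x ≤ 1 → ∃ n : ℤ, v (x - n) < 1) (h3 : v ((3 : ℕ) : K) < 1) {x : K}
    (hx : v (x + 1) < 1) : ¬ v.NearSq 1 x := by
  have hx' : v (x - ((-1 : ℤ) : K)) < 1 := by simpa using hx
  refine not_nearSq_of_residue hres Nat.prime_three h3 hx' ?_
    (eq_one_of_residue Nat.prime_three h3 (by decide) hx')
  intro n hn
  have hn' := (ZMod.intCast_zmod_eq_zero_iff_dvd _ 3).2 hn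
  push_cast at hn'
  generalize (n : ZMod 3) = m at hn'
  revert m
  decide

theorem sub_pow_lt_one {x : K} {m : ℤ}
    (hx : v (x - m) < 1) (n : ℕ) : v (x ^ n - (m ^ n : ℤ)) < 1 := by
  induction n with
  | zero => simp
  | succ n ih => rw [pow_succ, pow_succ]; exact sub_mul_lt_one ih hx

theorem even_of_nearSq_residue
    (hres : ∀ x, v x ≤ 1 → ∃ n : ℤ, v (x - n) < 1) (h3 : v ((3 : ℕ) : K) < 1) {x : K} {n : ℕ}
    (hx : v (x - ((-1) ^ n : ℤ)) < 1) (h : v.NearSq 1 x) : Even n := by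
  by_contra hn
  rw [(Nat.not_even_iff_odd.1 hn).neg_one_pow] at hx
  exact not_nearSq_of_residue_three hres h3 (by simpa using hx) h

theorem mul_le_exp {x y : K} {m n : ℤ}
    (l : ℤ) (hx : v x ≤ exp m) (hy : v y ≤ exp n) (h : m + n ≤ l) : v (x * y) ≤ exp l := by
  rw [map_mul]
  refine (mul_le_mul' hx hy).trans ?_
  rwa [← exp_add, exp_le_exp]

theorem intCast_mul_le {x : K} {g : ℤᵐ⁰}
    (n : ℤ) (hx : v x ≤ g) : v (n * x) ≤ g := by
  rw [map_mul, mul_comm]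
  exact (mul_le_of_le_one_right' (intCast_le_one n)).trans hx

end Valuation

section Descent

open Valuation

namespace CubeRootTenArithmetic

variable {K : Type*} [Field K] [CharZero K] (D : CubeRootTenArithmetic K)

def β : K := (1 + D.α + D.α ^ 2) / 3

local notation "α" => CubeRootTenArithmetic.α D
local notation "β" => CubeRootTenArithmetic.β D

def η : K := 6 + 2 * α + 5 * β

def b : K := 25 + 10 * α + 4 * α ^ 2

local notation "η" => CubeRootTenArithmetic.η D
local notation "b" => CubeRootTenArithmetic.b D

theorem three_mul_beta : 3 * β = 1 + α + α ^ 2 := by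
  rw [CubeRootTenArithmetic.β]; field_simp

theorem alpha_sq : α * α = 3 * β - 1 - α := by linear_combination -D.three_mul_beta

theorem alpha_mul_beta : α * β = β + 3 := by
  have h3 : (3 : K) ≠ 0 := by norm_num
  apply mul_left_cancel₀ h3
  linear_combination (α - 1) * D.three_mul_beta + D.cube

theorem beta_sq : β * β = β + 2 + α := by
  have h3 : (3 : K) ≠ 0 := by norm_num
  apply mul_left_cancel₀ h3
  linear_combination β * D.three_mul_beta + (2 + α) * D.alpha_mul_beta + D.three_mul_beta + D.alpha_sq

theorem eta_mul : η * (2 * β - 3 - α) = 1 := by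
  rw [CubeRootTenArithmetic.η]
  linear_combination 10 * D.beta_sq - D.alpha_mul_beta - 2 * D.alpha_sq

theorem b_eq : b = η * (α - 1) * (2 + α - β) ^ 2 := by
  have h1 := D.alpha_sq
  have h2 := D.alpha_mul_beta
  have h3 := D.beta_sq
  rw [CubeRootTenArithmetic.η, CubeRootTenArithmetic.b]
  grind

omit [CharZero K] in
theorem b_mul : b * (5 - 2 * α) = 45 := by
  rw [CubeRootTenArithmetic.b]
  linear_combination -8 * D.cube

theorem b_ne_zero : b ≠ 0 := by
  intro h
  have := D.b_mul
  rw [h] at this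
  norm_num at this

theorem alpha_ne_zero : α ≠ 0 := by
  intro h
  have := D.cube
  rw [h] at this
  norm_num at this

theorem beta_ne_zero : β ≠ 0 := by
  intro h
  have := D.alpha_mul_beta
  rw [h] at this
  norm_num at this

theorem eta_ne_zero : η ≠ 0 := left_ne_zero_of_mul_eq_one D.eta_mul

theorem classes' {x : K} (hx : x ≠ 0) (h₂ : D.v₂.IsSquareAt x)
    (h : ∀ v : Valuation K ℤᵐ⁰, v 2 = 1 → v 3 = 1 → v 5 = 1 → v α ≤ 1 → v.IsSquareAt x) :
    ∃ (h i j k l : ℕ) (t : K), t ≠ 0 ∧ h ≤ 1 ∧ i ≤ 1 ∧ j ≤ 1 ∧ k ≤ 1 ∧ l ≤ 1 ∧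
      x = (-1) ^ h * η ^ i * β ^ j * (β - α) ^ k * (4 + α + 3 * β) ^ l * t ^ 2 := by
  obtain ⟨h, i, j, k, l, t, ht, hh, hi, hj, hk, hl, e⟩ := D.classes x hx h₂ h
  refine ⟨h, i, j, k, l, t, ht, hh, hi, hj, hk, hl, ?_⟩
  have h1 : (23 + 11 * α + 5 * α ^ 2) / 3 = η := by
    simp only [CubeRootTenArithmetic.η, CubeRootTenArithmetic.β]; ring
  have h2 : (1 - 2 * α + α ^ 2) / 3 = β - α := by
    simp only [CubeRootTenArithmetic.β]; ring
  have h3 : 5 + 2 * α + α ^ 2 = 4 + α + 3 * β := by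
    linear_combination D.alpha_sq
  rw [e, h1, h2, h3, CubeRootTenArithmetic.β]

variable {D}

theorem beta_le_one {v : Valuation K ℤᵐ⁰} (hα : v α ≤ 1) : v β ≤ 1 := by
  by_contra! h
  have h1 := congrArg v D.beta_sq
  have h2 : v (β + 2 + α) ≤ v β := by
    refine v.map_add_le (v.map_add_le le_rfl ?_) (hα.trans h.le)
    exact le_trans (by exact_mod_cast intCast_le_one (v := v) (2 : ℤ)) h.le
  rw [← h1, map_mul] at h2
  have : v β * v β ≤ 1 * v β := by simpa using h2
  exact absurd (le_of_mul_le_mul_right this (zero_lt_one.trans h)) h.not_ge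

theorem le_one_of_int_combination {v : Valuation K ℤᵐ⁰} (hα : v α ≤ 1) (l m n : ℤ) :
    v (l + m * α + n * β) ≤ 1 := by
  have hβ := beta_le_one hα
  refine v.map_add_le (v.map_add_le (intCast_le_one l) ?_) ?_ <;> rw [map_mul]
  · exact mul_le_one' (intCast_le_one m) hα
  · exact mul_le_one' (intCast_le_one n) hβ

theorem le_of_eq_mul {v : Valuation K ℤᵐ⁰} (hα : v α ≤ 1) {x y : K} (l m n : ℤ)
    (h : x = y * (l + m * α + n * β)) : v x ≤ v y := by
  rw [h, map_mul]
  exact mul_le_of_le_one_right' (le_one_of_int_combination hα l m n)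

theorem b_eq_one {v : Valuation K ℤᵐ⁰} (h3 : v 3 = 1) (h5 : v 5 = 1) (hα : v α ≤ 1) : v b = 1 := by
  refine eq_one_of_mul (y := 5 - 2 * α) ?_ ?_ ?_
  · have := le_one_of_int_combination hα 21 6 12
    convert this using 2
    rw [CubeRootTenArithmetic.b]
    push_cast
    linear_combination -4 * D.three_mul_beta
  · have := le_one_of_int_combination hα 5 (-2) 0
    convert this using 2
    push_cast
    ring
  · rw [D.b_mul, show (45 : K) = 3 ^ 2 * 5 by norm_num]
    simp [h3, h5]

theorem eta_eq_one {v : Valuation K ℤᵐ⁰} (hα : v α ≤ 1) : v η = 1 := by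
  refine eq_one_of_mul (y := 2 * β - 3 - α) ?_ ?_ (by rw [D.eta_mul, map_one])
  · exact_mod_cast le_one_of_int_combination hα 6 2 5
  · have := le_one_of_int_combination hα (-3) (-1) 2
    convert this using 2
    push_cast
    ring

variable (D)

omit [CharZero K] in
theorem v₃_alpha_le : D.v₃ α ≤ 1 := by
  rw [show α = (α - 1) + 1 by ring]
  refine map_add_le _ ?_ (map_one _).le
  rw [D.v₃_alpha_sub_one]; decide

omit [CharZero K] in
theorem v₃'_alpha_le : D.v₃' α ≤ 1 := by
  rw [show α = (α - 1) + 1 by ring]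
  refine map_add_le _ ?_ (map_one _).le
  rw [D.v₃'_alpha_sub_one]; decide

omit [CharZero K] in
theorem v₅_alpha_le : D.v₅ α ≤ 1 := by rw [D.v₅_alpha]; decide

omit [CharZero K] in
theorem v₃_three_lt : D.v₃ ((3 : ℕ) : K) < 1 := by
  rw [Nat.cast_ofNat, D.v₃_three]; decide

omit [CharZero K] in
theorem v₃'_three_lt : D.v₃' ((3 : ℕ) : K) < 1 := by
  rw [Nat.cast_ofNat, D.v₃'_three]; decide

omit [CharZero K] in
theorem v₅_five_lt : D.v₅ ((5 : ℕ) : K) < 1 := by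
  rw [Nat.cast_ofNat]; exact D.v₅_five

theorem sub_one_mul_beta : (α - 1) * β = 3 := by linear_combination D.alpha_mul_beta

theorem beta_mul_sub : β * (β - α) = α - 1 := by
  linear_combination D.beta_sq - D.alpha_mul_beta

theorem v₃_beta : D.v₃ β = exp (-1 : ℤ) := by
  have h := congrArg D.v₃ D.sub_one_mul_beta
  rw [map_mul, D.v₃_alpha_sub_one, D.v₃_three, sq] at h
  exact mul_left_cancel₀ exp_ne_zero h

theorem v₃_eta : D.v₃ (η + 1) < 1 := by
  refine (le_of_eq_mul (y := β) D.v₃_alpha_le 2 1 2 ?_).trans_lt (by rw [v₃_beta]; decide)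
  rw [CubeRootTenArithmetic.η]
  push_cast
  linear_combination -2 * D.beta_sq - D.alpha_mul_beta

theorem v₃_beta_sub : D.v₃ (β - α + 1) < 1 := by
  refine (le_of_eq_mul (y := β) D.v₃_alpha_le 1 1 (-1) ?_).trans_lt (by rw [v₃_beta]; decide)
  push_cast
  linear_combination D.beta_sq - D.alpha_mul_beta

theorem v₃_five : D.v₃ (4 + α + 3 * β + 1) < 1 := by
  refine (le_of_eq_mul (y := β) D.v₃_alpha_le 1 1 1 ?_).trans_lt (by rw [v₃_beta]; decide)
  push_cast
  linear_combination -D.beta_sq - D.alpha_mul_beta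

theorem v₃'_beta : D.v₃' β = 1 := by
  have h := congrArg D.v₃' D.sub_one_mul_beta
  rw [map_mul, D.v₃'_alpha_sub_one, D.v₃'_three] at h
  exact mul_left_cancel₀ exp_ne_zero (h.trans (mul_one _).symm)

theorem v₃'_beta_sub : D.v₃' (β - α) = exp (-1 : ℤ) := by
  have h := congrArg D.v₃' D.beta_mul_sub
  rwa [map_mul, D.v₃'_alpha_sub_one, v₃'_beta, one_mul] at h

theorem v₃'_beta_sub_one : D.v₃' (β - 1) < 1 := by
  refine (le_of_eq_mul (y := β - α) D.v₃'_alpha_le 1 0 1 ?_).trans_lt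
    (by rw [v₃'_beta_sub]; decide)
  push_cast
  linear_combination -D.beta_sq + D.alpha_mul_beta

theorem v₃'_eta : D.v₃' (η - 1) < 1 := by
  refine (le_of_eq_mul (y := β - α) D.v₃'_alpha_le 13 4 11 ?_).trans_lt
    (by rw [v₃'_beta_sub]; decide)
  rw [CubeRootTenArithmetic.η]
  push_cast
  linear_combination -11 * D.beta_sq + 7 * D.alpha_mul_beta + 4 * D.alpha_sq

theorem v₃'_five : D.v₃' (4 + α + 3 * β + 1) < 1 := by
  refine (le_of_eq_mul (y := β - α) D.v₃'_alpha_le 9 3 7 ?_).trans_lt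
    (by rw [v₃'_beta_sub]; decide)
  push_cast
  linear_combination -7 * D.beta_sq + 4 * D.alpha_mul_beta + 3 * D.alpha_sq

theorem v₅_pi : D.v₅ (4 + α + 3 * β) = exp (-1 : ℤ) := by
  have h : (4 + α + 3 * β) * (α - 2) = α := by
    linear_combination 3 * D.alpha_mul_beta + D.alpha_sq
  have h2 : D.v₅ (α - 2) = 1 := by
    refine eq_one_of_residue (m := -2) (Nat.prime_five) D.v₅_five_lt (by decide) ?_
    push_cast
    rw [sub_neg_eq_add, sub_add_cancel, D.v₅_alpha]; decide
  have h3 := congrArg D.v₅ h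
  rwa [map_mul, h2, mul_one, D.v₅_alpha] at h3

theorem v₅_eta : D.v₅ (η - 1) < 1 := by
  refine (le_of_eq_mul (y := 4 + α + 3 * β) D.v₅_alpha_le (-1) 0 1 ?_).trans_lt
    (by rw [v₅_pi]; decide)
  rw [CubeRootTenArithmetic.η]
  push_cast
  linear_combination -3 * D.beta_sq - D.alpha_mul_beta

theorem v₅_beta : D.v₅ (β - 2) < 1 := by
  refine (le_of_eq_mul (y := 4 + α + 3 * β) D.v₅_alpha_le (-3) (-1) 2 ?_).trans_lt
    (by rw [v₅_pi]; decide)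
  push_cast
  linear_combination -6 * D.beta_sq + D.alpha_mul_beta + D.alpha_sq

theorem v₅_beta_sub : D.v₅ (β - α - 2) < 1 := by
  refine (le_of_eq_mul (y := 4 + α + 3 * β) D.v₅_alpha_le (-1) (-2) 2 ?_).trans_lt
    (by rw [v₅_pi]; decide)
  push_cast
  linear_combination -6 * D.beta_sq + 4 * D.alpha_mul_beta + 2 * D.alpha_sq

theorem beta_sub_ne_zero : β - α ≠ 0 := by
  intro h
  have := D.v₃'_beta_sub
  rw [h, map_zero] at this
  exact exp_ne_zero this.symm

theorem five_ne_zero : 4 + α + 3 * β ≠ 0 := by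
  intro h
  have := D.v₅_pi
  rw [h, map_zero] at this
  exact exp_ne_zero this.symm

/-- The product of powers of the generators of the group of square classes. -/
def gen (h i j k l : ℕ) : K :=
  (-1) ^ h * η ^ i * β ^ j * (β - α) ^ k * (4 + α + 3 * β) ^ l

omit [CharZero K] in
theorem v₂_five : D.v₂ 5 = 1 := by
  have := intCast_eq_one (v := D.v₂) (p := 2) Nat.prime_two (by exact_mod_cast D.v₂_two)
    (n := 5) (by decide)
  exact_mod_cast this

omit [CharZero K] in
theorem v₂_three : D.v₂ 3 = 1 := by
  have := intCast_eq_one (v := D.v₂) (p := 2) Nat.prime_two (by exact_mod_cast D.v₂_two)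
    (n := 3) (by decide)
  exact_mod_cast this

omit [CharZero K] in
theorem v₂_two_eq : D.v₂ 2 = exp (-3 : ℤ) := by
  have h : (2 : K) * 5 = α ^ 3 := by rw [D.cube]; norm_num
  have h1 := congrArg D.v₂ h
  rw [map_mul, v₂_five, mul_one, map_pow, D.v₂_alpha] at h1
  rw [h1]; decide

omit [CharZero K] in
theorem alpha_eq_one {v : Valuation K ℤᵐ⁰} (h2 : v 2 = 1) (h5 : v 5 = 1) : v α = 1 := by
  have h : α ^ 3 = (2 : K) * 5 := by rw [D.cube]; norm_num
  have h1 := congrArg v h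
  rw [map_mul, h2, h5, mul_one, map_pow] at h1
  exact (pow_eq_one_iff.1 h1).resolve_right three_ne_zero

omit [CharZero K] in
theorem phi_alpha_pos : 0 < D.φ α := by
  have h := congrArg D.φ D.cube
  rw [map_pow, map_ofNat] at h
  by_contra! h0
  have : (D.φ α) ^ 3 ≤ 0 := Odd.pow_nonpos (by decide) h0
  linarith

theorem phi_beta : 3 * D.φ β = 1 + D.φ α + D.φ α ^ 2 := by
  have h := congrArg D.φ D.three_mul_beta
  simpa [map_ofNat] using h

theorem phi_beta_pos : 0 < D.φ β := by
  have := D.phi_beta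
  have := D.phi_alpha_pos
  nlinarith

theorem sign_eq_zero {h i j k l : ℕ} {t : K} (hh : h ≤ 1)
    (hpos : 0 < D.φ (D.gen h i j k l * t ^ 2)) : h = 0 := by
  interval_cases h
  · rfl
  · exfalso
    have h1 := D.phi_alpha_pos
    have h2 := D.phi_beta_pos
    have h3 := D.phi_beta
    have h4 : 0 < D.φ η := by
      rw [CubeRootTenArithmetic.η]; simp only [map_add, map_mul, map_ofNat]; positivity
    have h5 : 0 ≤ D.φ β - D.φ α := by nlinarith [sq_nonneg (D.φ α - 1)]
    have h6 : 0 < 4 + D.φ α + 3 * D.φ β := by positivity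
    have h7 : 0 ≤ D.φ η ^ i * D.φ β ^ j * (D.φ β - D.φ α) ^ k * (4 + D.φ α + 3 * D.φ β) ^ l *
        D.φ t ^ 2 := by positivity
    simp only [gen, map_mul, map_pow, map_add, _root_.map_sub, _root_.map_neg, map_one, map_ofNat] at hpos
    linarith

omit [CharZero K] in
theorem not_isSquareAt_mul {v : Valuation K ℤᵐ⁰} {u p t : K} (hu : v u = 1)
    (hp : v p = exp (-1 : ℤ)) (ht : t ≠ 0) : ¬ v.IsSquareAt (u * p * t ^ 2) := fun h =>
  not_isSquareAt_of_eq_exp (x := u * p) (by rw [map_mul, hu, hp, one_mul])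
    (h.of_mul isSquareAt_sq (pow_ne_zero 2 ht))

theorem v₃_eta_eq : D.v₃ η = 1 :=
  eq_one_of_residue Nat.prime_three D.v₃_three_lt (m := -1) (by decide)
    (by simpa using D.v₃_eta)

theorem v₃_beta_sub_eq : D.v₃ (β - α) = 1 :=
  eq_one_of_residue Nat.prime_three D.v₃_three_lt (m := -1) (by decide)
    (by simpa using D.v₃_beta_sub)

theorem v₃_five_eq : D.v₃ (4 + α + 3 * β) = 1 :=
  eq_one_of_residue Nat.prime_three D.v₃_three_lt (m := -1) (by decide)
    (by simpa using D.v₃_five)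

theorem v₃'_eta_eq : D.v₃' η = 1 := map_eq_one_of_sub_one_lt D.v₃'_eta

theorem v₃'_five_eq : D.v₃' (4 + α + 3 * β) = 1 :=
  eq_one_of_residue Nat.prime_three D.v₃'_three_lt (m := -1) (by decide)
    (by simpa using D.v₃'_five)

theorem v₅_eta_eq : D.v₅ η = 1 := map_eq_one_of_sub_one_lt D.v₅_eta

theorem v₅_beta_eq : D.v₅ β = 1 :=
  eq_one_of_residue Nat.prime_five D.v₅_five_lt (m := 2) (by decide)
    (by simpa using D.v₅_beta)

theorem v₅_beta_sub_eq : D.v₅ (β - α) = 1 :=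
  eq_one_of_residue Nat.prime_five D.v₅_five_lt (m := 2) (by decide)
    (by simpa using D.v₅_beta_sub)

section parity

variable {h i j k l : ℕ} {t : K} (ht : t ≠ 0)
include ht

theorem parity₃ (hj : j ≤ 1) : D.v₃.IsSquareAt (D.gen h i j k l * t ^ 2) ↔ j = 0 := by
  have key : D.v₃ ((-1) ^ h * η ^ i * (β - α) ^ k * (4 + α + 3 * β) ^ l) = 1 := by
    simp [v₃_eta_eq, v₃_beta_sub_eq, v₃_five_eq, Valuation.map_neg]
  interval_cases j
  · refine iff_of_true ((isSquareAt_of_eq_one ?_).mul isSquareAt_sq) rfl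
    simpa [gen] using key
  · refine iff_of_false ?_ one_ne_zero
    have := not_isSquareAt_mul key D.v₃_beta ht
    convert this using 2
    rw [gen]; ring

theorem parity₃' (hk : k ≤ 1) : D.v₃'.IsSquareAt (D.gen h i j k l * t ^ 2) ↔ k = 0 := by
  have key : D.v₃' ((-1) ^ h * η ^ i * β ^ j * (4 + α + 3 * β) ^ l) = 1 := by
    simp [v₃'_eta_eq, v₃'_beta, v₃'_five_eq, Valuation.map_neg]
  interval_cases k
  · refine iff_of_true ((isSquareAt_of_eq_one ?_).mul isSquareAt_sq) rfl
    simpa [gen] using key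
  · refine iff_of_false ?_ one_ne_zero
    have := not_isSquareAt_mul key D.v₃'_beta_sub ht
    convert this using 2
    rw [gen]; ring

theorem parity₅ (hl : l ≤ 1) : D.v₅.IsSquareAt (D.gen h i j k l * t ^ 2) ↔ l = 0 := by
  have key : D.v₅ ((-1) ^ h * η ^ i * β ^ j * (β - α) ^ k) = 1 := by
    simp [v₅_eta_eq, v₅_beta_eq, v₅_beta_sub_eq, Valuation.map_neg]
  interval_cases l
  · refine iff_of_true ((isSquareAt_of_eq_one ?_).mul isSquareAt_sq) rfl
    simpa [gen] using key
  · refine iff_of_false ?_ one_ne_zero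
    have := not_isSquareAt_mul key D.v₅_pi ht
    convert this using 2
    rw [gen]; ring

end parity

omit [CharZero K] in
theorem v₅_five_eq : D.v₅ 5 = exp (-3 : ℤ) := by
  have h : (2 : K) * 5 = α ^ 3 := by rw [D.cube]; norm_num
  have h2 : D.v₅ 2 = 1 := by
    have := intCast_eq_one (v := D.v₅) Nat.prime_five D.v₅_five_lt (n := 2) (by decide)
    exact_mod_cast this
  have h1 := congrArg D.v₅ h
  rw [map_mul, h2, one_mul, map_pow, D.v₅_alpha] at h1
  rw [h1]; decide

theorem pos_of_sq_eq {x y : K} (hx : x ≠ 0)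
    (h : y ^ 2 = x * (x ^ 2 - 6 * α * x + 12 * α ^ 2)) : 0 < D.φ x := by
  have h1 := congrArg D.φ h
  simp only [map_mul, map_pow, map_add, _root_.map_sub, map_ofNat] at h1
  have hx' : D.φ x ≠ 0 := (map_ne_zero D.φ).2 hx
  have ha := D.phi_alpha_pos
  have hq : 0 < D.φ x ^ 2 - 6 * D.φ α * D.φ x + 12 * D.φ α ^ 2 := by
    nlinarith [sq_nonneg (D.φ x - 3 * D.φ α), pow_pos ha 2]
  have : 0 ≤ D.φ x * (D.φ x ^ 2 - 6 * D.φ α * D.φ x + 12 * D.φ α ^ 2) := by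
    rw [← h1]; positivity
  exact lt_of_le_of_ne (nonneg_of_mul_nonneg_left this hq) hx'.symm

include D in
theorem not_five_dvd_num {u Y : ℚ} (h : (Y : K) ^ 2 = ((u : K) ^ 2 - 5) ^ 3 + 80) :
    ¬ (5 : ℤ) ∣ u.num := by
  intro hd
  have hu := ratCast_le_of_dvd_num (K := K) Nat.prime_five D.v₅_five_lt hd
  rw [Nat.cast_ofNat, D.v₅_five_eq] at hu
  have h80 : D.v₅ 80 = exp (-3 : ℤ) := by
    have h16 := intCast_eq_one (v := D.v₅) Nat.prime_five D.v₅_five_lt (n := 16) (by decide)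
    push_cast at h16
    rw [show (80 : K) = 16 * 5 by norm_num, map_mul, h16, D.v₅_five_eq, one_mul]
  have hX : D.v₅ ((u : K) ^ 2 - 5) ≤ exp (-3 : ℤ) := by
    refine Valuation.map_sub_le _ ?_ D.v₅_five_eq.le
    rw [map_pow]
    exact (pow_le_pow_left' hu 2).trans (by decide)
  have h1 : D.v₅ (((u : K) ^ 2 - 5) ^ 3 + 80) = exp (-3 : ℤ) := by
    rw [← h80]
    refine D.v₅.map_add_eq_of_lt_right ?_
    rw [map_pow, h80]
    exact (pow_le_pow_left' hX 3).trans_lt (by decide)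
  rw [← h, map_pow] at h1
  refine exp_neg_one_ne_sq (D.v₅ Y * exp (1 : ℤ)) ?_
  rw [mul_pow, h1]; decide

theorem shift_ne_zero {u : ℚ} (hu : ¬ (5 : ℤ) ∣ u.num) : (u : K) ^ 2 - 5 + 2 * α ≠ 0 := by
  intro h
  have h1 := one_le_ratCast (K := K) Nat.prime_five D.v₅_five_lt hu
  have h2 : (u : K) ^ 2 = 5 - 2 * α := by linear_combination h
  have h3 : D.v₅ ((u : K) ^ 2) < 1 := by
    rw [h2]
    refine Valuation.map_sub_lt _ D.v₅_five ?_
    have := intCast_le_one (v := D.v₅) 2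
    rw [map_mul, mul_comm]
    refine mul_lt_one_of_lt_of_le ?_ (by exact_mod_cast this)
    rw [D.v₅_alpha]; decide
  rw [map_pow] at h3
  exact absurd h3 (one_le_pow₀ h1).not_gt

theorem isSquare_or_of_sq_eq {u Y : ℚ} (h : (Y : K) ^ 2 = ((u : K) ^ 2 - 5) ^ 3 + 80) :
    ∃ t : K, t ≠ 0 ∧
      ((u : K) ^ 2 - 5 + 2 * α = t ^ 2 ∨ (u : K) ^ 2 - 5 + 2 * α = b * t ^ 2) := by
  have h5 := D.not_five_dvd_num h
  have hx0 := D.shift_ne_zero h5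
  set x := (u : K) ^ 2 - 5 + 2 * α with hx
  have hY : (Y : K) ^ 2 = x * (x ^ 2 - 6 * α * x + 12 * α ^ 2) := by
    rw [h, hx]; linear_combination -8 * D.cube
  have hY' : (1 : K) * (Y : K) ^ 2 = x * (x ^ 2 + (-(6 * α)) * x + 12 * α ^ 2) := by
    rw [hY]; ring
  obtain ⟨h, i, j, k, l, t, ht, hh, hi, hj, hk, hl, e⟩ := D.classes' hx0
    (isSquareAt_of_eq (map_one _) (pow_ne_zero 4 D.alpha_ne_zero)
      ⟨α ^ 2, by rw [← map_pow]; ring_nf⟩ (by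
        rw [Valuation.map_neg, show (6 : K) = 2 * 3 by norm_num, map_mul, map_mul, v₂_two_eq,
          v₂_three, D.v₂_alpha, map_pow, D.v₂_alpha]; decide) (by
        rw [show (12 : K) = 2 ^ 2 * 3 by norm_num, map_mul, map_mul, map_pow, v₂_two_eq,
          v₂_three, map_pow, map_pow, D.v₂_alpha]; decide) hx0 hY')
    (fun v h2 h3 h5 hα => isSquareAt_of_eq (map_one _) one_ne_zero
      (isSquareAt_of_eq_one (map_one _)) (by
        rw [Valuation.map_neg, show (6 : K) = 2 * 3 by norm_num]
        simp [h2, h3, D.alpha_eq_one h2 h5]) (by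
        rw [show (12 : K) = 2 ^ 2 * 3 by norm_num]
        simp [h2, h3, D.alpha_eq_one h2 h5]) hx0 hY')
  change x = D.gen h i j k l * t ^ 2 at e
  obtain rfl : h = 0 := D.sign_eq_zero hh (e ▸ D.pos_of_sq_eq hx0 hY)
  obtain rfl : l = 0 := by
    rw [← D.parity₅ ht hl, ← e]
    have h1 := one_le_ratCast (K := K) Nat.prime_five D.v₅_five_lt h5
    have hu0 : (u : K) ≠ 0 := by rintro h0; simp [h0] at h1
    refine NearSq.isSquareAt le_rfl ((nearSq_sq zero_lt_one hu0).of_lt le_rfl ?_)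
    rw [one_mul, hx, map_pow]
    refine lt_of_lt_of_le ?_ (one_le_pow₀ h1)
    rw [show (u : K) ^ 2 - 5 + 2 * α - u ^ 2 = 2 * α - 5 by ring]
    refine Valuation.map_sub_lt _ ?_ D.v₅_five
    have := intCast_le_one (v := D.v₅) 2
    rw [map_mul, mul_comm]
    refine mul_lt_one_of_lt_of_le ?_ (by exact_mod_cast this)
    rw [D.v₅_alpha]; decide
  have near_of_unit : ∀ v : Valuation K ℤᵐ⁰, v ((3 : ℕ) : K) < 1 → v (α - 1) = exp (-1 : ℤ) →
      ¬ (3 : ℤ) ∣ u.num → v.NearSq 1 x := by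
    intro v h3 hw hd
    have h1 := one_le_ratCast (K := K) Nat.prime_three h3 hd
    have hu0 : (u : K) ≠ 0 := by rintro h0; simp [h0] at h1
    refine (nearSq_sq zero_lt_one hu0).of_lt le_rfl ?_
    rw [one_mul, hx, map_pow]
    refine lt_of_lt_of_le ?_ (one_le_pow₀ h1)
    rw [show (u : K) ^ 2 - 5 + 2 * α - u ^ 2 = 2 * (α - 1) - (3 : ℕ) by push_cast; ring]
    refine Valuation.map_sub_lt _ ?_ h3
    have := intCast_le_one (v := v) 2
    rw [map_mul, mul_comm]
    refine mul_lt_one_of_lt_of_le ?_ (by exact_mod_cast this)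
    rw [hw]; decide
  by_cases hd : (3 : ℤ) ∣ u.num
  · have hw0 : α - 1 ≠ 0 := by
      intro h0
      have := D.v₃_alpha_sub_one
      rw [h0, map_zero] at this
      exact exp_ne_zero this.symm
    have h2 : D.v₃ 2 = 1 := by
      exact_mod_cast intCast_eq_one (v := D.v₃) Nat.prime_three D.v₃_three_lt (n := 2) (by decide)
    have hu := ratCast_le_of_dvd_num (K := K) Nat.prime_three D.v₃_three_lt hd
    have hu' := ratCast_le_of_dvd_num (K := K) Nat.prime_three D.v₃'_three_lt hd
    rw [Nat.cast_ofNat, D.v₃_three] at hu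
    rw [Nat.cast_ofNat, D.v₃'_three] at hu'
    have hn : D.v₃.NearSq 1 (x * (2 * (α - 1))) := by
      refine nearSq_mul_of_lt le_rfl zero_lt_one (mul_ne_zero two_ne_zero hw0) ?_
      rw [show x - 2 * (α - 1) = u ^ 2 - 3 by rw [hx]; ring, one_mul, map_mul, h2, one_mul,
        D.v₃_alpha_sub_one]
      refine Valuation.map_sub_lt _ ?_ (by rw [D.v₃_three]; decide)
      rw [map_pow]
      exact (pow_le_pow_left' hu 2).trans_lt (by decide)
    have hr : D.v₃' (2 - β) = 1 := by
      refine map_eq_one_of_sub_one_lt ?_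
      rw [show 2 - β - 1 = -(β - 1) by ring, Valuation.map_neg]
      exact D.v₃'_beta_sub_one
    have hn' : D.v₃'.NearSq 1 (x * ((α - 1) * (2 - β))) := by
      refine nearSq_mul_of_lt le_rfl zero_lt_one (mul_ne_zero hw0 ?_) ?_
      · rintro h0; simp [h0] at hr
      · rw [show x - (α - 1) * (2 - β) = u ^ 2 by
          rw [hx]; linear_combination D.sub_one_mul_beta, one_mul, map_mul, hr, mul_one,
          D.v₃'_alpha_sub_one, map_pow]
        exact (pow_le_pow_left' hu' 2).trans_lt (by decide)
    have hj0 : j ≠ 0 := by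
      rw [Ne, ← D.parity₃ (h := 0) (i := i) (k := k) (l := 0) ht hj, ← e]
      intro hs
      have := (hn.isSquareAt le_rfl)
      rw [mul_comm] at this
      refine not_isSquareAt_of_eq_exp ?_ (this.of_mul hs hx0)
      rw [map_mul, h2, D.v₃_alpha_sub_one, one_mul]
    have hk0 : k ≠ 0 := by
      rw [Ne, ← D.parity₃' (h := 0) (i := i) (j := j) (l := 0) ht hk, ← e]
      intro hs
      have := (hn'.isSquareAt le_rfl)
      rw [mul_comm] at this
      refine not_isSquareAt_of_eq_exp ?_ (this.of_mul hs hx0)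
      rw [map_mul, hr, D.v₃'_alpha_sub_one, mul_one]
    obtain rfl : j = 1 := by omega
    obtain rfl : k = 1 := by omega
    have e' : x = η ^ i * (α - 1) * t ^ 2 := by
      rw [e, gen, ← D.beta_mul_sub]; ring
    have hi1 : i ≠ 0 := by
      rintro rfl
      rw [e', show η ^ 0 * (α - 1) * t ^ 2 * (2 * (α - 1)) = 2 * ((α - 1) * t) ^ 2 by ring,
        nearSq_mul_sq (mul_ne_zero hw0 ht)] at hn
      refine not_nearSq_of_residue_three D.v₃_residue D.v₃_three_lt ?_ hn
      convert D.v₃_three_lt using 2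
      norm_num
    obtain rfl : i = 1 := by omega
    have hs : (2 + α - β) ≠ 0 := by
      intro h0
      have := D.b_eq
      rw [h0] at this
      exact D.b_ne_zero (by rw [this]; ring)
    refine ⟨t / (2 + α - β), div_ne_zero ht hs, Or.inr ?_⟩
    rw [e', D.b_eq]
    field_simp
  · have hn := near_of_unit _ D.v₃_three_lt D.v₃_alpha_sub_one hd
    have hn' := near_of_unit _ D.v₃'_three_lt D.v₃'_alpha_sub_one hd
    obtain rfl : j = 0 := by
      rw [← D.parity₃ ht hj, ← e]; exact hn.isSquareAt le_rfl
    obtain rfl : k = 0 := by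
      rw [← D.parity₃' ht hk, ← e]; exact hn'.isSquareAt le_rfl
    obtain rfl : i = 0 := by
      by_contra hi0
      obtain rfl : i = 1 := by omega
      rw [e, nearSq_mul_sq ht, gen] at hn
      refine not_nearSq_of_residue_three D.v₃_residue D.v₃_three_lt D.v₃_eta ?_
      simpa using hn
    exact ⟨t, ht, Or.inl (by simpa [gen] using e)⟩

theorem three_mul_beta_sub : 3 * (β - α) = (α - 1) ^ 2 := by
  linear_combination D.three_mul_beta

theorem alpha_sub_one_ne_zero : α - 1 ≠ 0 := by
  intro h
  have := D.sub_one_mul_beta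
  rw [h] at this
  norm_num at this

omit [CharZero K] in
theorem v₃_b : D.v₃ b = exp (-3 : ℤ) := by
  have h1 := congrArg D.v₃ D.b_mul
  have h2 : D.v₃ (5 - 2 * α) = exp (-1 : ℤ) := by
    rw [show 5 - 2 * α = -(2 * (α - 1)) + 3 by ring]
    have e : D.v₃ (-(2 * (α - 1))) = exp (-1 : ℤ) := by
      have h2 : D.v₃ 2 = 1 := by
        exact_mod_cast intCast_eq_one (v := D.v₃) Nat.prime_three D.v₃_three_lt (n := 2)
          (by decide)
      rw [Valuation.map_neg, map_mul, h2, one_mul, D.v₃_alpha_sub_one]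
    rw [← e]
    refine D.v₃.map_add_eq_of_lt_left ?_
    rw [e, D.v₃_three]; decide
  have h5 : D.v₃ 5 = 1 := by
    exact_mod_cast intCast_eq_one (v := D.v₃) Nat.prime_three D.v₃_three_lt (n := 5) (by decide)
  rw [map_mul, h2, show (45 : K) = 3 ^ 2 * 5 by norm_num, map_mul, map_pow, D.v₃_three, h5] at h1
  have h0 : exp (-1 : ℤ) ≠ 0 := exp_ne_zero
  exact mul_right_cancel₀ h0 (h1.trans (by decide))

omit [CharZero K] in
theorem four_b_ne_sq (z : K) : z ^ 2 ≠ 4 * b := by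
  intro h
  have h1 := congrArg D.v₃ h
  have h4 : D.v₃ 4 = 1 := by
    exact_mod_cast intCast_eq_one (v := D.v₃) Nat.prime_three D.v₃_three_lt (n := 4) (by decide)
  rw [map_pow, map_mul, h4, one_mul, v₃_b] at h1
  refine exp_neg_one_ne_sq (D.v₃ z * exp (1 : ℤ)) ?_
  rw [mul_pow, h1]; decide

theorem even_of_nearSq₃' {h i j l : ℕ} {t : K} (ht : t ≠ 0)
    (hn : D.v₃'.NearSq 1 ((-1) ^ h * η ^ i * β ^ j * (4 + α + 3 * β) ^ l * t ^ 2)) :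
    Even (h + l) := by
  rw [nearSq_mul_sq ht] at hn
  refine even_of_nearSq_residue D.v₃'_residue D.v₃'_three_lt ?_ hn
  have h1 := sub_pow_lt_one (v := D.v₃') (x := -1) (m := -1) (by simp) h
  have h2 := sub_pow_lt_one (v := D.v₃') (x := η) (m := 1) (by simpa using D.v₃'_eta) i
  have h3 := sub_pow_lt_one (v := D.v₃') (x := β) (m := 1) (by simpa using D.v₃'_beta_sub_one) j
  have h4 := sub_pow_lt_one (v := D.v₃') (x := 4 + α + 3 * β) (m := -1)
    (by simpa using D.v₃'_five) l
  have := sub_mul_lt_one (sub_mul_lt_one (sub_mul_lt_one h1 h2) h3) h4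
  simpa [pow_add] using this

theorem even_of_nearSq₃ {h i k l : ℕ} {t : K} (ht : t ≠ 0)
    (hn : D.v₃.NearSq 1 ((-1) ^ h * η ^ i * (-(β - α)) ^ k * (-(4 + α + 3 * β)) ^ l * t ^ 2)) :
    Even (h + i) := by
  rw [nearSq_mul_sq ht] at hn
  refine even_of_nearSq_residue D.v₃_residue D.v₃_three_lt ?_ hn
  have h1 := sub_pow_lt_one (v := D.v₃) (x := -1) (m := -1) (by simp) h
  have h2 := sub_pow_lt_one (v := D.v₃) (x := η) (m := -1) (by simpa using D.v₃_eta) i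
  have h3 := sub_pow_lt_one (v := D.v₃) (x := -(β - α)) (m := 1) (by
    rw [← Valuation.map_neg]; convert D.v₃_beta_sub using 2; push_cast; ring) k
  have h4 := sub_pow_lt_one (v := D.v₃) (x := -(4 + α + 3 * β)) (m := 1) (by
    rw [← Valuation.map_neg]; convert D.v₃_five using 2; push_cast; ring) l
  have := sub_mul_lt_one (sub_mul_lt_one (sub_mul_lt_one h1 h2) h3) h4
  simpa [pow_add] using this

section dual

variable {c X Y : K}

omit [CharZero K] in
theorem dual_ne_zero (hX : X ≠ 0)
    (h : c * Y ^ 2 = X * (X ^ 2 + (20 + 4 * α) * X + -(12 * α ^ 2))) :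
    Y ≠ 0 ∧ X ^ 2 + (20 + 4 * α) * X + -(12 * α ^ 2) ≠ 0 := by
  have hQ : X ^ 2 + (20 + 4 * α) * X + -(12 * α ^ 2) ≠ 0 := by
    intro h0
    refine D.four_b_ne_sq (X + 10 + 2 * α) ?_
    rw [CubeRootTenArithmetic.b]
    linear_combination h0
  refine ⟨?_, hQ⟩
  rintro rfl
  rw [zero_pow two_ne_zero, mul_zero] at h
  exact mul_ne_zero hX hQ h.symm

theorem dual_nearSq₃' (hc : c ≠ 0) (hX : X ≠ 0)
    (h : c * Y ^ 2 = X * (X ^ 2 + (20 + 4 * α) * X + -(12 * α ^ 2))) :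
    D.v₃'.NearSq 1 (c * X) ∨ D.v₃'.NearSq 1 (-3 * (c * X)) := by
  obtain ⟨hY, hQ⟩ := D.dual_ne_zero hX h
  have hα : D.v₃' α = 1 := map_eq_one_of_sub_one_lt (by rw [D.v₃'_alpha_sub_one]; decide)
  have hn {n : ℤ} : D.v₃' (n : K) ≤ 1 := intCast_le_one n
  have hA : D.v₃' (20 + 4 * α) < 1 := by
    rw [show 20 + 4 * α = (4 : ℤ) * (α - 1) + (8 : ℤ) * 3 by push_cast; ring]
    refine map_add_lt _ ?_ ?_ <;> rw [map_mul, mul_comm]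
    · exact mul_lt_one_of_lt_of_le (by rw [D.v₃'_alpha_sub_one]; decide) hn
    · exact mul_lt_one_of_lt_of_le (by rw [D.v₃'_three]; decide) hn
  have h4 : D.v₃' ((4 : ℤ) : K) = 1 :=
    intCast_eq_one (v := D.v₃') Nat.prime_three D.v₃'_three_lt (by decide)
  have hB : D.v₃' (-(12 * α ^ 2)) = exp (-1 : ℤ) := by
    rw [Valuation.map_neg, show 12 * α ^ 2 = (4 : ℤ) * 3 * α ^ 2 by push_cast; ring, map_mul,
      map_mul, map_pow, hα, h4, D.v₃'_three]; decide
  have hX0 : 0 < D.v₃' X := by simpa [zero_lt_iff] using hX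
  rcases le_or_gt 1 (D.v₃' X) with hX1 | hX1
  · left
    have := NearSq.of_mul_eq_sq (v := D.v₃') (γ := 1) (d := X ^ 2) le_rfl zero_lt_one hY hQ h ?_
      (pow_ne_zero 2 hX) hc
    · rwa [nearSq_mul_sq hX] at this
    · rw [one_mul, show X ^ 2 + (20 + 4 * α) * X + -(12 * α ^ 2) - X ^ 2 =
        (20 + 4 * α) * X + -(12 * α ^ 2) by ring]
      refine map_add_lt _ ?_ ?_
      · rw [map_mul, map_pow, sq]
        exact mul_lt_mul_of_pos_right (hA.trans_le hX1) hX0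
      · rw [hB, map_pow]
        exact lt_of_lt_of_le (by decide) (one_le_pow₀ hX1)
  · right
    have hα0 := D.alpha_ne_zero
    have := NearSq.of_mul_eq_sq (v := D.v₃') (γ := 1) (d := -(12 * α ^ 2)) le_rfl zero_lt_one
      hY hQ h ?_ (neg_ne_zero.2 (mul_ne_zero (by norm_num) (pow_ne_zero 2 hα0))) hc
    · rwa [show c * X * -(12 * α ^ 2) = -3 * (c * X) * (2 * α) ^ 2 by ring,
        nearSq_mul_sq (mul_ne_zero two_ne_zero hα0)] at this
    · rw [one_mul, add_sub_cancel_right, hB]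
      rw [lt_one_iff] at hX1 hA
      refine map_add_lt _ ?_ ?_
      · rw [map_pow]
        exact (pow_le_pow_left' hX1 2).trans_lt (by decide)
      · rw [map_mul]
        exact (mul_le_mul' hA hX1).trans_lt (by decide)

end dual

section DualQuartic

variable {c X Y : K}

theorem dual_nearSq₃ (hc : c ≠ 0) (hX : X ≠ 0)
    (h : c * Y ^ 2 = X * (X ^ 2 + (20 + 4 * α) * X + -(12 * α ^ 2))) :
    D.v₃.NearSq 1 (c * X) ∨ D.v₃ (X - (α - 1)) ≤ exp (-2 : ℤ) := by
  obtain ⟨hY, hQ⟩ := D.dual_ne_zero hX h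
  have hw0 := D.alpha_sub_one_ne_zero
  have hX0 : 0 < D.v₃ X := by simpa [zero_lt_iff] using hX
  have hw := D.v₃_alpha_sub_one
  have h3 : D.v₃ 3 = exp (-2 : ℤ) := by rw [D.v₃_three]; decide
  set w := α - 1 with hwdef
  have hα : α = w + 1 := by rw [hwdef]; ring
  have hw2 : D.v₃ (w ^ 2) = exp (-2 : ℤ) := by rw [map_pow, hw]; decide
  have h3w : D.v₃ (3 * w) ≤ exp (-3 : ℤ) := mul_le_exp _ h3.le hw.le (by norm_num)
  have h3w2 : D.v₃ (3 * w ^ 2) ≤ exp (-3 : ℤ) := mul_le_exp _ h3.le hw2.le (by norm_num)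
  have hs : D.v₃ (3 + w ^ 2) ≤ exp (-3 : ℤ) := by
    rw [hwdef, ← D.three_mul_beta_sub, show 3 + 3 * (β - α) = 3 * (β - α + 1) by ring]
    exact mul_le_exp _ h3.le (lt_one_iff.1 D.v₃_beta_sub) (by norm_num)
  have hA : D.v₃ (20 + 4 * α) ≤ exp (-1 : ℤ) := by
    rw [hα, show 20 + 4 * (w + 1) = (4 : ℤ) * w + (8 : ℤ) * 3 by push_cast; ring]
    exact map_add_le _ (intCast_mul_le _ hw.le)
      (intCast_mul_le _ (by rw [h3]; decide))
  have near_of_le (hd : D.v₃ (X ^ 2 + (20 + 4 * α) * X + -(12 * α ^ 2) - w ^ 2) ≤ exp (-3 : ℤ)) :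
      D.v₃.NearSq 1 (c * X) := by
    have := NearSq.of_mul_eq_sq (v := D.v₃) (γ := 1) (d := w ^ 2) le_rfl zero_lt_one
      hY hQ h (hd.trans_lt (by rw [hw2]; decide)) (pow_ne_zero 2 hw0) hc
    rwa [nearSq_mul_sq hw0] at this
  have hBw : D.v₃ (-(12 * α ^ 2) - w ^ 2) ≤ exp (-3 : ℤ) := by
    rw [hα, show -(12 * (w + 1) ^ 2) - w ^ 2 =
      (-4 : ℤ) * (3 + w ^ 2) + (-8 : ℤ) * (3 * w) + (-3 : ℤ) * (3 * w ^ 2) by push_cast; ring]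
    exact map_add_le _ (map_add_le _ (intCast_mul_le _ hs) (intCast_mul_le _ h3w))
      (intCast_mul_le _ h3w2)
  rcases le_or_gt 1 (D.v₃ X) with hX1 | hX1
  · left
    have := NearSq.of_mul_eq_sq (v := D.v₃) (γ := 1) (d := X ^ 2) le_rfl zero_lt_one hY hQ h ?_
      (pow_ne_zero 2 hX) hc
    · rwa [nearSq_mul_sq hX] at this
    · rw [one_mul, show X ^ 2 + (20 + 4 * α) * X + -(12 * α ^ 2) - X ^ 2 =
        (20 + 4 * α) * X + ((-(12 * α ^ 2) - w ^ 2) + w ^ 2) by ring]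
      refine map_add_lt _ ?_ ?_
      · rw [map_mul, map_pow, sq]
        refine mul_lt_mul_of_pos_right (lt_of_lt_of_le (hA.trans_lt (by decide)) hX1) hX0
      · rw [map_pow]
        refine lt_of_lt_of_le ?_ (one_le_pow₀ hX1)
        exact map_add_lt _ (hBw.trans_lt (by decide)) (by rw [hw2]; decide)
  · rw [lt_one_iff] at hX1
    obtain ⟨n, hn⟩ := D.v₃_residue (X / w) (by
      rw [map_div₀, hw, div_le_one₀ (by decide)]; exact hX1)
    have hn' : ∀ m : ℤ, (3 : ℤ) ∣ n - m → D.v₃ (X - m * w) ≤ exp (-2 : ℤ) := by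
      intro m hm
      have h1 : D.v₃ ((n - m : ℤ) : K) < 1 := by
        refine (intCast_le_of_dvd (p := 3) (by exact_mod_cast hm)).trans_lt ?_
        rw [Nat.cast_ofNat, h3]; decide
      push_cast at h1
      have h2 : D.v₃ (X / w - m) < 1 := by
        rw [show X / w - m = (X / w - n) + (n - m) by ring]
        exact map_add_lt _ hn h1
      rw [show X - m * w = (X / w - m) * w by field_simp]
      exact mul_le_exp _ (lt_one_iff.1 h2) hw.le (by norm_num)
    have : (3 : ℤ) ∣ n - 0 ∨ (3 : ℤ) ∣ n - 1 ∨ (3 : ℤ) ∣ n - (-1) := by omega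
    rcases this with hm | hm | hm
    · left
      have hX2 := hn' _ hm
      rw [Int.cast_zero, zero_mul, sub_zero] at hX2
      refine near_of_le ?_
      rw [show X ^ 2 + (20 + 4 * α) * X + -(12 * α ^ 2) - w ^ 2 =
        X * X + (20 + 4 * α) * X + (-(12 * α ^ 2) - w ^ 2) by ring]
      exact map_add_le _ (map_add_le _ (mul_le_exp _ hX2 hX2 (by norm_num))
        (mul_le_exp _ hA hX2 (by norm_num))) hBw
    · right
      simpa using hn' _ hm
    · left
      have hX2 := hn' _ hm
      push_cast at hX2
      set e := X - -1 * w with he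
      have hXe : X = -w + e := by rw [he]; ring
      refine near_of_le ?_
      have h24 : D.v₃ ((2 : ℤ) * w + e + (8 : ℤ) * 3) ≤ exp (-1 : ℤ) :=
        map_add_le _ (map_add_le _ (intCast_mul_le _ hw.le) (hX2.trans (by decide)))
          (intCast_mul_le _ (by rw [h3]; decide))
      rw [hα, hXe, show (-w + e) ^ 2 + (20 + 4 * (w + 1)) * (-w + e) + -(12 * (w + 1) ^ 2) - w ^ 2
        = (-4 : ℤ) * (3 + w ^ 2) + (-4 : ℤ) * (3 * w ^ 2) + e * ((2 : ℤ) * w + e + (8 : ℤ) * 3) +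
          (-16 : ℤ) * (3 * w) by push_cast; ring]
      exact map_add_le _ (map_add_le _ (map_add_le _ (intCast_mul_le _ hs)
        (intCast_mul_le _ h3w2)) (mul_le_exp _ hX2 h24 (by norm_num))) (intCast_mul_le _ h3w)

theorem dual_class (hc : c = 1 ∨ c = b) (hX : X ≠ 0)
    (h : c * Y ^ 2 = X * (X ^ 2 + (20 + 4 * α) * X + -(12 * α ^ 2))) :
    ∃ (i k l : ℕ) (t : K), t ≠ 0 ∧ i ≤ 1 ∧ k ≤ 1 ∧ l ≤ 1 ∧ (c = b → i = 0) ∧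
      c * X = (η * β) ^ i * (-(β - α)) ^ k * (-(4 + α + 3 * β)) ^ l * t ^ 2 := by
  have hc0 : c ≠ 0 := by
    rcases hc with rfl | rfl
    exacts [one_ne_zero, D.b_ne_zero]
  have hw0 := D.alpha_sub_one_ne_zero
  obtain ⟨hY, hQ⟩ := D.dual_ne_zero hX h
  have hx0 : c * X ≠ 0 := mul_ne_zero hc0 hX
  have c_unit : ∀ v : Valuation K ℤᵐ⁰, v 3 = 1 → v 5 = 1 → v α ≤ 1 → v c = 1 := by
    intro v h3 h5 hα
    rcases hc with rfl | rfl
    exacts [map_one _, b_eq_one h3 h5 hα]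
  have hc2 : D.v₂ c = 1 := c_unit _ D.v₂_three D.v₂_five (by rw [D.v₂_alpha]; decide)
  obtain ⟨h', i, j, k, l, t, ht, hh, hi, hj, hk, hl, e⟩ := D.classes' hx0
    ((isSquareAt_of_eq_one hc2).mul (isSquareAt_of_eq hc2 (pow_ne_zero 4 D.alpha_ne_zero)
      ⟨α ^ 2, by rw [← map_pow]; ring_nf⟩ (by
        rw [map_pow, D.v₂_alpha, show 20 + 4 * α = 2 ^ 2 * 5 + 2 ^ 2 * α by ring]
        refine map_add_le _ ?_ ?_
        · rw [map_mul, map_pow, v₂_two_eq, v₂_five]; decide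
        · rw [map_mul, map_pow, v₂_two_eq, D.v₂_alpha]; decide) (by
        rw [Valuation.map_neg, show (12 : K) = 2 ^ 2 * 3 by norm_num, map_mul, map_mul, map_pow,
          v₂_two_eq, v₂_three, map_pow, map_pow, D.v₂_alpha]; decide) hX h))
    (fun v h2 h3 h5 hα => by
      have hc1 := c_unit v h3 h5 hα
      refine (isSquareAt_of_eq_one hc1).mul (isSquareAt_of_eq hc1 one_ne_zero
        (isSquareAt_of_eq_one (map_one _)) ?_ ?_ hX h)
      · rw [map_one]
        refine map_add_le _ ?_ ?_
        · exact_mod_cast intCast_le_one (v := v) 20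
        · exact_mod_cast intCast_mul_le (v := v) 4 hα
      · rw [Valuation.map_neg, show (12 : K) = 2 ^ 2 * 3 by norm_num]
        simp [h2, h3, D.alpha_eq_one h2 h5])
  change c * X = D.gen h' i j k l * t ^ 2 at e
  have even : Even (h' + k + l) := by
    rcases D.dual_nearSq₃' hc0 hX h with hn | hn
    · obtain rfl : k = 0 := by
        rw [← D.parity₃' ht hk, ← e]; exact hn.isSquareAt le_rfl
      refine D.even_of_nearSq₃' (i := i) (j := j) ht ?_
      rw [e] at hn
      simpa [gen] using hn
    · obtain rfl : k = 1 := by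
        by_contra hk1
        obtain rfl : k = 0 := by omega
        have h3 : D.v₃'.IsSquareAt (c * X) := by rw [e, D.parity₃' ht hk]
        refine not_isSquareAt_of_eq_exp ?_ ((hn.isSquareAt le_rfl).of_mul h3 hx0)
        rw [Valuation.map_neg, D.v₃'_three]
      rw [show h' + 1 + l = (h' + 1) + l by ring]
      refine D.even_of_nearSq₃' (i := i) (j := j) (t := (α - 1) * t) (mul_ne_zero hw0 ht) ?_
      convert hn using 1
      rw [e, gen, mul_pow, ← D.three_mul_beta_sub]
      ring
  have e' : c * X = η ^ i * β ^ j * (-(β - α)) ^ k * (-(4 + α + 3 * β)) ^ l * t ^ 2 := by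
    have h1 : (-1 : K) ^ h' = (-1) ^ k * (-1) ^ l := by
      have : (-1 : K) ^ (h' + k + l) = 1 := even.neg_one_pow
      rw [pow_add, pow_add, mul_assoc] at this
      have h2 : ((-1 : K) ^ k * (-1) ^ l) * ((-1) ^ k * (-1) ^ l) = 1 := by
        rw [← pow_add, ← pow_add, ← two_mul, pow_mul]; simp
      linear_combination ((-1 : K) ^ k * (-1) ^ l) * this - (-1) ^ h' * h2
    rw [e, gen, h1, neg_pow (β - α), neg_pow (4 + α + 3 * β)]
    ring
  have main : i = j ∧ (c = b → i = 0) := by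
    have near_case (hn : D.v₃.NearSq 1 (c * X)) : i = 0 ∧ j = 0 := by
      obtain rfl : j = 0 := by
        rw [← D.parity₃ ht hj, ← e]; exact hn.isSquareAt le_rfl
      refine ⟨?_, rfl⟩
      have := D.even_of_nearSq₃ (h := 0) (i := i) (k := k) (l := l) ht (by simpa [e'] using hn)
      grind
    rcases D.dual_nearSq₃ hc0 hX h with hn | hn
    · obtain ⟨rfl, rfl⟩ := near_case hn
      simp
    · rcases hc with rfl | rfl
      · have hXw : D.v₃.NearSq 1 (X * (α - 1)) := nearSq_mul_of_lt le_rfl zero_lt_one hw0 (by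
          rw [one_mul, D.v₃_alpha_sub_one]; exact hn.trans_lt (by decide))
        rw [one_mul] at e e' hx0
        obtain rfl : j = 1 := by
          by_contra hj1
          obtain rfl : j = 0 := by omega
          have h3 : D.v₃.IsSquareAt X := by rw [e, D.parity₃ ht hj]
          have := hXw.isSquareAt le_rfl
          rw [mul_comm] at this
          exact not_isSquareAt_of_eq_exp D.v₃_alpha_sub_one (this.of_mul h3 hx0)
        have hev := D.even_of_nearSq₃ (h := 1) (i := i) (k := k + 1) (l := l)
          (t := (α - 1) * t / (β - α))
          (div_ne_zero (mul_ne_zero hw0 ht) D.beta_sub_ne_zero) (by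
            convert hXw using 1
            rw [e', div_pow, mul_pow, ← D.three_mul_beta_sub, ← D.sub_one_mul_beta]
            have := D.beta_sub_ne_zero
            field_simp
            ring)
        refine ⟨by grind, fun hb => ?_⟩
        have := D.v₃_b
        rw [← hb, map_one] at this
        exact absurd this (by decide)
      · exfalso
        have hXv : D.v₃ X = exp (-1 : ℤ) := by
          rw [← D.v₃_alpha_sub_one]
          refine D.v₃.map_eq_of_sub_lt ?_
          rw [D.v₃_alpha_sub_one]; exact hn.trans_lt (by decide)
        have h4 : D.v₃ 4 = 1 := by
          exact_mod_cast intCast_eq_one (v := D.v₃) Nat.prime_three D.v₃_three_lt (n := 4)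
            (by decide)
        have hQv : D.v₃ (X ^ 2 + (20 + 4 * α) * X + -(12 * α ^ 2)) = exp (-3 : ℤ) := by
          have h4b : D.v₃ (-(4 * b)) = exp (-3 : ℤ) := by
            rw [Valuation.map_neg, map_mul, h4, one_mul, v₃_b]
          have h1 : D.v₃ (X - (α - 1) + (3 : ℤ) * (α - 1) + (4 : ℤ) * 3) ≤ exp (-2 : ℤ) := by
            have h3 : D.v₃ 3 = exp (-2 : ℤ) := by rw [D.v₃_three]; decide
            refine map_add_le _ (map_add_le _ hn ?_) (intCast_mul_le _ h3.le)
            refine mul_le_exp _ (m := -2) (n := -1) ?_ D.v₃_alpha_sub_one.le (by norm_num)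
            push_cast; exact h3.le
          rw [← h4b, show X ^ 2 + (20 + 4 * α) * X + -(12 * α ^ 2) = -(4 * b) +
            (X - (α - 1) + (3 : ℤ) * (α - 1) + (4 : ℤ) * 3) ^ 2 by
              rw [CubeRootTenArithmetic.b]; push_cast; ring]
          refine D.v₃.map_add_eq_of_lt_left ?_
          rw [h4b, map_pow]
          exact (pow_le_pow_left' h1 2).trans_lt (by decide)
        have hv := congrArg D.v₃ h
        rw [map_mul, map_mul, map_pow, hQv, hXv, v₃_b] at hv
        have h0 : exp (-3 : ℤ) ≠ 0 := exp_ne_zero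
        have hv' : D.v₃ Y ^ 2 = exp (-1 : ℤ) := by
          rw [mul_comm] at hv
          exact mul_right_cancel₀ h0 hv
        exact exp_neg_one_ne_sq _ hv'
  obtain ⟨rfl, hb⟩ := main
  exact ⟨i, k, l, t, ht, hi, hk, hl, hb, by rw [e', mul_pow]⟩

end DualQuartic

section MainQuartic

variable {c V Y : K}

omit [CharZero K] in
theorem v₂_b_sub_one : D.v₂ (b - 1) ≤ exp (-4 : ℤ) := by
  rw [CubeRootTenArithmetic.b, show 25 + 10 * α + 4 * α ^ 2 - 1 =
    (3 : ℤ) * 2 ^ 3 + (5 : ℤ) * (2 * α) + 2 ^ 2 * α ^ 2 by push_cast; ring]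
  refine map_add_le _ (map_add_le _ (intCast_mul_le _ ?_) (intCast_mul_le _ ?_)) ?_ <;>
  simp only [map_mul, map_pow, v₂_two_eq, D.v₂_alpha] <;> decide

theorem v₂_eta_sub : D.v₂ (η - 1 - α) ≤ exp (-2 : ℤ) := by
  have h : (3 : K) * (η - 1 - α) = (10 : ℤ) * 2 + (4 : ℤ) * (2 * α) + (5 : ℤ) * α ^ 2 := by
    rw [CubeRootTenArithmetic.η]
    push_cast
    linear_combination 5 * D.three_mul_beta
  rw [← one_mul (D.v₂ _), ← D.v₂_three, ← map_mul, h]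
  refine map_add_le _ (map_add_le _ (intCast_mul_le _ ?_) (intCast_mul_le _ ?_))
    (intCast_mul_le _ ?_) <;>
  simp only [map_mul, map_pow, v₂_two_eq, D.v₂_alpha] <;> decide

theorem main_ne_zero (hV : V ≠ 0)
    (h : c * Y ^ 2 = V * (V ^ 2 + -(10 + 2 * α) * V + b)) :
    Y ≠ 0 ∧ V ^ 2 + -(10 + 2 * α) * V + b ≠ 0 := by
  have hQ : V ^ 2 + -(10 + 2 * α) * V + b ≠ 0 := by
    intro h0
    have h1 : (2 * V - (10 + 2 * α)) ^ 2 = -(12 * α ^ 2) := by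
      rw [CubeRootTenArithmetic.b] at h0
      linear_combination 4 * h0
    have h2 := congrArg D.φ h1
    simp only [map_pow, _root_.map_neg, map_mul, map_ofNat] at h2
    have := pow_pos D.phi_alpha_pos 2
    have := sq_nonneg (D.φ (2 * V - (10 + 2 * α)))
    linarith
  refine ⟨?_, hQ⟩
  rintro rfl
  rw [zero_pow two_ne_zero, mul_zero] at h
  exact mul_ne_zero hV hQ h.symm

theorem main_pos (hc : c = 1 ∨ c = b) (hV : V ≠ 0)
    (h : c * Y ^ 2 = V * (V ^ 2 + -(10 + 2 * α) * V + b)) : 0 < D.φ V := by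
  have ha := D.phi_alpha_pos
  have hφb : D.φ b = 25 + 10 * D.φ α + 4 * D.φ α ^ 2 := by
    rw [CubeRootTenArithmetic.b]; simp only [map_add, map_mul, map_pow, map_ofNat]
  have hφc : 0 < D.φ c := by
    rcases hc with rfl | rfl
    · simp
    · rw [hφb]; positivity
  have h1 := congrArg D.φ h
  simp only [map_mul, map_pow, map_add, _root_.map_neg, map_ofNat, hφb] at h1
  have hV' : D.φ V ≠ 0 := (map_ne_zero D.φ).2 hV
  have hq : 0 < D.φ V ^ 2 + -(10 + 2 * D.φ α) * D.φ V +
      (25 + 10 * D.φ α + 4 * D.φ α ^ 2) := by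
    nlinarith [sq_nonneg (D.φ V - (5 + D.φ α)), pow_pos ha 2]
  refine lt_of_le_of_ne (nonneg_of_mul_nonneg_left ?_ hq) hV'.symm
  rw [← h1]; positivity

omit [CharZero K] in
theorem v₅_int {n : ℤ} (hn : ¬ (5 : ℤ) ∣ n) : D.v₅ (n : K) = 1 :=
  intCast_eq_one Nat.prime_five D.v₅_five_lt hn

omit [CharZero K] in
theorem v₅_b_sub : D.v₅ (b - 4 * α ^ 2) ≤ exp (-3 : ℤ) := by
  rw [CubeRootTenArithmetic.b, show 25 + 10 * α + 4 * α ^ 2 - 4 * α ^ 2 =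
    (5 : ℤ) * 5 + (2 : ℤ) * α * 5 by push_cast; ring]
  refine map_add_le _ (intCast_mul_le _ D.v₅_five_eq.le) ?_
  rw [mul_assoc]
  refine intCast_mul_le _ (mul_le_exp _ D.v₅_alpha.le D.v₅_five_eq.le (by norm_num))

omit [CharZero K] in
theorem v₅_four_alpha_sq : D.v₅ (4 * α ^ 2) = exp (-2 : ℤ) := by
  have := D.v₅_int (n := 4) (by decide)
  push_cast at this
  rw [map_mul, this, map_pow, D.v₅_alpha]; decide

omit [CharZero K] in
theorem v₅_b : D.v₅ b = exp (-2 : ℤ) := by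
  rw [← D.v₅_four_alpha_sq]
  refine D.v₅.map_eq_of_sub_lt ?_
  rw [v₅_four_alpha_sq]
  exact D.v₅_b_sub.trans_lt (by decide)

theorem nearSq₅_b : D.v₅.NearSq 1 b := by
  rw [show b = b * 1 by ring]
  refine (nearSq_sq (c := 2 * α) zero_lt_one (mul_ne_zero two_ne_zero D.alpha_ne_zero)).of_lt
    le_rfl ?_
  rw [mul_one, one_mul, show (2 * α) ^ 2 = 4 * α ^ 2 by ring, v₅_four_alpha_sq]
  exact D.v₅_b_sub.trans_lt (by decide)

theorem main_nearSq₅ (hc : c = 1 ∨ c = b) (hV : V ≠ 0)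
    (h : c * Y ^ 2 = V * (V ^ 2 + -(10 + 2 * α) * V + b)) : D.v₅.NearSq 1 V := by
  have hc0 : c ≠ 0 := by
    rcases hc with rfl | rfl
    exacts [one_ne_zero, D.b_ne_zero]
  have hcn : D.v₅.NearSq 1 c := by
    rcases hc with rfl | rfl
    exacts [nearSq_of_sub_one_lt (by simp), D.nearSq₅_b]
  obtain ⟨hY, hQ⟩ := D.main_ne_zero hV h
  have hV0 : 0 < D.v₅ V := by simpa [zero_lt_iff] using hV
  have hA : D.v₅ (-(10 + 2 * α)) ≤ exp (-1 : ℤ) := by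
    rw [Valuation.map_neg, show 10 + 2 * α = (2 : ℤ) * 5 + (2 : ℤ) * α by push_cast; ring]
    exact map_add_le _ (intCast_mul_le _ (by rw [v₅_five_eq]; decide))
      (intCast_mul_le _ D.v₅_alpha.le)
  suffices hs : D.v₅.NearSq 1 (c * V) by rw [mul_comm] at hs; exact hs.of_mul le_rfl hcn
  rcases lt_trichotomy (D.v₅ V) (exp (-1 : ℤ)) with hlt | heq | hgt
  · have hV2 := lt_exp_iff.1 hlt
    norm_num at hV2
    have hα0 := mul_ne_zero (two_ne_zero' K) D.alpha_ne_zero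
    have := NearSq.of_mul_eq_sq (v := D.v₅) (γ := 1) (d := (2 * α) ^ 2) le_rfl zero_lt_one hY hQ h
      ?_ (pow_ne_zero 2 hα0) hc0
    · rwa [nearSq_mul_sq hα0] at this
    · rw [one_mul, show (2 * α) ^ 2 = 4 * α ^ 2 by ring, v₅_four_alpha_sq,
        show V ^ 2 + -(10 + 2 * α) * V + b - 4 * α ^ 2 =
          V * V + -(10 + 2 * α) * V + (b - 4 * α ^ 2) by ring]
      exact (map_add_le _ (map_add_le _ (mul_le_exp (-3) hV2 hV2 (by norm_num))
        (mul_le_exp _ hA hV2 (by norm_num))) D.v₅_b_sub).trans_lt (by decide)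
  · exfalso
    have hα0 := D.alpha_ne_zero
    set q := V / α with hq
    have hVq : V = α * q := by rw [hq]; field_simp
    have hq1 : D.v₅ q = 1 := by
      rw [hq, map_div₀, heq, D.v₅_alpha]; decide
    obtain ⟨n, hn⟩ := D.v₅_residue q hq1.le
    have hr : D.v₅ (q ^ 2 - 2 * q + 4) = 1 := by
      refine eq_one_of_residue (m := n ^ 2 - 2 * n + 4) Nat.prime_five D.v₅_five_lt ?_ ?_
      · intro hd
        have hn' := (ZMod.intCast_zmod_eq_zero_iff_dvd _ 5).2 hd
        push_cast at hn'
        generalize (n : ZMod 5) = m at hn'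
        revert m
        decide
      · push_cast
        rw [show q ^ 2 - 2 * q + 4 - (n ^ 2 - 2 * n + 4) = (q - n) * (q + (n - 2 : ℤ)) by
          push_cast; ring, map_mul]
        exact mul_lt_one_of_lt_of_le hn (map_add_le _ hq1.le (intCast_le_one _))
    have hQv : D.v₅ (V ^ 2 + -(10 + 2 * α) * V + b) = exp (-2 : ℤ) := by
      have e1 : D.v₅ (α ^ 2 * (q ^ 2 - 2 * q + 4)) = exp (-2 : ℤ) := by
        rw [map_mul, hr, map_pow, D.v₅_alpha]; decide
      rw [← e1, show V ^ 2 + -(10 + 2 * α) * V + b = α ^ 2 * (q ^ 2 - 2 * q + 4) +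
        (5 * ((-2 : ℤ) * V) + (b - 4 * α ^ 2)) by rw [hVq]; push_cast; ring]
      refine D.v₅.map_add_eq_of_lt_left ?_
      rw [e1]
      exact (map_add_le _ (mul_le_exp (-3) D.v₅_five_eq.le (intCast_mul_le _ heq.le)
        (by norm_num)) D.v₅_b_sub).trans_lt (by decide)
    have hv := congrArg D.v₅ h
    rw [map_mul, map_mul, map_pow, hQv, heq] at hv
    rcases hc with rfl | rfl
    · rw [map_one, one_mul] at hv
      refine exp_neg_one_ne_sq (D.v₅ Y * exp (1 : ℤ)) ?_
      rw [mul_pow, hv]; decide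
    · rw [v₅_b, mul_comm] at hv
      have h0 : exp (-2 : ℤ) ≠ 0 := exp_ne_zero
      exact exp_neg_one_ne_sq _ (mul_right_cancel₀ h0 hv)
  · have hV1 : 1 ≤ D.v₅ V := by
      by_contra! h1
      rw [lt_one_iff] at h1
      exact absurd hgt h1.not_gt
    have := NearSq.of_mul_eq_sq (v := D.v₅) (γ := 1) (d := V ^ 2) le_rfl zero_lt_one hY hQ h ?_
      (pow_ne_zero 2 hV) hc0
    · rwa [nearSq_mul_sq hV] at this
    · rw [one_mul, show V ^ 2 + -(10 + 2 * α) * V + b - V ^ 2 = -(10 + 2 * α) * V + b by ring]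
      refine map_add_lt _ ?_ ?_
      · rw [map_mul, map_pow, sq]
        exact mul_lt_mul_of_pos_right ((hA.trans_lt (by decide)).trans_le hV1) hV0
      · rw [v₅_b, map_pow]
        exact lt_of_lt_of_le (by decide) (one_le_pow₀ hV1)

omit [CharZero K] in
theorem v₂_sub_one_lt {x : K} (hx : D.v₂ x = 1) : D.v₂ (x - 1) < 1 := by
  have h2 : D.v₂ ((2 : ℕ) : K) < 1 := by exact_mod_cast D.v₂_two
  obtain ⟨n, hn⟩ := D.v₂_residue x hx.le
  have hodd : ¬ (2 : ℤ) ∣ n := by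
    intro hd
    have h1 := (intCast_le_of_dvd (v := D.v₂) (p := 2) hd).trans_lt h2
    have := map_add_lt D.v₂ hn h1
    rw [sub_add_cancel, hx] at this
    exact lt_irrefl _ this
  have h1 : D.v₂ ((n - 1 : ℤ) : K) < 1 :=
    (intCast_le_of_dvd (p := 2) (by push_cast; omega)).trans_lt h2
  rw [show x - 1 = (x - n) + ((n - 1 : ℤ) : K) by push_cast; ring]
  exact map_add_lt _ hn h1

omit [CharZero K] in
theorem v₂_b : D.v₂ b = 1 :=
  map_eq_one_of_sub_one_lt (D.v₂_b_sub_one.trans_lt (by decide))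

theorem main_nearSq₂ (hc : c = 1 ∨ c = b) (hV : V ≠ 0)
    (h : c * Y ^ 2 = V * (V ^ 2 + -(10 + 2 * α) * V + b)) :
    D.v₂.NearSq (exp (-1 : ℤ)) V := by
  have hγ : exp (-1 : ℤ) ≤ 1 := by decide
  have hγ0 : 0 < exp (-1 : ℤ) := by decide
  have hc0 : c ≠ 0 := by
    rcases hc with rfl | rfl
    exacts [one_ne_zero, D.b_ne_zero]
  have hcn : D.v₂.NearSq (exp (-1 : ℤ)) c := by
    rcases hc with rfl | rfl
    exacts [nearSq_of_sub_one_lt (by simp),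
      nearSq_of_sub_one_lt (D.v₂_b_sub_one.trans_lt (by decide))]
  obtain ⟨hY, hQ⟩ := D.main_ne_zero hV h
  have hV0 : 0 < D.v₂ V := by simpa [zero_lt_iff] using hV
  have hA : D.v₂ (-(10 + 2 * α)) ≤ exp (-3 : ℤ) := by
    rw [Valuation.map_neg, show 10 + 2 * α = (5 : ℤ) * 2 + 2 * α by push_cast; ring]
    exact map_add_le _ (intCast_mul_le _ D.v₂_two_eq.le)
      (mul_le_exp _ D.v₂_two_eq.le D.v₂_alpha.le (by norm_num))
  have key {d : K} (hd0 : d ≠ 0)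
      (hd : D.v₂ (V ^ 2 + -(10 + 2 * α) * V + b - d ^ 2) < exp (-1 : ℤ) * D.v₂ (d ^ 2)) :
      D.v₂.NearSq (exp (-1 : ℤ)) V := by
    have := NearSq.of_mul_eq_sq hγ hγ0 hY hQ h hd (pow_ne_zero 2 hd0) hc0
    rw [nearSq_mul_sq hd0, mul_comm] at this
    exact this.of_mul hγ hcn
  rcases lt_trichotomy (D.v₂ V) 1 with hlt | heq | hgt
  · have hV1 := lt_one_iff.1 hlt
    refine key one_ne_zero ?_
    rw [show V ^ 2 + -(10 + 2 * α) * V + b - 1 ^ 2 = V * V + -(10 + 2 * α) * V + (b - 1) by ring,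
      one_pow, map_one, mul_one]
    exact (map_add_le _ (map_add_le _ (mul_le_exp (-2) hV1 hV1 (by norm_num))
      (mul_le_exp _ hA hV1 (by norm_num))) (D.v₂_b_sub_one.trans (by decide))).trans_lt
      (by decide)
  · have hV1 := lt_one_iff.1 (D.v₂_sub_one_lt heq)
    rcases hV1.lt_or_eq with hV1 | hV1
    · exact nearSq_of_sub_one_lt hV1
    · have hne : V - 1 ≠ 0 := by
        intro h0
        rw [h0, map_zero] at hV1
        exact absurd hV1 (by decide)
      refine key hne ?_
      rw [show V ^ 2 + -(10 + 2 * α) * V + b - (V - 1) ^ 2 =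
        -((4 : ℤ) * 2 + 2 * α) * V + (b - 1) by push_cast; ring, map_pow, hV1]
      have h1 : D.v₂ (-((4 : ℤ) * 2 + 2 * α)) ≤ exp (-4 : ℤ) := by
        rw [Valuation.map_neg, show ((4 : ℤ) : K) = 2 * 2 by norm_num]
        refine map_add_le _ (mul_le_exp _ (mul_le_exp (-6) D.v₂_two_eq.le D.v₂_two_eq.le ?_)
          D.v₂_two_eq.le ?_) (mul_le_exp _ D.v₂_two_eq.le D.v₂_alpha.le ?_) <;> norm_num
      refine (map_add_le _ ?_ D.v₂_b_sub_one).trans_lt (by decide)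
      rw [map_mul, heq, mul_one]
      exact h1
  · have hV1 : exp (1 : ℤ) ≤ D.v₂ V := by
      by_contra! h1
      rw [lt_exp_iff] at h1
      exact absurd hgt h1.not_gt
    refine key hV ?_
    rw [show V ^ 2 + -(10 + 2 * α) * V + b - V ^ 2 = -(10 + 2 * α) * V + b by ring, map_pow, sq,
      ← mul_assoc]
    have h1 : 1 ≤ exp (-1 : ℤ) * D.v₂ V := by
      calc (1 : ℤᵐ⁰) = exp (-1 : ℤ) * exp (1 : ℤ) := by decide
        _ ≤ _ := by gcongr
    refine map_add_lt _ ?_ ?_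
    · rw [map_mul]
      exact mul_lt_mul_of_pos_right ((hA.trans_lt (by decide)).trans_le h1) hV0
    · rw [v₂_b]
      exact hgt.trans_le (le_mul_of_one_le_left' h1)

theorem not_nearSq₂_eta : ¬ D.v₂.NearSq (exp (-1 : ℤ)) η := by
  rintro ⟨t, ht⟩
  have hη : D.v₂ η = 1 := eta_eq_one (by rw [D.v₂_alpha]; decide)
  have h1 := NearSq.valuation_eq (v := D.v₂) (by decide) ht
  rw [hη, one_mul] at h1
  have ht1 : D.v₂ t = 1 := by
    simpa using h1
  have h2 := lt_one_iff.1 (D.v₂_sub_one_lt ht1)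
  have h3 : D.v₂ (t ^ 2 - 1) ≤ exp (-2 : ℤ) := by
    rw [show t ^ 2 - 1 = (t - 1) * (t - 1) + 2 * (t - 1) by ring]
    exact map_add_le _ (mul_le_exp _ h2 h2 (by norm_num))
      (mul_le_exp _ D.v₂_two_eq.le h2 (by norm_num))
  have h4 : D.v₂ α ≤ exp (-2 : ℤ) := by
    rw [show α = (η * t ^ 2 - 1) - ((η - 1 - α) * t ^ 2 + (1 + α) * (t ^ 2 - 1)) by ring]
    refine D.v₂.map_sub_le (lt_exp_iff.1 ht) (map_add_le _ ?_ ?_)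
    · rw [map_mul, map_pow, ht1, one_pow, mul_one]
      exact D.v₂_eta_sub
    · refine mul_le_exp _ (m := 0) (map_add_le _ (by simp) ?_) h3 (by norm_num)
      rw [D.v₂_alpha]; decide
  rw [D.v₂_alpha] at h4
  exact absurd h4 (by decide)

theorem main_class (hc : c = 1 ∨ c = b) (hV : V ≠ 0)
    (h : c * Y ^ 2 = V * (V ^ 2 + -(10 + 2 * α) * V + b)) :
    ∃ t : K, t ≠ 0 ∧ (V = t ^ 2 ∨ V = b * t ^ 2) := by
  have c_unit : ∀ v : Valuation K ℤᵐ⁰, v 3 = 1 → v 5 = 1 → v α ≤ 1 → v c = 1 := by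
    intro v h3 h5 hα
    rcases hc with rfl | rfl
    exacts [map_one _, b_eq_one h3 h5 hα]
  have key : ∀ v : Valuation K ℤᵐ⁰, v 3 = 1 → v 5 = 1 → v α ≤ 1 → v.IsSquareAt V := by
    intro v h3 h5 hα
    refine isSquareAt_of_eq (c_unit v h3 h5 hα) one_ne_zero (isSquareAt_of_eq_one (map_one _))
      ?_ ?_ hV h
    · rw [map_one, Valuation.map_neg]
      refine map_add_le _ ?_ ?_
      · exact_mod_cast intCast_le_one (v := v) 10
      · exact_mod_cast intCast_mul_le (v := v) 2 hα
    · rw [map_one, one_pow, b_eq_one h3 h5 hα]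
  obtain ⟨h', i, j, k, l, t, ht, hh, hi, hj, hk, hl, e⟩ := D.classes' hV
    (key _ D.v₂_three D.v₂_five (by rw [D.v₂_alpha]; decide)) (fun v _ h3 h5 hα => key v h3 h5 hα)
  change V = D.gen h' i j k l * t ^ 2 at e
  obtain rfl : h' = 0 := D.sign_eq_zero hh (by rw [← e]; exact D.main_pos hc hV h)
  have h5 := D.main_nearSq₅ hc hV h
  obtain rfl : l = 0 := by
    rw [← D.parity₅ ht hl, ← e]; exact h5.isSquareAt le_rfl
  have h2 := D.main_nearSq₂ hc hV h
  rw [e, nearSq_mul_sq ht] at h2 h5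
  have not_two {x : K} (hx : D.v₅ (x - 2) < 1) : ¬ D.v₅.NearSq 1 x := by
    have hx' : D.v₅ (x - (2 : ℤ)) < 1 := by exact_mod_cast hx
    refine not_nearSq_of_residue D.v₅_residue Nat.prime_five D.v₅_five_lt hx' ?_
      (eq_one_of_residue Nat.prime_five D.v₅_five_lt (by decide) hx')
    intro n hn
    have hn' := (ZMod.intCast_zmod_eq_zero_iff_dvd _ 5).2 hn
    push_cast at hn'
    generalize (n : ZMod 5) = m at hn'
    revert m
    decide
  have hη : D.v₅.NearSq 1 (η ^ i) := by
    interval_cases i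
    exacts [nearSq_of_sub_one_lt (by simp), nearSq_of_sub_one_lt (by simpa using D.v₅_eta)]
  obtain rfl : j = k := by
    interval_cases j <;> interval_cases k <;> first | rfl | exfalso
    · refine not_two D.v₅_beta_sub (NearSq.of_mul le_rfl ?_ hη)
      simpa [gen, mul_comm] using h5
    · refine not_two D.v₅_beta (NearSq.of_mul le_rfl ?_ hη)
      simpa [gen, mul_comm] using h5
  have e' : D.gen 0 i j j 0 = η ^ i * (α - 1) ^ j := by
    rw [gen, ← D.beta_mul_sub, mul_pow]; ring
  rw [e'] at h2 e
  have hs : 2 + α - β ≠ 0 := by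
    intro h0
    have := D.b_eq
    rw [h0] at this
    exact D.b_ne_zero (by rw [this]; ring)
  have hγ : exp (-1 : ℤ) ≤ 1 := by decide
  have hηα : D.v₂.NearSq (exp (-1 : ℤ)) (η * (α - 1)) := by
    rw [← nearSq_mul_sq hs, ← D.b_eq]
    exact nearSq_of_sub_one_lt (D.v₂_b_sub_one.trans_lt (by decide))
  interval_cases i <;> interval_cases j
  · exact ⟨t, ht, Or.inl (by rw [e]; ring)⟩
  · exact absurd (hηα.of_mul hγ (by simpa using h2)) D.not_nearSq₂_eta
  · exact absurd (by simpa using h2) D.not_nearSq₂_eta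
  · refine ⟨t / (2 + α - β), div_ne_zero ht hs, Or.inr ?_⟩
    rw [e, D.b_eq]
    field_simp

end MainQuartic

end CubeRootTenArithmetic

end Descent

/-! ### The quartics `w ^ 2 = 1 + A * z ^ 2 + B * z ^ 4` -/

/-- The affine points of the quartic `w ^ 2 = 1 + A * z ^ 2 + B * z ^ 4`, an elliptic curve with
neutral element `(0, 1)` and two-torsion point `(0, -1)`. -/
def JacobiQuartic {F : Type*} [CommRing F] (A B z w : F) : Prop :=
  w ^ 2 = 1 + A * z ^ 2 + B * z ^ 4

namespace JacobiQuartic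

section CommRing

variable {F : Type*} [CommRing F] {A B z w z₁ w₁ z₂ w₂ : F}

theorem mul_sign {s : F} (h : JacobiQuartic A B z w) (hs : s ^ 2 = 1) :
    JacobiQuartic A B (s * z) (s * w) := by
  unfold JacobiQuartic at *
  linear_combination s ^ 2 * h + (1 - B * z ^ 4 * s ^ 2) * hs

theorem sub_mul_pow (h₁ : JacobiQuartic A B z₁ w₁) (h₂ : JacobiQuartic A B z₂ w₂) :
    ((w₁ * w₂ - A * z₁ * z₂) * (1 + B * z₁ ^ 2 * z₂ ^ 2) -
      2 * B * z₁ * z₂ * (z₁ ^ 2 + z₂ ^ 2)) ^ 2 =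
    (1 - B * z₁ ^ 2 * z₂ ^ 2) ^ 4 +
      A * (z₁ * w₂ - z₂ * w₁) ^ 2 * (1 - B * z₁ ^ 2 * z₂ ^ 2) ^ 2 +
      B * (z₁ * w₂ - z₂ * w₁) ^ 4 := by
  unfold JacobiQuartic at *
  grind

theorem form_mul_form_sub (h₁ : JacobiQuartic A B z₁ w₁) (h₂ : JacobiQuartic A B z₂ w₂) :
    (2 * (1 + w₁) + A * z₁ ^ 2) * (2 * (1 + w₂) + A * z₂ ^ 2) *
      (2 * ((1 - B * z₁ ^ 2 * z₂ ^ 2) ^ 2 + ((w₁ * w₂ - A * z₁ * z₂) *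
        (1 + B * z₁ ^ 2 * z₂ ^ 2) - 2 * B * z₁ * z₂ * (z₁ ^ 2 + z₂ ^ 2))) +
        A * (z₁ * w₂ - z₂ * w₁) ^ 2) =
    (2 * (1 + w₁) * (1 + w₂) + A * (z₁ ^ 2 + z₂ ^ 2 - z₁ * z₂) -
      2 * B * z₁ * z₂ * (z₁ ^ 2 + z₁ * z₂ + z₂ ^ 2) + A ^ 2 * z₁ ^ 2 * z₂ ^ 2 -
      A * B * z₁ ^ 3 * z₂ ^ 3 + w₂ * (-A * z₁ * z₂ + A * z₁ ^ 2 - 2 * B * z₁ ^ 3 * z₂) +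
      w₁ * (A * z₂ ^ 2 - A * z₁ * z₂ - 2 * B * z₁ * z₂ ^ 3) - A * z₁ * z₂ * w₁ * w₂) ^ 2 := by
  unfold JacobiQuartic at *
  grind

/-- The form `2 * (1 + w) + A * z ^ 2` takes at `(z, w)` and `(-z, -w)` values whose product is
`(A ^ 2 - 4 * B) * z ^ 4`. -/
theorem form_mul_form_neg (h : JacobiQuartic A B z w) :
    (2 * (1 + w) + A * z ^ 2) * (2 * (1 - w) + A * z ^ 2) = (A ^ 2 - 4 * B) * z ^ 4 := by
  unfold JacobiQuartic at h
  linear_combination -4 * h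

theorem dual (h : JacobiQuartic A B z w) :
    4 * (2 * (1 + w) + A * z ^ 2) ^ 2 = (2 * (1 + w) + A * z ^ 2) *
      ((2 * (1 + w) + A * z ^ 2) ^ 2 - 2 * A * z ^ 2 * (2 * (1 + w) + A * z ^ 2) +
        (A ^ 2 - 4 * B) * z ^ 4) := by
  unfold JacobiQuartic at h
  linear_combination -4 * (2 * (1 + w) + A * z ^ 2) * h

end CommRing

section Field

variable {F : Type*} [Field F] {A B z w z₁ w₁ z₂ w₂ r : F}

theorem denom_ne_zero (hB : ¬ IsSquare B) (z₁ z₂ : F) : 1 - B * z₁ ^ 2 * z₂ ^ 2 ≠ 0 := by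
  intro h
  have h0 : z₁ * z₂ ≠ 0 := by
    intro h0
    exact one_ne_zero (α := F) (by linear_combination h + B * (z₁ * z₂) * h0)
  exact hB ⟨(z₁ * z₂)⁻¹, by
    obtain ⟨h1, h2⟩ := mul_ne_zero_iff.1 h0
    field_simp; linear_combination -h⟩

theorem sub (hB : ¬ IsSquare B) (h₁ : JacobiQuartic A B z₁ w₁) (h₂ : JacobiQuartic A B z₂ w₂) :
    JacobiQuartic A B ((z₁ * w₂ - z₂ * w₁) / (1 - B * z₁ ^ 2 * z₂ ^ 2))
      (((w₁ * w₂ - A * z₁ * z₂) * (1 + B * z₁ ^ 2 * z₂ ^ 2) -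
        2 * B * z₁ * z₂ * (z₁ ^ 2 + z₂ ^ 2)) / (1 - B * z₁ ^ 2 * z₂ ^ 2) ^ 2) := by
  have hd := denom_ne_zero hB z₁ z₂
  have := sub_mul_pow h₁ h₂
  unfold JacobiQuartic
  generalize 1 - B * z₁ ^ 2 * z₂ ^ 2 = d at *
  field_simp
  linear_combination this

/-- A point of the quartic at which `2 * (1 + w) + A * z ^ 2` is a square is a double, provided the
companion curve `y ^ 2 = v * (v ^ 2 + A * v + B)` has no points with `v` outside the square classes
of `1` and `B`. -/
theorem exists_double (hA : A ^ 2 - 4 * B ≠ 0) (hB : ¬ IsSquare B)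
    (hv : ∀ v y : F, v ≠ 0 → y ^ 2 = v * (v ^ 2 + A * v + B) →
      ∃ t, t ≠ 0 ∧ (v = t ^ 2 ∨ v = B * t ^ 2))
    (h : JacobiQuartic A B z w) (hr : 2 * (1 + w) + A * z ^ 2 = r ^ 2) :
    ∃ z₁ w₁, JacobiQuartic A B z₁ w₁ ∧ z * (1 - B * z₁ ^ 4) = 2 * z₁ * w₁ := by
  rcases eq_or_ne z 0 with rfl | hz
  · exact ⟨0, 1, by simp [JacobiQuartic], by simp⟩
  have hB0 : B ≠ 0 := by rintro rfl; exact hB (by simp)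
  have half {r τ : F} (hr : 2 * (1 + w) + A * z ^ 2 = r ^ 2) (hτ : τ ≠ 0)
      (h1 : 1 + w + r = τ ^ 2) :
      ∃ z₁ w₁, JacobiQuartic A B z₁ w₁ ∧ z * (1 - B * z₁ ^ 4) = 2 * z₁ * w₁ := by
    have h2 : B * z ^ 4 = τ ^ 2 * (1 + w - r) := by
      unfold JacobiQuartic at h
      rw [← h1]
      linear_combination -h - hr
    refine ⟨z / τ, r / τ, ?_, ?_⟩
    · unfold JacobiQuartic
      field_simp
      linear_combination -τ ^ 2 * hr - h2 + τ ^ 2 * h1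
    · field_simp
      linear_combination -h2 - τ ^ 2 * h1
  have hprod : (1 + w + r) * (1 + w - r) = B * z ^ 4 := by
    unfold JacobiQuartic at h
    linear_combination h + hr
  have hne : B * z ^ 4 ≠ 0 := mul_ne_zero hB0 (pow_ne_zero 4 hz)
  have h1 : 1 + w + r ≠ 0 := by
    intro h0; rw [h0, zero_mul] at hprod; exact hne hprod.symm
  obtain ⟨t, ht, hvt | hvt⟩ := hv ((1 + w + r) / z ^ 2) (r * (1 + w + r) / z ^ 3)
    (div_ne_zero h1 (pow_ne_zero 2 hz)) (by
      field_simp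
      linear_combination -(1 + w + r) * hr + hprod)
  · exact half hr (τ := t * z) (mul_ne_zero ht hz) (by rw [mul_pow, ← hvt]; field_simp)
  · refine half (r := -r) (by rw [hr]; ring) (τ := z / t) (div_ne_zero hz ht) ?_
    have h2 : 1 + w + r = B * t ^ 2 * z ^ 2 := by rw [← hvt]; field_simp
    rw [h2] at hprod
    have h3 : B * z ^ 2 ≠ 0 := mul_ne_zero hB0 (pow_ne_zero 2 hz)
    have h4 : t ^ 2 * (1 + w - r) = z ^ 2 := by
      apply mul_left_cancel₀ h3
      linear_combination hprod
    rw [div_pow, ← h4]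
    field_simp
    ring

theorem exists_double_sub (hA : A ^ 2 - 4 * B ≠ 0) (hB : ¬ IsSquare B)
    (hv : ∀ v y : F, v ≠ 0 → y ^ 2 = v * (v ^ 2 + A * v + B) →
      ∃ t, t ≠ 0 ∧ (v = t ^ 2 ∨ v = B * t ^ 2))
    (h₁ : JacobiQuartic A B z₁ w₁) (h₂ : JacobiQuartic A B z₂ w₂) (hr0 : r ≠ 0)
    (hr : (2 * (1 + w₁) + A * z₁ ^ 2) * (2 * (1 + w₂) + A * z₂ ^ 2) = r ^ 2) :
    ∃ z w, JacobiQuartic A B z w ∧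
      (z₁ * w₂ - z₂ * w₁) * (1 - B * z ^ 4) = 2 * z * w * (1 - B * z₁ ^ 2 * z₂ ^ 2) := by
  have hd := denom_ne_zero hB z₁ z₂
  have hf := form_mul_form_sub h₁ h₂
  obtain ⟨z, w, hJ, e⟩ := exists_double (r := _ / (r * (1 - B * z₁ ^ 2 * z₂ ^ 2))) hA hB hv
    (sub hB h₁ h₂) (by
      rw [div_pow _ (r * _), eq_div_iff (pow_ne_zero 2 (mul_ne_zero hr0 hd)), ← hf, mul_pow, ← hr]
      generalize 1 - B * z₁ ^ 2 * z₂ ^ 2 = d at *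
      field_simp)
  refine ⟨z, w, hJ, ?_⟩
  generalize 1 - B * z₁ ^ 2 * z₂ ^ 2 = d at *
  field_simp at e
  linear_combination e

end Field

end JacobiQuartic

namespace CubeRootTenArithmetic

variable {K : Type*} [Field K] [CharZero K] (D : CubeRootTenArithmetic K)

local notation "α" => CubeRootTenArithmetic.α D
local notation "β" => CubeRootTenArithmetic.β D
local notation "η" => CubeRootTenArithmetic.η D
local notation "b" => CubeRootTenArithmetic.b D

variable {A B c z w : K}

theorem exists_sign_class (hc : c = 1 ∨ c = b) (hA : A * c = -(10 + 2 * α)) (hB : B * c ^ 2 = b)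
    (h : JacobiQuartic A B z w) :
    ∃ (s : K) (i l : ℕ) (t : K), (s = 1 ∨ s = -1) ∧ t ≠ 0 ∧ i ≤ 1 ∧ l ≤ 1 ∧ (c = b → i = 0) ∧
      2 * (1 + s * w) + A * z ^ 2 = (η * β) ^ i * (-(4 + α + 3 * β)) ^ l * t ^ 2 := by
  have hc0 : c ≠ 0 := by
    rcases hc with rfl | rfl
    exacts [one_ne_zero, D.b_ne_zero]
  have hα0 := D.alpha_ne_zero
  have hdisc : c ^ 2 * (A ^ 2 - 4 * B) = -(12 * α ^ 2) := by
    rw [CubeRootTenArithmetic.b] at hB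
    linear_combination (A * c - (10 + 2 * α)) * hA - 4 * hB
  rcases eq_or_ne z 0 with rfl | hz
  · have hw : w * w = 1 := by unfold JacobiQuartic at h; linear_combination h
    exact ⟨w, 0, 0, 2, mul_self_eq_one_iff.1 hw, two_ne_zero, by simp, by simp, by simp,
      by linear_combination 2 * hw⟩
  have hprod := h.form_mul_form_neg
  set q := 2 * (1 + w) + A * z ^ 2 with hq
  have hq0 : q ≠ 0 := by
    intro h0
    rw [h0, zero_mul] at hprod
    have h1 : -(12 * α ^ 2) * z ^ 4 = 0 := by rw [← hdisc]; linear_combination -c ^ 2 * hprod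
    refine mul_ne_zero (neg_ne_zero.2 (mul_ne_zero ?_ (pow_ne_zero 2 hα0))) (pow_ne_zero 4 hz) h1
    norm_num
  obtain ⟨i, k, l, t, ht, hi, hk, hl, hci, e⟩ := D.dual_class (c := c) (X := c * q / z ^ 2)
    (Y := 2 * c * q / z ^ 3) hc (div_ne_zero (mul_ne_zero hc0 hq0) (pow_ne_zero 2 hz)) (by
      have hd := h.dual
      rw [← hq] at hd
      field_simp
      have hq' : 4 * q = q ^ 2 - 2 * A * z ^ 2 * q + (A ^ 2 - 4 * B) * z ^ 4 := by
        apply mul_left_cancel₀ hq0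
        linear_combination hd
      linear_combination c ^ 2 * hq' - 2 * c * z ^ 2 * q * hA + z ^ 4 * hdisc)
  have hβ := D.beta_sub_ne_zero
  set g := (η * β) ^ i * (-(4 + α + 3 * β)) ^ l with hg
  have hg0 : g ≠ 0 := mul_ne_zero (pow_ne_zero _ (mul_ne_zero D.eta_ne_zero D.beta_ne_zero))
    (pow_ne_zero _ (neg_ne_zero.2 D.five_ne_zero))
  have e' : c ^ 2 * q = g * (-(β - α)) ^ k * (t * z) ^ 2 := by
    have : c ^ 2 * q = c * (c * q / z ^ 2) * z ^ 2 := by field_simp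
    rw [this, e, hg]; ring
  interval_cases k
  · refine ⟨1, i, l, t * z / c, Or.inl rfl, div_ne_zero (mul_ne_zero ht hz) hc0, hi, hl, hci, ?_⟩
    rw [one_mul, ← hq, ← hg]
    field_simp
    linear_combination e'
  · refine ⟨-1, i, l, 2 * α * z * (α - 1) / (g * (β - α) * t), Or.inr rfl,
      div_ne_zero (mul_ne_zero (mul_ne_zero (mul_ne_zero two_ne_zero hα0) hz)
        D.alpha_sub_one_ne_zero) (mul_ne_zero (mul_ne_zero hg0 hβ) ht), hi, hl, hci, ?_⟩
    rw [← hg]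
    have h3 := D.three_mul_beta_sub
    set p := β - α with hp
    have e2 : -g * p * t ^ 2 * (2 * (1 + -1 * w) + A * z ^ 2) = -(12 * α ^ 2) * z ^ 2 := by
      apply mul_left_cancel₀ (pow_ne_zero 2 hz)
      linear_combination c ^ 2 * hprod + z ^ 4 * hdisc - (2 * (1 - w) + A * z ^ 2) * e'
    field_simp
    linear_combination -p * e2 + 4 * α ^ 2 * z ^ 2 * h3

omit [CharZero K] in
theorem not_isSquare_b : ¬ IsSquare b := by
  rintro ⟨y, hy⟩
  exact D.four_b_ne_sq (2 * y) (by rw [hy]; ring)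

theorem exists_double_sub {zε wε r : K} (hc : c = 1 ∨ c = b) (hA : A * c = -(10 + 2 * α))
    (hB : B * c ^ 2 = b) (h : JacobiQuartic A B z w) (hε : JacobiQuartic A B zε wε) (hr0 : r ≠ 0)
    (hr : (2 * (1 + w) + A * z ^ 2) * (2 * (1 + wε) + A * zε ^ 2) = r ^ 2) :
    ∃ z₁ w₁, JacobiQuartic A B z₁ w₁ ∧
      (z * wε - zε * w) * (1 - B * z₁ ^ 4) = 2 * z₁ * w₁ * (1 - B * z ^ 2 * zε ^ 2) := by
  have hc0 : c ≠ 0 := by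
    rcases hc with rfl | rfl
    exacts [one_ne_zero, D.b_ne_zero]
  refine JacobiQuartic.exists_double_sub ?_ ?_ ?_ h hε hr0 hr
  · intro h0
    have h1 : -(12 * α ^ 2) = 0 := by
      rw [CubeRootTenArithmetic.b] at hB
      linear_combination c ^ 2 * h0 - (A * c - (10 + 2 * α)) * hA + 4 * hB
    exact neg_ne_zero.2 (mul_ne_zero (by norm_num) (pow_ne_zero 2 D.alpha_ne_zero)) h1
  · rintro ⟨y, hy⟩
    exact D.not_isSquare_b ⟨c * y, by rw [← hB, hy]; ring⟩
  · intro v y hv e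
    obtain ⟨t, ht, h1⟩ := D.main_class (V := c * v) (Y := c * y) hc (mul_ne_zero hc0 hv) (by
      rw [← hA, ← hB]
      linear_combination c ^ 3 * e)
    rcases hc with rfl | rfl
    · refine ⟨t, ht, ?_⟩
      rwa [one_mul, ← hB, one_pow, mul_one] at h1
    · have hB' : B * b = 1 := by
        apply mul_right_cancel₀ hc0
        linear_combination hB
      rcases h1 with h1 | h1
      · exact ⟨t, ht, Or.inr (by linear_combination B * h1 - v * hB')⟩
      · exact ⟨t, ht, Or.inl (mul_left_cancel₀ hc0 h1)⟩

theorem exists_double_sub_of_class {s zε wε r t : K} {i l : ℕ} (hc : c = 1 ∨ c = b)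
    (hA : A * c = -(10 + 2 * α)) (hB : B * c ^ 2 = b) (h : JacobiQuartic A B z w)
    (hs : s = 1 ∨ s = -1) (ht : t ≠ 0)
    (e : 2 * (1 + s * w) + A * z ^ 2 = (η * β) ^ i * (-(4 + α + 3 * β)) ^ l * t ^ 2)
    (hε : JacobiQuartic A B zε wε) (hr0 : r ≠ 0)
    (hr : 2 * (1 + wε) + A * zε ^ 2 = (η * β) ^ i * (-(4 + α + 3 * β)) ^ l * r ^ 2) :
    ∃ z₁ w₁, JacobiQuartic A B z₁ w₁ ∧
      s * (z * wε - zε * w) * (1 - B * z₁ ^ 4) = 2 * z₁ * w₁ * (1 - B * z ^ 2 * zε ^ 2) := by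
  have hs2 : s ^ 2 = 1 := by rcases hs with rfl | rfl <;> ring
  have hg : (η * β) ^ i * (-(4 + α + 3 * β)) ^ l ≠ 0 :=
    mul_ne_zero (pow_ne_zero _ (mul_ne_zero D.eta_ne_zero D.beta_ne_zero))
      (pow_ne_zero _ (neg_ne_zero.2 D.five_ne_zero))
  obtain ⟨z₁, w₁, h1, e1⟩ := D.exists_double_sub hc hA hB (h.mul_sign hs2) hε
    (mul_ne_zero (mul_ne_zero hg ht) hr0) (by rw [mul_pow s z, hs2, one_mul, e, hr]; ring)
  refine ⟨z₁, w₁, h1, ?_⟩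
  rw [mul_pow s z, hs2, one_mul] at e1
  rw [← e1]; ring

/-- Two-descent on the quartic attached to the trivial class: up to sign, every point is one of four
explicit points plus a double. -/
theorem descent_one (h : JacobiQuartic (-(10 + 2 * α)) b z w) :
    ∃ s zε wε z₁ w₁ : K, (s = 1 ∨ s = -1) ∧ ((zε = 0 ∧ wε = 1) ∨
      (zε = -(α - 1) / 3 ∧ wε = (2 + 2 * α - α ^ 2) / 3) ∨
      (zε = (5 + 5 * α + 2 * α ^ 2) / 15 ∧ wε = -(110 + 50 * α + 23 * α ^ 2) / 15) ∨
      (zε = (α ^ 2 - 10) / 15 ∧ wε = (5 - 10 * α + 2 * α ^ 2) / 15)) ∧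
      JacobiQuartic (-(10 + 2 * α)) b z₁ w₁ ∧
      s * (z * wε - zε * w) * (1 - b * z₁ ^ 4) = 2 * z₁ * w₁ * (1 - b * z ^ 2 * zε ^ 2) := by
  have hA : -(10 + 2 * α) * 1 = -(10 + 2 * α) := mul_one _
  have hB : b * 1 ^ 2 = b := by ring
  obtain ⟨s, i, l, t, hs, ht, hi, hl, -, e⟩ := D.exists_sign_class (Or.inl rfl) hA hB h
  have key {zε wε r : K} := D.exists_double_sub_of_class (zε := zε) (wε := wε) (r := r)
    (Or.inl rfl) hA hB h hs ht e
  have hne {r q n : K} (hn : n ≠ 0) (hrq : r * q = n) : r ≠ 0 :=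
    left_ne_zero_of_mul (hrq ▸ hn)
  interval_cases i <;> interval_cases l
  · obtain ⟨z₁, w₁, h1⟩ := key (zε := 0) (wε := 1) (r := 2) (by simp [JacobiQuartic]) two_ne_zero
      (by norm_num)
    exact ⟨s, _, _, z₁, w₁, hs, Or.inl ⟨rfl, rfl⟩, h1⟩
  · obtain ⟨z₁, w₁, h1⟩ := key (zε := (5 + 5 * α + 2 * α ^ 2) / 15)
      (wε := -(110 + 50 * α + 23 * α ^ 2) / 15) (r := -(10 + 10 * α + α ^ 2) / 15)
      (by
        rw [JacobiQuartic, CubeRootTenArithmetic.b]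
        linear_combination ((-434/81) + (-2024/405) * α + (-746/225) * α ^ 2 +
          (-2636/2025) * α ^ 3 + (-4208/10125) * α ^ 4 + (-112/1125) * α ^ 5 +
          (-32/2025) * α ^ 6 + (-64/50625) * α ^ 7) * D.cube)
      (hne (n := -12/5) (q := (-2/5) * α + (2/5) * α ^ 2) (by norm_num) (by
        linear_combination ((-6/25) + (-2/75) * α) * D.cube))
      (by
        rw [CubeRootTenArithmetic.β]
        linear_combination ((52/45) + (17/45) * α + (14/225) * α ^ 2 + (1/225) * α ^ 3) * D.cube)
    exact ⟨s, _, _, z₁, w₁, hs, Or.inr (Or.inr (Or.inl ⟨rfl, rfl⟩)), h1⟩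
  · obtain ⟨z₁, w₁, h1⟩ := key (zε := -(α - 1) / 3)
      (wε := (2 + 2 * α - α ^ 2) / 3) (r := (10 + 2 * α - 3 * α ^ 2) / 3)
      (by
        rw [JacobiQuartic, CubeRootTenArithmetic.b]
        linear_combination ((-2/81) + (2/27) * α ^ 2 + (-4/81) * α ^ 3) * D.cube)
      (hne (n := 20/3) (q := (160/9) + (70/9) * α + (34/9) * α ^ 2) (by norm_num) (by
        linear_combination ((-142/27) + (-34/9) * α) * D.cube))
      (by
        rw [CubeRootTenArithmetic.η, CubeRootTenArithmetic.β]
        linear_combination ((212/81) + 5 * α + (136/27) * α ^ 2 + (121/81) * α ^ 3 +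
          (-28/27) * α ^ 4 + (-5/9) * α ^ 5) * D.cube)
    exact ⟨s, _, _, z₁, w₁, hs, Or.inr (Or.inl ⟨rfl, rfl⟩), h1⟩
  · obtain ⟨z₁, w₁, h1⟩ := key (zε := (α ^ 2 - 10) / 15)
      (wε := (5 - 10 * α + 2 * α ^ 2) / 15) (r := (40 + 20 * α - 18 * α ^ 2) / 15)
      (by
        rw [JacobiQuartic, CubeRootTenArithmetic.b]
        linear_combination ((56/405) + (62/405) * α + (-56/675) * α ^ 2 + (-4/135) * α ^ 3 +
          (8/1125) * α ^ 4 + (1/375) * α ^ 5 + (-2/10125) * α ^ 6 + (-4/50625) * α ^ 7) * D.cube)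
      (hne (n := -32/15) (q := (208/9) + (488/45) * α + (224/45) * α ^ 2) (by norm_num) (by
        linear_combination ((-4304/675) + (-448/75) * α) * D.cube))
      (by
        rw [CubeRootTenArithmetic.η, CubeRootTenArithmetic.β]
        linear_combination ((-3608/405) + (-10502/405) * α + (-68594/2025) * α ^ 2 +
          (-47576/2025) * α ^ 3 + (-9752/2025) * α ^ 4 + (7184/2025) * α ^ 5 +
          (536/225) * α ^ 6 + (4/5) * α ^ 7) * D.cube)
    exact ⟨s, _, _, z₁, w₁, hs, Or.inr (Or.inr (Or.inr ⟨rfl, rfl⟩)), h1⟩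

/-- Two-descent on the quartic attached to the class of `b`: up to sign, every point is a double or
`z = 3` plus a double. -/
theorem descent_two (hA : A * b = -(10 + 2 * α)) (hB : B * b = 1) (h : JacobiQuartic A B z w) :
    ∃ s zε wε z₁ w₁ : K, (s = 1 ∨ s = -1) ∧ ((zε = 0 ∧ wε = 1) ∨
      (zε = 3 ∧ wε = -(20 - 10 * α + 2 * α ^ 2) / 15)) ∧
      JacobiQuartic A B z₁ w₁ ∧
      s * (z * wε - zε * w) * (1 - B * z₁ ^ 4) = 2 * z₁ * w₁ * (1 - B * z ^ 2 * zε ^ 2) := by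
  have hB' : B * b ^ 2 = b := by linear_combination b * hB
  obtain ⟨s, i, l, t, hs, ht, -, hl, hi, e⟩ := D.exists_sign_class (Or.inr rfl) hA hB' h
  obtain rfl := hi rfl
  have key {zε wε r : K} := D.exists_double_sub_of_class (zε := zε) (wε := wε) (r := r)
    (Or.inr rfl) hA hB' h hs ht e
  have hne {r q n : K} (hn : n ≠ 0) (hrq : r * q = n) : r ≠ 0 :=
    left_ne_zero_of_mul (hrq ▸ hn)
  have hB2 : B = (5 - 2 * α) / 45 := by
    rw [eq_div_iff (by norm_num), ← D.b_mul]
    linear_combination (5 - 2 * α) * hB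
  have hA2 : A = -(10 + 2 * α) * ((5 - 2 * α) / 45) := by
    rw [← hB2, ← hA]
    linear_combination -A * hB
  interval_cases l
  · obtain ⟨z₁, w₁, h1⟩ := key (zε := 0) (wε := 1) (r := 2) (by simp [JacobiQuartic]) two_ne_zero
      (by norm_num)
    exact ⟨s, _, _, z₁, w₁, hs, Or.inl ⟨rfl, rfl⟩, h1⟩
  · obtain ⟨z₁, w₁, h1⟩ := key (zε := 3) (wε := -(20 - 10 * α + 2 * α ^ 2) / 15)
      (r := -10/3 + (2/3) * α + (7/15) * α ^ 2)
      (by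
        rw [JacobiQuartic, hA2, hB2]
        linear_combination ((-8/45) + (4/225) * α) * D.cube)
      (hne (n := 36/5) (q := 8 + (22/5) * α + 2 * α ^ 2) (by norm_num) (by
        linear_combination ((254/75) + (14/15) * α) * D.cube))
      (by
        rw [hA2, CubeRootTenArithmetic.β]
        linear_combination ((-202/45) + (-1/3) * α + (238/225) * α ^ 2 + (49/225) * α ^ 3) * D.cube)
    exact ⟨s, _, _, z₁, w₁, hs, Or.inr ⟨rfl, rfl⟩, h1⟩

end CubeRootTenArithmetic

/-! ### Local rings with a uniformizer whose cube is almost `2` -/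

/-- The element `π` is a uniformizer with residue field of two elements, and `2` is `π ^ 3` up to
a unit congruent to `1` modulo `π ^ 6`. -/
structure IsCubicUniformizer {R : Type u} [CommRing R] (π : R) : Prop where
  exists_two_eq : ∃ f, (2 : R) = π ^ 3 * (1 + π ^ 6 * f)
  ne_zero : π ≠ 0
  not_dvd_one : ¬ π ∣ 1
  dvd_or_dvd_sub_one : ∀ x, π ∣ x ∨ π ∣ x - 1
  exists_inv : ∀ x, ∃ y, (1 + π * x) * (1 + π * y) = 1
  exists_eq_pow_mul : ∀ x, x ≠ 0 → ∃ n u, x = π ^ n * (1 + π * u)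

namespace IsCubicUniformizer

variable {R : Type u} [CommRing R] {π : R} (h : IsCubicUniformizer π)

include h

theorem digit (x : R) : (∃ y, x = π * y) ∨ ∃ y, x = 1 + π * y := by
  rcases h.dvd_or_dvd_sub_one x with ⟨y, hy⟩ | ⟨y, hy⟩
  · exact Or.inl ⟨y, hy⟩
  · exact Or.inr ⟨y, by rw [← hy]; ring⟩

theorem ne_one (x : R) : π * x ≠ 1 := fun hx ↦ h.not_dvd_one ⟨x, hx.symm⟩

theorem mul_add_one (t : R) : ∃ k, t * (t + 1) = π * k := by
  obtain ⟨g, hg⟩ := h.exists_two_eq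
  rcases h.digit t with ⟨u, rfl⟩ | ⟨u, rfl⟩
  · exact ⟨u * (π * u + 1), by ring⟩
  · exact ⟨(1 + π * u) * (u + π ^ 2 * (1 + π ^ 6 * g)), by linear_combination (1 + π * u) * hg⟩

theorem exists_of_sq_eq [IsDomain R] (n : ℕ) {w x : R} (hw : w ^ 2 = π ^ (2 * n) * x) :
    ∃ y, w = π ^ n * y ∧ y ^ 2 = x := by
  induction n generalizing w with
  | zero => exact ⟨w, by simp, by simpa using hw⟩
  | succ n ih =>
    rcases h.digit w with ⟨y, rfl⟩ | ⟨y, rfl⟩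
    · obtain ⟨v, rfl, hv⟩ := ih (w := y) (by
        apply mul_left_cancel₀ (pow_ne_zero 2 h.ne_zero)
        linear_combination hw)
      exact ⟨v, by ring, hv⟩
    · exact absurd (by linear_combination -hw) (h.ne_one (π ^ (2 * n + 1) * x - 2 * y - π * y ^ 2))

/-- Reduction modulo a small power of `π` lands in characteristic two. -/
theorem exists_quotient [IsDomain R] (n : ℕ) (hn0 : n ≠ 0) (hn : n ≤ 3) :
    ∃ (Q : Type u) (_ : CommRing Q) (_ : CharP Q 2) (φ : R →+* Q), φ π ^ n = 0 ∧
      (∀ m < n, φ π ^ m ≠ 0) ∧ ∀ x, φ x = 0 → ∃ y, x = π ^ n * y := by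
  obtain ⟨f, hf⟩ := h.exists_two_eq
  have hmk (x : R) : Ideal.Quotient.mk (Ideal.span {π ^ n}) x = 0 ↔ π ^ n ∣ x :=
    Ideal.Quotient.eq_zero_iff_dvd _ _
  refine ⟨R ⧸ Ideal.span {π ^ n}, inferInstance, CharTwo.of_one_ne_zero_of_two_eq_zero ?_ ?_,
    Ideal.Quotient.mk _, ?_, fun m hmn ↦ ?_, fun x hx ↦ (hmk x).1 hx⟩
  · rw [← map_one (Ideal.Quotient.mk (Ideal.span {π ^ n})), Ne, hmk]
    exact fun hd ↦ h.not_dvd_one ((dvd_pow_self π hn0).trans hd)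
  · rw [← map_ofNat (Ideal.Quotient.mk (Ideal.span {π ^ n})) 2, hmk, hf]
    exact (pow_dvd_pow π hn).mul_right _
  · rw [← map_pow, hmk]
  · rw [← map_pow, Ne, hmk]
    intro hd
    obtain ⟨x, hx⟩ := (pow_dvd_pow π (show m + 1 ≤ n from hmn)).trans hd
    refine h.ne_one x (mul_left_cancel₀ (pow_ne_zero m h.ne_zero) ?_)
    rw [mul_one]
    exact Eq.symm (hx.trans (by ring))

theorem exists_inv_pow (n : ℕ) (x : R) :
    ∃ y, (1 + π ^ (n + 1) * x) * (1 + π ^ (n + 1) * y) = 1 := by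
  obtain ⟨y, hy⟩ := h.exists_inv (π ^ n * x)
  exact ⟨-x * (1 + π * y), by linear_combination -(π ^ (n + 1) * x) * hy⟩

theorem exists_eq_one_add_of_sq [IsDomain R] {w x : R} (hw : w ^ 2 = 1 + π ^ 4 * x) :
    ∃ m, w = 1 + π ^ 2 * m := by
  obtain ⟨f, hf⟩ := h.exists_two_eq
  rcases h.digit w with ⟨m, rfl⟩ | ⟨m, rfl⟩
  · exact absurd (by linear_combination hw) (h.ne_one (π * m ^ 2 - π ^ 3 * x))
  · obtain ⟨k, rfl, -⟩ := h.exists_of_sq_eq 1 (w := m) (x := x - (1 + π ^ 6 * f) * m) (by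
      apply mul_left_cancel₀ (pow_ne_zero 2 h.ne_zero)
      linear_combination hw - π * m * hf)
    exact ⟨k, by ring⟩

theorem exists_eq_one_add_of_sq' [IsDomain R] {w x : R} (hw : w ^ 2 = 1 + π ^ 7 * x) :
    ∃ m, w = 1 + π ^ 3 * m := by
  obtain ⟨f, hf⟩ := h.exists_two_eq
  obtain ⟨m, rfl⟩ := h.exists_eq_one_add_of_sq (x := π ^ 3 * x) (by rw [hw]; ring)
  have h1 : m ^ 2 = π * (π ^ 2 * x - (1 + π ^ 6 * f) * m) := by
    apply mul_left_cancel₀ (pow_ne_zero 4 h.ne_zero)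
    linear_combination hw - π ^ 2 * m * hf
  rcases h.digit m with ⟨k, rfl⟩ | ⟨k, hk⟩
  · exact ⟨k, by ring⟩
  · rw [hk] at h1
    exact absurd (by linear_combination -h1) (h.ne_one (π ^ 2 * x - (1 + π ^ 6 * f) * (1 + π * k) -
      2 * k - π * k ^ 2))

end IsCubicUniformizer

/-- The quartic `w ^ 2 = 1 + A * z ^ 2 + B * z ^ 4` is congruent to `w ^ 2 = (1 - z ^ 2) ^ 2`, and
its coefficients have prescribed leading digits. -/
structure IsSplitMod {R : Type*} [CommRing R] (π A B : R) : Prop where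
  exists_right_eq : ∃ b, B = 1 + π ^ 4 * (1 + π ^ 3 * b)
  exists_sum_eq : ∃ e, A + B + 1 = π ^ 8 * (1 + π ^ 2 + π ^ 4 * e)

namespace JacobiQuartic

variable {R : Type u} [CommRing R] [IsDomain R] {π A B z w : R} (h : IsCubicUniformizer π)
  (hAB : IsSplitMod π A B)

include h hAB

omit [IsDomain R] h in
theorem sq_eq (hJ : JacobiQuartic A B z w) :
    ∃ b e, B = 1 + π ^ 4 * (1 + π ^ 3 * b) ∧
      w ^ 2 = (1 - z ^ 2) * (1 - B * z ^ 2) + π ^ 8 * (1 + π ^ 2 + π ^ 4 * e) * z ^ 2 := by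
  obtain ⟨b, hb⟩ := hAB.exists_right_eq
  obtain ⟨e, he⟩ := hAB.exists_sum_eq
  exact ⟨b, e, hb, by rw [JacobiQuartic] at hJ; linear_combination hJ + z ^ 2 * he⟩

theorem sq_eq_of_one_add {x : R} (hJ : JacobiQuartic A B (1 + π ^ 2 * x) w) :
    ∃ f b e v, w = π ^ 4 * v ∧
      v ^ 2 = x * (x + π * (1 + π ^ 6 * f)) * (x * (x + π * (1 + π ^ 6 * f)) +
        (1 + π ^ 3 * b) * (1 + π ^ 2 * x) ^ 2) +
        (1 + π ^ 2 + π ^ 4 * e) * (1 + π ^ 2 * x) ^ 2 := by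
  obtain ⟨f, hf⟩ := h.exists_two_eq
  obtain ⟨b, e, hb, hw⟩ := sq_eq hAB hJ
  set z := 1 + π ^ 2 * x with hz
  have h1 : 1 - z ^ 2 = -π ^ 4 * (x * (x + π * (1 + π ^ 6 * f))) := by
    rw [hz]; linear_combination -π ^ 2 * x * hf
  have h2 : 1 - B * z ^ 2 =
      -π ^ 4 * (x * (x + π * (1 + π ^ 6 * f)) + (1 + π ^ 3 * b) * z ^ 2) := by
    rw [hb]; linear_combination h1
  obtain ⟨v, hwv, hv⟩ := h.exists_of_sq_eq 4 (w := w) (x := x * (x + π * (1 + π ^ 6 * f)) *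
    (x * (x + π * (1 + π ^ 6 * f)) + (1 + π ^ 3 * b) * z ^ 2) +
      (1 + π ^ 2 + π ^ 4 * e) * z ^ 2) (by rw [hw, h1, h2]; ring)
  exact ⟨f, b, e, v, hwv, hv⟩

theorem type_cases (hJ : JacobiQuartic A B z w) :
    (∃ t, z = π * t) ∨ (∃ t, z = 1 + π ^ 3 * t) ∨ ∃ t, z = 1 + π + π ^ 2 * t := by
  rcases h.digit z with hz | ⟨y, hz⟩
  · exact Or.inl hz
  right
  rcases h.digit y with ⟨x, rfl⟩ | ⟨x, rfl⟩
  swap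
  · exact Or.inr ⟨x, by rw [hz]; ring⟩
  left
  rcases h.digit x with ⟨t, rfl⟩ | ⟨t, rfl⟩
  · exact ⟨t, by rw [hz]; ring⟩
  exfalso
  obtain ⟨f, b, e, v, -, hv⟩ := sq_eq_of_one_add h hAB (x := 1 + π * t)
    (by rwa [pow_two, mul_assoc, ← hz])
  obtain ⟨Q, _, hQ, φ, hp, h1, -⟩ := h.exists_quotient 2 two_ne_zero (by norm_num)
  have h1 := h1 1 one_lt_two
  replace hv := congrArg φ hv
  rcases h.digit v with ⟨u, rfl⟩ | ⟨u, rfl⟩ <;>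
  simp only [map_mul, map_add, map_pow, map_one] at hv <;> clear *- hQ hp h1 hv <;> grind

theorem right_digits {t : R} (hJ : JacobiQuartic A B (1 + π ^ 3 * t) w) :
    ∃ v, w = π ^ 4 * (1 + π + π ^ 2 * v) := by
  obtain ⟨f, b, e, v, rfl, hv⟩ := sq_eq_of_one_add h hAB (x := π * t)
    (by rwa [pow_two, mul_assoc, ← mul_assoc π π t, ← pow_two, ← mul_assoc, ← pow_succ'])
  have ht : π * t * (π * t + π * (1 + π ^ 6 * f)) = π ^ 2 * (t * (t + 1) + π ^ 6 * t * f) := by ring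
  obtain ⟨k, hk⟩ := h.mul_add_one t
  rw [ht, hk] at hv
  obtain ⟨Q, _, hQ, φ, hp, h1, -⟩ := h.exists_quotient 3 three_ne_zero le_rfl
  have h1 := h1 2 (by norm_num)
  replace hv := congrArg φ hv
  rcases h.digit v with ⟨u, rfl⟩ | ⟨u, rfl⟩
  · simp only [map_mul, map_add, map_pow, map_one] at hv
    clear *- hQ hp h1 hv
    grind
  rcases h.digit u with ⟨u, rfl⟩ | ⟨u, rfl⟩
  · simp only [map_mul, map_add, map_pow, map_one] at hv
    clear *- hQ hp h1 hv
    grind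
  · exact ⟨u, by ring⟩

theorem right_digits_of_mul {x : R} (hJ : JacobiQuartic A B (π * x) w) :
    ∃ m, w = 1 + π ^ 2 * m := by
  obtain ⟨f, hf⟩ := h.exists_two_eq
  obtain ⟨b, e, hb, hw⟩ := sq_eq hAB hJ
  refine h.exists_eq_one_add_of_sq (x := x ^ 4 * B - π * x ^ 2 * (1 + π ^ 6 * f) -
    π ^ 2 * x ^ 2 * (1 + π ^ 3 * b) + π ^ 6 * (1 + π ^ 2 + π ^ 4 * e) * x ^ 2) ?_
  linear_combination hw - π ^ 2 * x ^ 2 * hb - π ^ 2 * x ^ 2 * hf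

theorem right_digits_of_sq_mul {x : R} (hJ : JacobiQuartic A B (π ^ 2 * x) w) :
    ∃ m, w = 1 + π ^ 3 * m := by
  obtain ⟨f, hf⟩ := h.exists_two_eq
  obtain ⟨b, e, hb, hw⟩ := sq_eq hAB hJ
  refine h.exists_eq_one_add_of_sq' (x := π * x ^ 4 * B - x ^ 2 * (1 + π ^ 6 * f) -
    π * x ^ 2 * (1 + π ^ 3 * b) + π ^ 5 * (1 + π ^ 2 + π ^ 4 * e) * x ^ 2) ?_
  linear_combination hw - π ^ 4 * x ^ 2 * hb - π ^ 4 * x ^ 2 * hf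

theorem right_digits_of_one_add {c : R} (hJ : JacobiQuartic A B (1 + π + π ^ 2 * c) w) :
    ∃ v, w = π ^ 2 * (1 + π + π ^ 2 * v) := by
  obtain ⟨f, hf⟩ := h.exists_two_eq
  obtain ⟨b, e, hb, hw⟩ := sq_eq hAB hJ
  set z := 1 + π + π ^ 2 * c with hz
  set k := (1 + π * c) * (1 + π * c + π ^ 2 * (1 + π ^ 6 * f)) with hk
  have h1 : 1 - z ^ 2 = -π ^ 2 * k := by
    rw [hz, hk]; linear_combination -π * (1 + π * c) * hf
  have h2 : 1 - B * z ^ 2 = -π ^ 2 * (k + π ^ 2 * (1 + π ^ 3 * b) * z ^ 2) := by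
    rw [hb]; linear_combination h1
  obtain ⟨v, hwv, hv⟩ := h.exists_of_sq_eq 2 (w := w) (x := k * (k + π ^ 2 * (1 + π ^ 3 * b) *
    z ^ 2) + π ^ 4 * (1 + π ^ 2 + π ^ 4 * e) * z ^ 2) (by rw [hw, h1, h2]; ring)
  obtain ⟨Q, _, hQ, φ, hp, hp2, -⟩ := h.exists_quotient 3 three_ne_zero le_rfl
  have hp2 := hp2 2 (by norm_num)
  clear_value k
  subst hk
  clear_value z
  subst hz
  replace hv := congrArg φ hv
  rcases h.digit v with ⟨u, rfl⟩ | ⟨u, rfl⟩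
  · simp only [map_mul, map_add, map_pow, map_one] at hv
    exfalso
    clear *- hQ hp hp2 hv
    grind
  rcases h.digit u with ⟨u, rfl⟩ | ⟨u, rfl⟩
  · simp only [map_mul, map_add, map_pow, map_one] at hv
    exfalso
    clear *- hQ hp hp2 hv
    grind
  · exact ⟨u, by rw [hwv]; ring⟩

section Double

variable {L N : R}

omit hAB [IsDomain R] in
theorem double_of_mul {x m P ρ : R} (hP : π ^ 3 = P * ρ) (hw : w = 1 + P * m)
    (e : L * (1 - B * (π * x) ^ 4) = 2 * (π * x) * w * N) :
    ∃ t, L = π ^ 3 * (π * x) * (1 + P * t) * N := by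
  obtain ⟨f, hf⟩ := h.exists_two_eq
  obtain ⟨y, hy⟩ := h.exists_inv_pow 3 (-B * x ^ 4)
  refine ⟨π ^ 3 * ρ * f * (1 + P * m) * (1 + π ^ 4 * y) + m * (1 + π ^ 4 * y) + ρ * π * y, ?_⟩
  subst hw
  linear_combination (1 + π ^ 4 * y) * e - L * hy +
    (π * x) * (1 + P * m) * N * (1 + π ^ 4 * y) * hf +
    π ^ 4 * x * N * (π * y + π ^ 3 * f * (1 + P * m) * (1 + π ^ 4 * y)) * hP

theorem double_of_one_add {t : R} (hJ : JacobiQuartic A B (1 + π ^ 3 * t) w)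
    (e : L * (1 - B * (1 + π ^ 3 * t) ^ 4) = 2 * (1 + π ^ 3 * t) * w * N) :
    ∃ u, L = π ^ 3 * (1 + π + π ^ 2 * u) * N := by
  obtain ⟨f, hf⟩ := h.exists_two_eq
  obtain ⟨b, hb⟩ := hAB.exists_right_eq
  obtain ⟨v, rfl⟩ := right_digits h hAB hJ
  set k := (1 + π ^ 6 * f) * t + t ^ 2 with hk
  have h1 : 1 - B * (1 + π ^ 3 * t) ^ 4 =
      -π ^ 4 * (1 + π ^ 2 * (π * b + (2 * k + π ^ 6 * k ^ 2) * B)) := by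
    have h2 : (1 + π ^ 3 * t) ^ 2 = 1 + π ^ 6 * k := by rw [hk]; linear_combination π ^ 3 * t * hf
    linear_combination -B * ((1 + π ^ 3 * t) ^ 2 + (1 + π ^ 6 * k)) * h2 - hb
  generalize π * b + (2 * k + π ^ 6 * k ^ 2) * B = c at h1
  obtain ⟨y, hy⟩ := h.exists_inv_pow 1 c
  obtain ⟨Q, _, hQ, φ, hp, -, h2⟩ := h.exists_quotient 2 two_ne_zero (by norm_num)
  obtain ⟨u, hu⟩ := h2 (-(1 + π ^ 6 * f) * (1 + π ^ 3 * t) * (1 + π + π ^ 2 * v) *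
    (1 + π ^ 2 * y) - (1 + π)) (by
      simp only [map_mul, map_add, map_pow, map_one, map_sub, map_neg]
      clear *- hQ hp
      grind)
  refine ⟨u, mul_left_cancel₀ (pow_ne_zero 4 h.ne_zero) ?_⟩
  rw [h1] at e
  linear_combination -(1 + π ^ 2 * y) * e - L * π ^ 4 * hy + π ^ 7 * N * hu -
    π ^ 4 * (1 + π ^ 3 * t) * (1 + π + π ^ 2 * v) * (1 + π ^ 2 * y) * N * hf

theorem double_of_one_add_one_add {c : R} (hJ : JacobiQuartic A B (1 + π + π ^ 2 * c) w)
    (e : L * (1 - B * (1 + π + π ^ 2 * c) ^ 4) = 2 * (1 + π + π ^ 2 * c) * w * N) :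
    ∃ t, L = (1 + π ^ 2 * t) * N := by
  obtain ⟨f, hf⟩ := h.exists_two_eq
  obtain ⟨b, hb⟩ := hAB.exists_right_eq
  obtain ⟨v, rfl⟩ := right_digits_of_one_add h hAB hJ
  obtain ⟨Q, _, hQ, φ, hp, -, h2⟩ := h.exists_quotient 3 three_ne_zero le_rfl
  obtain ⟨m, hm⟩ : ∃ m, 1 - B * (1 + π + π ^ 2 * c) ^ 4 = -π ^ 5 * (1 + π ^ 2 * m) := by
    set z := 1 + π + π ^ 2 * c with hz
    set k := (1 + π * c) * (1 + π * c + π ^ 2 * (1 + π ^ 6 * f)) with hk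
    have h1 : 1 - z ^ 4 = -π ^ 4 * (k * (k + π * (1 + π ^ 6 * f))) := by
      have h1 : 1 - z ^ 2 = -π ^ 2 * k := by
        rw [hz, hk]; linear_combination -π * (1 + π * c) * hf
      linear_combination (1 + z ^ 2 + π ^ 2 * k) * h1 - π ^ 2 * k * hf
    clear_value k
    subst hk
    clear_value z
    subst hz
    obtain ⟨m, hm⟩ := h2 ((1 + π * c) * (1 + π * c + π ^ 2 * (1 + π ^ 6 * f)) *
      ((1 + π * c) * (1 + π * c + π ^ 2 * (1 + π ^ 6 * f)) + π * (1 + π ^ 6 * f)) +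
      (1 + π ^ 3 * b) * (1 + π + π ^ 2 * c) ^ 4 - π) (by
        simp only [map_mul, map_add, map_pow, map_one, map_sub]
        clear *- hQ hp
        grind)
    refine ⟨m, ?_⟩
    rw [hb]
    linear_combination h1 - π ^ 4 * hm
  obtain ⟨y, hy⟩ := h.exists_inv_pow 1 m
  obtain ⟨Q, _, hQ, φ, hp, -, h2⟩ := h.exists_quotient 2 two_ne_zero (by norm_num)
  obtain ⟨u, hu⟩ := h2 (-(1 + π ^ 6 * f) * (1 + π + π ^ 2 * c) * (1 + π + π ^ 2 * v) *
    (1 + π ^ 2 * y) - 1) (by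
      simp only [map_mul, map_add, map_pow, map_one, map_sub, map_neg]
      clear *- hQ hp
      grind)
  refine ⟨u, mul_left_cancel₀ (pow_ne_zero 5 h.ne_zero) ?_⟩
  rw [hm] at e
  linear_combination -(1 + π ^ 2 * y) * e - L * π ^ 5 * hy + π ^ 5 * N * hu -
    π ^ 2 * (1 + π + π ^ 2 * c) * (1 + π + π ^ 2 * v) * (1 + π ^ 2 * y) * N * hf

theorem double_cases (hJ : JacobiQuartic A B z w) (e : L * (1 - B * z ^ 4) = 2 * z * w * N) :
    (∃ x t, z = π * x ∧ L = π ^ 3 * z * (1 + π ^ 2 * t) * N ∧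
      (π ∣ x → ∃ t, L = π ^ 3 * z * (1 + π ^ 3 * t) * N)) ∨
    (∃ t, L = π ^ 3 * (1 + π + π ^ 2 * t) * N) ∨
    ∃ c t, z = 1 + π + π ^ 2 * c ∧ L = (1 + π ^ 2 * t) * N := by
  obtain ⟨x, rfl⟩ | ⟨t, rfl⟩ | ⟨c, rfl⟩ := type_cases h hAB hJ
  · left
    obtain ⟨m, hm⟩ := right_digits_of_mul h hAB hJ
    obtain ⟨t, ht⟩ := double_of_mul h (ρ := π) (by ring) hm e
    refine ⟨x, t, rfl, ht, ?_⟩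
    rintro ⟨y, rfl⟩
    obtain ⟨m, hm⟩ := right_digits_of_sq_mul h hAB (x := y) (by rwa [pow_two, mul_assoc])
    exact double_of_mul h (ρ := 1) (by ring) hm e
  · exact Or.inr (Or.inl (double_of_one_add h hAB hJ e))
  · obtain ⟨t, ht⟩ := double_of_one_add_one_add h hAB hJ e
    exact Or.inr (Or.inr ⟨c, t, rfl, ht⟩)

end Double

end JacobiQuartic

/-! ### Leading digits of the points that reduce to the neutral element -/

namespace IsCubicUniformizer

variable {R : Type u} [CommRing R] [IsDomain R] {π : R} (h : IsCubicUniformizer π)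

include h

theorem pow_mul_inj {m n : ℕ} {x y : R} (hxy : π ^ m * (1 + π * x) = π ^ n * (1 + π * y)) :
    m = n ∧ 1 + π * x = 1 + π * y := by
  have key {m d : ℕ} {x y : R} (hxy : π ^ m * (1 + π * x) = π ^ (m + d) * (1 + π * y)) : d = 0 := by
    rw [pow_add, mul_assoc] at hxy
    have h1 := mul_left_cancel₀ (pow_ne_zero m h.ne_zero) hxy
    rcases d with _ | d
    · rfl
    · exact absurd (by linear_combination -h1) (h.ne_one (π ^ d * (1 + π * y) - x))
  have hmn : m = n := by
    rcases le_total m n with hmn | hmn <;> obtain ⟨d, rfl⟩ := Nat.exists_eq_add_of_le hmn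
    · rw [key hxy, add_zero]
    · rw [key hxy.symm, add_zero]
  subst hmn
  exact ⟨rfl, mul_left_cancel₀ (pow_ne_zero m h.ne_zero) hxy⟩

theorem exists_not_pow_dvd {x : R} (hx : x ≠ 0) : ∃ n, ¬ π ^ n ∣ x := by
  obtain ⟨n, u, rfl⟩ := h.exists_eq_pow_mul x hx
  refine ⟨n + 1, fun ⟨v, hv⟩ ↦ h.ne_one (v - u) ?_⟩
  apply mul_left_cancel₀ (pow_ne_zero n h.ne_zero)
  linear_combination -hv

omit [IsDomain R] in
theorem exists_eq_one_add_pow_three {s : R} (hs : s = 1 ∨ s = -1) : ∃ t, s = 1 + π ^ 3 * t := by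
  obtain ⟨f, hf⟩ := h.exists_two_eq
  rcases hs with rfl | rfl
  · exact ⟨0, by ring⟩
  · exact ⟨-(1 + π ^ 6 * f), by linear_combination -hf⟩

end IsCubicUniformizer

namespace JacobiQuartic

variable {R : Type u} [CommRing R]

/-- Up to sign, every point of the quartic is a point satisfying `E` plus the double of a point. -/
def HasDescent (A B : R) (E : R → R → Prop) : Prop :=
  ∀ z w, JacobiQuartic A B z w → ∃ s zε wε z₁ w₁, (s = 1 ∨ s = -1) ∧ E zε wε ∧
    JacobiQuartic A B z₁ w₁ ∧
    s * (z * wε - zε * w) * (1 - B * z₁ ^ 4) = 2 * z₁ * w₁ * (1 - B * z ^ 2 * zε ^ 2)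

variable [IsDomain R] {π A B z w : R} (h : IsCubicUniformizer π) (hAB : IsSplitMod π A B)

include h hAB

/-- There are no points outside the valuation ring: in coordinates `x = 1 / z` the quartic has no
points with `x` divisible by `π`. -/
theorem sq_ne_of_mul (x W : R) : W ^ 2 ≠ B + A * (π * x) ^ 2 + (π * x) ^ 4 := by
  intro hW
  obtain ⟨f, hf⟩ := h.exists_two_eq
  obtain ⟨b, hb⟩ := hAB.exists_right_eq
  obtain ⟨e, he⟩ := hAB.exists_sum_eq
  obtain ⟨a, ha⟩ : ∃ a, A = -π ^ 3 * (1 + π * a) := by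
    refine ⟨π ^ 5 * f + (1 + π ^ 3 * b) - π ^ 4 * (1 + π ^ 2 + π ^ 4 * e), ?_⟩
    linear_combination he - hb - hf
  obtain ⟨n, rfl⟩ := h.exists_eq_one_add_of_sq
    (x := 1 + π ^ 3 * b - π * x ^ 2 * (1 + π * a) + x ^ 4) (by rw [hW, hb, ha]; ring)
  have h1 : n ^ 2 + π * (1 + π ^ 6 * f) * n =
      1 + π ^ 3 * b - π * x ^ 2 * (1 + π * a) + x ^ 4 := by
    apply mul_left_cancel₀ (pow_ne_zero 4 h.ne_zero)
    linear_combination hW + hb + π ^ 2 * x ^ 2 * ha - π ^ 2 * n * hf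
  obtain ⟨Q, _, hQ, φ, hp, hp1, -⟩ := h.exists_quotient 2 two_ne_zero (by norm_num)
  have hp1 := hp1 1 one_lt_two
  replace h1 := congrArg φ h1
  rcases h.digit n with ⟨m, rfl⟩ | ⟨m, rfl⟩ <;> rcases h.digit x with ⟨y, rfl⟩ | ⟨y, rfl⟩ <;>
  simp only [map_mul, map_add, map_sub, map_pow, map_one] at h1 <;> clear *- hQ hp hp1 h1 <;> grind

section DescentOne

variable (hd : HasDescent A B fun zε wε ↦ (zε = 0 ∧ wε = 1) ∨
  (∃ c d, zε = 1 + π + π ^ 2 * c ∧ wε = π * d) ∨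
  ∃ p q, zε = π ^ 2 * (1 + π + π ^ 3 * p) ∧ wε = 1 + π ^ 3 * q)

include hd

theorem dvd_of_mul {x : R} (hJ : JacobiQuartic A B (π * x) w) : ∃ y, x = π * y := by
  obtain ⟨m, rfl⟩ := right_digits_of_mul h hAB hJ
  obtain ⟨s, zε, wε, z₁, w₁, hs, hε, hJ₁, e⟩ := hd _ _ hJ
  obtain ⟨Q, _, hQ, φ, hp, hp1, hφ⟩ := h.exists_quotient 2 two_ne_zero (by norm_num)
  replace hp1 := hp1 1 one_lt_two
  suffices hx : φ (π * x) = 0 by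
    obtain ⟨y, hy⟩ := hφ _ hx
    exact ⟨y, mul_left_cancel₀ h.ne_zero (by rw [hy]; ring)⟩
  replace hs : φ s = 1 := by
    rcases hs with rfl | rfl
    · exact map_one φ
    · rw [map_neg, map_one]
      exact CharTwo.neg_eq 1
  have hL : φ (s * (π * x * wε - zε * (1 + π ^ 2 * m))) = 0 ∨
      φ (s * (π * x * wε - zε * (1 + π ^ 2 * m))) = φ (1 - B * (π * x) ^ 2 * zε ^ 2) := by
    rcases double_cases h hAB hJ₁ e with ⟨-, t, -, hL, -⟩ | ⟨t, hL⟩ | ⟨-, t, -, hL⟩ <;> rw [hL] <;>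
    simp only [map_mul, map_add, map_sub, map_pow, map_one] <;> clear *- hQ hp
    · left; grind
    · left; grind
    · right; grind
  clear e hJ₁ hJ
  rcases hε with ⟨rfl, rfl⟩ | ⟨c, d, rfl, rfl⟩ | ⟨p, q, rfl, rfl⟩ <;>
  simp only [map_mul, map_add, map_sub, map_pow, map_one, map_zero] at hL ⊢ <;>
  clear *- hQ hp hs hp1 hL <;> grind

theorem exists_digits_of_mul {x : R} (hx : π * x ≠ 0) (hJ : JacobiQuartic A B (π * x) w) :
    (∃ k t, π * x = π ^ (3 * k + 3) * (1 + π + π ^ 2 * t)) ∨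
    (∃ k t, π * x = π ^ (3 * k + 2) * (1 + π + π ^ 3 * t)) ∨
    ∃ k t, π * x = π ^ (3 * k + 2) * (1 + π ^ 2 + π ^ 3 * t) := by
  obtain ⟨n, hn⟩ := h.exists_not_pow_dvd hx
  induction n generalizing x w with
  | zero => simp at hn
  | succ n ih =>
    obtain ⟨x, rfl⟩ := dvd_of_mul h hAB hd hJ
    rw [← mul_assoc, ← pow_two] at hJ hx hn ⊢
    obtain ⟨m, rfl⟩ := right_digits_of_sq_mul h hAB hJ
    obtain ⟨s, zε, wε, z₁, w₁, hs, hε, hJ₁, e⟩ := hd _ _ hJ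
    obtain ⟨σ, hσ⟩ := h.exists_eq_one_add_pow_three hs
    have hs2 : s ^ 2 = 1 := by rcases hs with rfl | rfl <;> norm_num
    rcases hε with ⟨rfl, rfl⟩ | ⟨c, d, rfl, rfl⟩ | ⟨p, q, rfl, rfl⟩
    · rcases double_cases h hAB hJ₁ e with ⟨x₁, -, rfl, -, hL⟩ | ⟨t, hL⟩ | ⟨-, t, -, hL⟩
      · obtain ⟨y, rfl⟩ := dvd_of_mul h hAB hd hJ₁
        obtain ⟨t, hL⟩ := hL (dvd_mul_right π y)
        have hz : π ^ 2 * x = π * (π * y) * (π ^ 3 * (1 + π ^ 3 * (t + σ * (1 + π ^ 3 * t)))) := by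
          linear_combination s * hL - π ^ 2 * x * hs2 +
            π ^ 3 * (π * (π * y)) * (1 + π ^ 3 * t) * hσ
        rw [hz] at hn ⊢
        rcases ih (left_ne_zero_of_mul (hz ▸ hx)) hJ₁ (fun hd ↦ hn (by
            rw [pow_succ]
            exact mul_dvd_mul hd ((dvd_pow_self π three_ne_zero).mul_right _))) with
          ⟨k, t', ht⟩ | ⟨k, t', ht⟩ | ⟨k, t', ht⟩
        · exact Or.inl ⟨k + 1, t' + π * (t + σ * (1 + π ^ 3 * t)) * (1 + π + π ^ 2 * t'), by
            rw [ht]; ring⟩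
        · exact Or.inr (Or.inl ⟨k + 1, t' + (t + σ * (1 + π ^ 3 * t)) * (1 + π + π ^ 3 * t'), by
            rw [ht]; ring⟩)
        · exact Or.inr (Or.inr ⟨k + 1, t' + (t + σ * (1 + π ^ 3 * t)) *
            (1 + π ^ 2 + π ^ 3 * t'), by rw [ht]; ring⟩)
      · refine Or.inl ⟨0, t + π * σ * (1 + π + π ^ 2 * t), ?_⟩
        linear_combination s * hL - π ^ 2 * x * hs2 + π ^ 3 * (1 + π + π ^ 2 * t) * hσ
      · exact absurd (by linear_combination hL) (h.ne_one (π * (s * x - t)))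
    · obtain ⟨Q, _, hQ, φ, hp, hp1, -⟩ := h.exists_quotient 2 two_ne_zero (by norm_num)
      replace hp1 := hp1 1 one_lt_two
      exfalso
      rcases double_cases h hAB hJ₁ e with ⟨-, t, -, hL, -⟩ | ⟨t, hL⟩ | ⟨-, t, -, hL⟩ <;>
      replace hL := congrArg φ hL <;>
      simp only [map_mul, map_add, map_sub, map_pow, map_one, hσ] at hL <;>
      clear *- hQ hp hp1 hL <;> grind
    · obtain ⟨Q, _, hQ, φ, hp, hp1, hφ⟩ := h.exists_quotient 3 three_ne_zero le_rfl
      rcases double_cases h hAB hJ₁ e with ⟨x₁, t, rfl, hL, -⟩ | ⟨t, hL⟩ | ⟨-, t, -, hL⟩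
      · obtain ⟨y, rfl⟩ := dvd_of_mul h hAB hd hJ₁
        have hL' : s * (x * (1 + π ^ 3 * q) - (1 + π + π ^ 3 * p) * (1 + π ^ 3 * m)) =
            π ^ 3 * (y * (1 + π ^ 2 * t) *
              (1 - B * (π ^ 2 * x) ^ 2 * (π ^ 2 * (1 + π + π ^ 3 * p)) ^ 2)) := by
          apply mul_left_cancel₀ (pow_ne_zero 2 h.ne_zero)
          linear_combination hL
        obtain ⟨v, hv⟩ := hφ (x - (1 + π)) (by
          replace hL := congrArg φ hL'
          simp only [map_mul, map_add, map_sub, map_pow, map_one, hσ] at hL ⊢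
          clear *- hQ hp hL
          grind)
        exact Or.inr (Or.inl ⟨0, v, by linear_combination π ^ 2 * hv⟩)
      · have hL' : s * (x * (1 + π ^ 3 * q) - (1 + π + π ^ 3 * p) * (1 + π ^ 3 * m)) =
            π * (1 + π + π ^ 2 * t) *
              (1 - B * (π ^ 2 * x) ^ 2 * (π ^ 2 * (1 + π + π ^ 3 * p)) ^ 2) := by
          apply mul_left_cancel₀ (pow_ne_zero 2 h.ne_zero)
          linear_combination hL
        obtain ⟨v, hv⟩ := hφ (x - (1 + π ^ 2)) (by
          replace hL := congrArg φ hL'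
          simp only [map_mul, map_add, map_sub, map_pow, map_one, hσ] at hL ⊢
          clear *- hQ hp hL
          grind)
        exact Or.inr (Or.inr ⟨0, v, by linear_combination π ^ 2 * hv⟩)
      · replace hp1 := hp1 2 (by norm_num)
        replace hL := congrArg φ hL
        exfalso
        simp only [map_mul, map_add, map_sub, map_pow, map_one, hσ] at hL
        clear *- hQ hp hp1 hL
        grind

end DescentOne

end JacobiQuartic

namespace JacobiQuartic

variable {R : Type u} [CommRing R] [IsDomain R] {π A B z w : R} (h : IsCubicUniformizer π)
  (hAB : IsSplitMod π A B)

section DescentTwo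

variable (hd : HasDescent A B fun zε wε ↦ (zε = 0 ∧ wε = 1) ∨
  (∃ c, zε = 1 + π ^ 3 * c) ∧ JacobiQuartic A B zε wε)

include h hAB hd

theorem not_one_add_one_add (c w : R) : ¬ JacobiQuartic A B (1 + π + π ^ 2 * c) w := by
  intro hJ
  obtain ⟨s, zε, wε, z₁, w₁, hs, hε, hJ₁, e⟩ := hd _ _ hJ
  obtain ⟨σ, hσ⟩ := h.exists_eq_one_add_pow_three hs
  obtain ⟨f, hf⟩ := h.exists_two_eq
  obtain ⟨b, hb⟩ := hAB.exists_right_eq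
  obtain ⟨v, rfl⟩ := right_digits_of_one_add h hAB hJ
  obtain ⟨Q, _, hQ, φ, hp, hp1, -⟩ := h.exists_quotient 2 two_ne_zero (by norm_num)
  replace hp1 := hp1 1 one_lt_two
  rcases hε with ⟨rfl, rfl⟩ | ⟨⟨d, rfl⟩, hε⟩
  · rcases double_cases h hAB hJ₁ e with ⟨-, t, -, hL, -⟩ | ⟨t, hL⟩ | ⟨-, t, -, hL⟩ <;>
    replace hL := congrArg φ hL <;>
    simp only [map_mul, map_add, map_sub, map_pow, map_one, map_zero, hσ] at hL <;>
    clear *- hQ hp hp1 hL <;> grind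
  · obtain ⟨v', rfl⟩ := right_digits h hAB hε
    set ν := (1 + π * c) * (1 + π * c + π ^ 2 * (1 + π ^ 6 * f)) +
      π ^ 2 * (1 + π + π ^ 2 * c) ^ 2 * (1 + π ^ 3 * b) +
      π ^ 4 * B * (1 + π + π ^ 2 * c) ^ 2 * ((1 + π ^ 6 * f) * d + d ^ 2) with hν
    have hN : 1 - B * (1 + π + π ^ 2 * c) ^ 2 * (1 + π ^ 3 * d) ^ 2 = π ^ 2 * -ν := by
      rw [hν]
      linear_combination -(1 + π + π ^ 2 * c) ^ 2 * hb - (π * (1 + π * c) + π ^ 3 * d * B *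
        (1 + π + π ^ 2 * c) ^ 2) * hf
    have hφ : φ ν = 1 := by
      rw [hν]
      simp only [map_mul, map_add, map_pow, map_one]
      clear *- hQ hp
      grind
    clear_value ν
    rw [hN] at e
    have cancel {y : R} (hL : s * ((1 + π + π ^ 2 * c) * (π ^ 4 * (1 + π + π ^ 2 * v')) -
        (1 + π ^ 3 * d) * (π ^ 2 * (1 + π + π ^ 2 * v))) = y * (π ^ 2 * -ν)) :
        φ (s * ((1 + π + π ^ 2 * c) * (π ^ 2 * (1 + π + π ^ 2 * v')) -
          (1 + π ^ 3 * d) * (1 + π + π ^ 2 * v))) = φ (y * -ν) := by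
      congr 1
      apply mul_left_cancel₀ (pow_ne_zero 2 h.ne_zero)
      linear_combination hL
    rcases double_cases h hAB hJ₁ e with ⟨-, t, -, hL, -⟩ | ⟨t, hL⟩ | ⟨-, t, -, hL⟩ <;>
    replace hL := cancel hL <;>
    simp only [map_mul, map_add, map_sub, map_pow, map_one, map_neg, hσ] at hL <;>
    clear *- hQ hp hp1 hφ hL <;> grind

theorem exists_digits_of_mul' {x : R} (hx : π * x ≠ 0) (hJ : JacobiQuartic A B (π * x) w) :
    ∃ k t, π * x = π ^ (3 * k + 3) * (1 + π + π ^ 2 * t) := by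
  obtain ⟨n, hn⟩ := h.exists_not_pow_dvd hx
  induction n generalizing x w with
  | zero => simp at hn
  | succ n ih =>
    obtain ⟨m, rfl⟩ := right_digits_of_mul h hAB hJ
    obtain ⟨s, zε, wε, z₁, w₁, hs, hε, hJ₁, e⟩ := hd _ _ hJ
    obtain ⟨σ, hσ⟩ := h.exists_eq_one_add_pow_three hs
    have hs2 : s ^ 2 = 1 := by rcases hs with rfl | rfl <;> norm_num
    rcases hε with ⟨rfl, rfl⟩ | ⟨⟨d, rfl⟩, hε⟩
    · rcases double_cases h hAB hJ₁ e with ⟨y, t, rfl, hL, -⟩ | ⟨t, hL⟩ | ⟨c, t, rfl, hL⟩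
      · have hz : π * x = π * y * (π ^ 3 * (1 + π ^ 2 * (t + π * σ * (1 + π ^ 2 * t)))) := by
          linear_combination s * hL - π * x * hs2 + π ^ 3 * (π * y) * (1 + π ^ 2 * t) * hσ
        rw [hz] at hn ⊢
        obtain ⟨k, t', ht⟩ := ih (left_ne_zero_of_mul (hz ▸ hx)) hJ₁ (fun hd ↦ hn (by
          rw [pow_succ]
          exact mul_dvd_mul hd ((dvd_pow_self π three_ne_zero).mul_right _)))
        exact ⟨k + 1, t' + (t + π * σ * (1 + π ^ 2 * t)) * (1 + π + π ^ 2 * t'), by rw [ht]; ring⟩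
      · refine ⟨0, t + π * σ * (1 + π + π ^ 2 * t), ?_⟩
        linear_combination s * hL - π * x * hs2 + π ^ 3 * (1 + π + π ^ 2 * t) * hσ
      · exact (not_one_add_one_add h hAB hd c w₁ hJ₁).elim
    · obtain ⟨Q, _, hQ, φ, hp, hp1, -⟩ := h.exists_quotient 1 one_ne_zero (by norm_num)
      obtain ⟨v', rfl⟩ := right_digits h hAB hε
      rcases double_cases h hAB hJ₁ e with ⟨y, t, rfl, hL, -⟩ | ⟨t, hL⟩ | ⟨c, t, rfl, hL⟩
      · replace hL := congrArg φ hL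
        simp only [map_mul, map_add, map_sub, map_pow, map_one, hσ] at hL
        exfalso
        clear *- hQ hp hL
        grind
      · replace hL := congrArg φ hL
        simp only [map_mul, map_add, map_sub, map_pow, map_one, hσ] at hL
        exfalso
        clear *- hQ hp hL
        grind
      · exact (not_one_add_one_add h hAB hd c w₁ hJ₁).elim

end DescentTwo

end JacobiQuartic

namespace JacobiQuartic

theorem neg_right {F : Type*} [CommRing F] {A B z w : F} (h : JacobiQuartic A B z w) :
    JacobiQuartic A B z (-w) := by
  rw [JacobiQuartic, neg_sq]
  exact h

variable {R : Type u} [CommRing R] [IsDomain R] {π A B z w z₀ w₀ z₃ : R}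
  (h : IsCubicUniformizer π) (hAB : IsSplitMod π A B)

omit [IsDomain R] in
theorem mul_add_eq {v v₀ : R} (hJ : JacobiQuartic A B z (π ^ 4 * v))
    (hJ₀ : JacobiQuartic A B z₀ (π ^ 4 * v₀)) :
    π ^ 8 * ((z * v₀ + z₀ * v) * (z * v₀ - z₀ * v)) =
      (z ^ 2 - z₀ ^ 2) * (1 - B * z ^ 2 * z₀ ^ 2) := by
  unfold JacobiQuartic at hJ hJ₀
  linear_combination z ^ 2 * hJ₀ - z₀ ^ 2 * hJ

include h in
omit [IsDomain R] in
theorem pow_seven_dvd_sq_sub_one (t : R) : ∃ k, (1 + π ^ 3 * t) ^ 2 = 1 + π ^ 7 * k := by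
  obtain ⟨f, hf⟩ := h.exists_two_eq
  obtain ⟨k, hk⟩ := h.mul_add_one t
  exact ⟨k + π ^ 5 * t * f, by linear_combination π ^ 3 * t * hf + π ^ 6 * hk⟩

include h hAB

omit [IsDomain R] in
theorem exists_one_sub_mul_eq (t t₀ : R) :
    ∃ d, 1 - B * (1 + π ^ 3 * t) ^ 2 * (1 + π ^ 3 * t₀) ^ 2 = π ^ 4 * (1 + π * d) := by
  obtain ⟨f, hf⟩ := h.exists_two_eq
  obtain ⟨b, hb⟩ := hAB.exists_right_eq
  obtain ⟨k, hk⟩ := pow_seven_dvd_sq_sub_one h t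
  obtain ⟨k₀, hk₀⟩ := pow_seven_dvd_sq_sub_one h t₀
  refine ⟨-π ^ 2 * (1 + π ^ 6 * f) - π ^ 2 * b - π ^ 2 * B * (k + k₀ * (1 + π ^ 7 * k)), ?_⟩
  rw [hk, hk₀]
  linear_combination -hb - π ^ 4 * hf

omit [IsDomain R] h hAB in
/-- The sum of two elements of orders `m` and `n` having order three forces `m = 3` or `n = 3`. -/
theorem _root_.IsCubicUniformizer.add_eq_pow_three [IsDomain R] (h : IsCubicUniformizer π)
    {m n : ℕ} {x y η : R} (hmn : 5 ≤ m + n)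
    (e : π ^ m * (1 + π * x) + π ^ n * (1 + π * y) = π ^ 3 * (1 + π * η)) :
    (m = 3 ∧ 3 < n) ∨ (n = 3 ∧ 3 < m) := by
  obtain ⟨f, hf⟩ := h.exists_two_eq
  have key {m d : ℕ} {x y : R} (e : π ^ m * (1 + π * x) + π ^ (m + (d + 1)) * (1 + π * y) =
      π ^ 3 * (1 + π * η)) : m = 3 :=
    (h.pow_mul_inj (x := x + π ^ d * (1 + π * y)) (Eq.trans (by ring) e)).1
  rcases lt_trichotomy m n with hlt | rfl | hlt
  · obtain ⟨d, rfl⟩ := Nat.exists_eq_add_of_lt hlt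
    have := key e
    omega
  · obtain ⟨d, rfl⟩ : ∃ d, m = 3 + d := Nat.exists_eq_add_of_le (by omega)
    exfalso
    refine h.ne_one (π ^ d * (π ^ 2 * (1 + π ^ 6 * f) + x + y) - η) ?_
    apply mul_left_cancel₀ (pow_ne_zero 3 h.ne_zero)
    linear_combination e - π ^ (3 + d) * hf
  · obtain ⟨d, rfl⟩ := Nat.exists_eq_add_of_lt hlt
    rw [add_comm] at e
    have := key e
    omega

/-- The difference of two points close to the diagonal, up to the sign of one of them. -/
theorem exists_sub_digits
    (hsub : ∀ z₁ w₁ z₂ w₂, JacobiQuartic A B z₁ w₁ → JacobiQuartic A B z₂ w₂ →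
      ∃ z₃ w₃, JacobiQuartic A B z₃ w₃ ∧ z₃ * (1 - B * z₁ ^ 2 * z₂ ^ 2) = z₁ * w₂ - z₂ * w₁)
    {t t₀ v₀ ω : R} {κ : ℕ} (hz : z = 1 + π ^ 3 * t) (hz₀ : z₀ = 1 + π ^ 3 * t₀)
    (hJ : JacobiQuartic A B z w) (hJ₀ : JacobiQuartic A B z₀ (π ^ 4 * v₀))
    (hκ : z ^ 2 - z₀ ^ 2 = π ^ (3 * κ) * (1 + π * ω)) :
    ∃ k z₃ w₃ p, κ = k + 4 ∧ JacobiQuartic A B z₃ w₃ ∧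
      z₃ * (1 + π * p) = π ^ (3 * k + 5) * (1 + π * ω) ∧
      (k ≠ 0 → ∃ m, 1 + π * p = v₀ + π ^ 3 * m) := by
  obtain ⟨f, hf⟩ := h.exists_two_eq
  obtain ⟨d, hd⟩ := exists_one_sub_mul_eq h hAB t t₀
  rw [← hz, ← hz₀] at hd
  have hd0 : 1 - B * z ^ 2 * z₀ ^ 2 ≠ 0 := by
    rw [hd]
    refine mul_ne_zero (pow_ne_zero 4 h.ne_zero) fun h0 ↦ h.ne_one (-d) ?_
    linear_combination -h0
  have hsq0 : z ^ 2 - z₀ ^ 2 ≠ 0 := by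
    rw [hκ]
    refine mul_ne_zero (pow_ne_zero _ h.ne_zero) fun h0 ↦ h.ne_one (-ω) ?_
    linear_combination -h0
  have hκ3 : 3 ≤ κ := by
    obtain ⟨k, hk⟩ := pow_seven_dvd_sq_sub_one h t
    obtain ⟨k₀, hk₀⟩ := pow_seven_dvd_sq_sub_one h t₀
    by_contra! hlt
    obtain ⟨j, hj⟩ := Nat.exists_eq_add_of_lt (show 3 * κ < 7 by omega)
    refine h.ne_one (π ^ j * (k - k₀) - ω) ?_
    apply mul_left_cancel₀ (pow_ne_zero (3 * κ) h.ne_zero)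
    rw [hz, hz₀, hk, hk₀, hj] at hκ
    linear_combination hκ
  -- the case distinguished by the sign of `w`
  have key {v p' q' : R} {n : ℕ} (hJ : JacobiQuartic A B z (π ^ 4 * v)) (hn : 3 < n)
      (hp : z * v₀ + z₀ * v = π ^ 3 * (1 + π * p')) (hq : z * v₀ - z₀ * v = π ^ n * (1 + π * q'))
      (hnκ : n + 7 = 3 * κ) :
      ∃ k z₃ w₃ p, κ = k + 4 ∧ JacobiQuartic A B z₃ w₃ ∧
      z₃ * (1 + π * p) = π ^ (3 * k + 5) * (1 + π * ω) ∧
      (k ≠ 0 → ∃ m, 1 + π * p = v₀ + π ^ 3 * m) := by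
    obtain ⟨z₃, w₃, hJ₃, e⟩ := hsub _ _ _ _ hJ hJ₀
    obtain ⟨k, rfl⟩ : ∃ k, κ = k + 4 := Nat.exists_eq_add_of_le' (by omega)
    obtain rfl : n = 3 * k + 5 := by omega
    refine ⟨k, z₃, w₃, p', rfl, hJ₃, ?_, fun hk ↦ ?_⟩
    · apply mul_left_cancel₀ (pow_ne_zero 7 h.ne_zero)
      apply mul_right_cancel₀ hd0
      have h1 := mul_add_eq hJ hJ₀
      rw [hp, hκ] at h1
      linear_combination π ^ 7 * (1 + π * p') * e + h1
    · obtain ⟨j, rfl⟩ := Nat.exists_eq_succ_of_ne_zero hk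
      refine ⟨π ^ 3 * f * z * v₀ + t * v₀ - π ^ (3 * j + 2) * (1 + π * q'), ?_⟩
      apply mul_left_cancel₀ (pow_ne_zero 3 h.ne_zero)
      rw [Nat.succ_eq_add_one] at hq
      linear_combination -hp - hq + z * v₀ * hf + π ^ 3 * v₀ * hz
  obtain ⟨v, rfl⟩ : ∃ v, w = π ^ 4 * v := by
    subst hz
    obtain ⟨v, hv⟩ := right_digits h hAB hJ
    exact ⟨_, hv⟩
  have hpq := mul_add_eq hJ hJ₀
  rw [hd, hκ] at hpq
  have hr : (1 + π * ω) * (π ^ 4 * (1 + π * d)) = π ^ 4 * (1 + π * (ω + d + π * ω * d)) := by ring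
  rw [mul_assoc, hr] at hpq
  have hpq0 : (z * v₀ + z₀ * v) * (z * v₀ - z₀ * v) ≠ 0 := by
    intro h0
    rw [h0, mul_zero, ← hr, ← mul_assoc, ← hκ, ← hd] at hpq
    exact mul_ne_zero hsq0 hd0 hpq.symm
  obtain ⟨m, p', hp⟩ := h.exists_eq_pow_mul _ (left_ne_zero_of_mul hpq0)
  obtain ⟨n, q', hq⟩ := h.exists_eq_pow_mul _ (right_ne_zero_of_mul hpq0)
  have hmn : m + n + 4 = 3 * κ := by
    rw [hp, hq] at hpq
    have := (h.pow_mul_inj (m := m + n + 8) (n := 3 * κ + 4) (x := p' + q' + π * p' * q')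
      (y := ω + d + π * ω * d) (by linear_combination hpq)).1
    omega
  obtain ⟨η, hη⟩ : ∃ η, π ^ m * (1 + π * p') + π ^ n * (1 + π * q') = π ^ 3 * (1 + π * η) := by
    obtain ⟨v₁, hv₁⟩ : ∃ v₁, v₀ = 1 + π * v₁ := by
      subst hz₀
      obtain ⟨v₁, hv₁⟩ := right_digits h hAB hJ₀
      exact ⟨1 + π * v₁, (mul_left_cancel₀ (pow_ne_zero 4 h.ne_zero) hv₁).trans (by ring)⟩
    refine ⟨v₁ + (π ^ 5 * f * z + π ^ 2 * t) * v₀, ?_⟩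
    linear_combination -hp - hq + z * v₀ * hf + π ^ 3 * v₀ * hz + π ^ 3 * hv₁
  rcases h.add_eq_pow_three (by omega) hη with ⟨rfl, hn⟩ | ⟨rfl, hm⟩
  · exact key hJ hn hp hq (by omega)
  · refine key (v := -v) (p' := q') (q' := p') (n := m) (by rw [mul_neg]; exact hJ.neg_right) hm ?_ ?_ (by omega)
    · rw [← hq]; ring
    · rw [← hp]; ring

section Subring

variable {S : Subring R} (hS : ∀ r ∈ S, r ≠ 0 → ∃ κ ω, r = π ^ (3 * κ) * (1 + π ^ 3 * ω))
  (hsub : ∀ z₁ w₁ z₂ w₂, JacobiQuartic A B z₁ w₁ → JacobiQuartic A B z₂ w₂ →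
    ∃ z₃ w₃, JacobiQuartic A B z₃ w₃ ∧ z₃ * (1 - B * z₁ ^ 2 * z₂ ^ 2) = z₁ * w₂ - z₂ * w₁)

include hS

theorem type_cases_of_mem (hzS : z ∈ S) (hz0 : z ≠ 0) (hJ : JacobiQuartic A B z w) :
    (∃ x κ ω, z = π * x ∧ z = π ^ (3 * κ) * (1 + π * (π ^ 2 * ω))) ∨ ∃ t, z = 1 + π ^ 3 * t := by
  obtain ⟨κ, ω, hω⟩ := hS z hzS hz0
  rcases type_cases h hAB hJ with ⟨x, hx⟩ | ht | ⟨c, hc⟩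
  · exact Or.inl ⟨x, κ, ω, hx, by rw [hω]; ring⟩
  · exact Or.inr ht
  · have h1 := (h.pow_mul_inj (m := 0) (n := 3 * κ) (x := 1 + π * c) (y := π ^ 2 * ω) (by
      linear_combination hω - hc)).2
    refine absurd (mul_left_cancel₀ h.ne_zero ?_) (h.ne_one (π * ω - c))
    linear_combination -h1

include hsub

theorem exists_sub_digits_of_mem {t t₀ v₀ : R} (hzS : z ∈ S) (hz₀S : z₀ ∈ S)
    (hz : z = 1 + π ^ 3 * t) (hz₀ : z₀ = 1 + π ^ 3 * t₀) (hJ : JacobiQuartic A B z w)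
    (hJ₀ : JacobiQuartic A B z₀ (π ^ 4 * v₀)) (hne : z ^ 2 ≠ z₀ ^ 2) :
    ∃ k ω x w₃ p, z ^ 2 - z₀ ^ 2 = π ^ (3 * (k + 4)) * (1 + π ^ 3 * ω) ∧
      π * x ≠ 0 ∧ JacobiQuartic A B (π * x) w₃ ∧
      π * x * (1 + π * p) = π ^ (3 * k + 5) * (1 + π * (π ^ 2 * ω)) ∧
      (k ≠ 0 → ∃ m, 1 + π * p = v₀ + π ^ 3 * m) := by
  obtain ⟨κ, ω, hω⟩ := hS (z ^ 2 - z₀ ^ 2) (S.sub_mem (S.pow_mem hzS 2) (S.pow_mem hz₀S 2))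
    (sub_ne_zero.2 hne)
  obtain ⟨k, z₃, w₃, p, rfl, hJ₃, e, hk⟩ := exists_sub_digits h hAB hsub hz hz₀ hJ hJ₀
    (ω := π ^ 2 * ω) (by rw [hω]; ring)
  obtain ⟨y, hy⟩ := h.exists_inv p
  obtain rfl : z₃ = π * (π ^ (3 * k + 4) * (1 + π * (π ^ 2 * ω)) * (1 + π * y)) := by
    linear_combination (1 + π * y) * e - z₃ * hy
  refine ⟨k, ω, _, w₃, p, hω, fun h0 ↦ ?_, hJ₃, e, hk⟩
  rw [h0, zero_mul, zero_eq_mul, or_iff_right (pow_ne_zero _ h.ne_zero)] at e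
  exact h.ne_one (-(π ^ 2 * ω)) (by linear_combination -e)

theorem sq_eq_sq_of_hasDescent
    (hd : HasDescent A B fun zε wε ↦ (zε = 0 ∧ wε = 1) ∨
      (∃ c, zε = 1 + π ^ 3 * c) ∧ JacobiQuartic A B zε wε)
    {t₀ : R} (hzS : z ∈ S) (hz₀S : z₀ ∈ S) (hz0 : z ≠ 0) (hz₀ : z₀ = 1 + π ^ 3 * t₀)
    (hJ : JacobiQuartic A B z w) (hJ₀ : JacobiQuartic A B z₀ w₀) : z ^ 2 = z₀ ^ 2 := by
  rcases type_cases_of_mem h hAB hS hzS hz0 hJ with ⟨x, κ, ω, rfl, hκ⟩ | ⟨t, ht⟩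
  · exfalso
    obtain ⟨k, t, hk⟩ := exists_digits_of_mul' h hAB hd hz0 hJ
    have h1 := (h.pow_mul_inj (m := 3 * k + 3) (n := 3 * κ) (x := 1 + π * t) (y := π ^ 2 * ω) (by
      linear_combination hκ - hk)).2
    refine absurd (mul_left_cancel₀ h.ne_zero ?_) (h.ne_one (π * ω - t))
    linear_combination -h1
  · by_contra hne
    obtain ⟨v₀, rfl⟩ : ∃ v₀, w₀ = π ^ 4 * v₀ := by
      subst hz₀
      obtain ⟨v, hv⟩ := right_digits h hAB hJ₀
      exact ⟨_, hv⟩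
    obtain ⟨k, ω, x, w₃, p, -, hx, hJ₃, e, -⟩ :=
      exists_sub_digits_of_mem h hAB hS hsub hzS hz₀S ht hz₀ hJ hJ₀ hne
    obtain ⟨j, t, hj⟩ := exists_digits_of_mul' h hAB hd hx hJ₃
    rw [hj] at e
    have := (h.pow_mul_inj (m := 3 * j + 3) (n := 3 * k + 5)
      (x := p + (1 + π * t) * (1 + π * p)) (y := π ^ 2 * ω) (by linear_combination e)).1
    omega

section DescentOne

variable (hd : HasDescent A B fun zε wε ↦ (zε = 0 ∧ wε = 1) ∨
  (∃ c d, zε = 1 + π + π ^ 2 * c ∧ wε = π * d) ∨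
  ∃ p q, zε = π ^ 2 * (1 + π + π ^ 3 * p) ∧ wε = 1 + π ^ 3 * q)

include hd

theorem exists_sq_sub_sq_eq {t t₀ m₀ : R} (hzS : z ∈ S) (hz₀S : z₀ ∈ S)
    (hz : z = 1 + π ^ 3 * t) (hz₀ : z₀ = 1 + π ^ 3 * t₀) (hJ : JacobiQuartic A B z w)
    (hJ₀ : JacobiQuartic A B z₀ (π ^ 4 * (1 + π + π ^ 3 * m₀))) (hne : z ^ 2 ≠ z₀ ^ 2) :
    ∃ ω, z ^ 2 - z₀ ^ 2 = π ^ 12 * (1 + π ^ 3 * ω) := by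
  obtain ⟨k, ω, x, w₃, p, hω, hx, hJ₃, e, hk⟩ :=
    exists_sub_digits_of_mem h hAB hS hsub hzS hz₀S hz hz₀ hJ hJ₀ hne
  rcases eq_or_ne k 0 with rfl | hk0
  · exact ⟨ω, hω⟩
  exfalso
  obtain ⟨m, hm⟩ := hk hk0
  obtain ⟨Q, _, hQ, φ, hp, hp2, -⟩ := h.exists_quotient 3 three_ne_zero le_rfl
  replace hp2 := hp2 2 (by norm_num)
  replace hm := congrArg φ hm
  rcases exists_digits_of_mul h hAB hd hx hJ₃ with ⟨j, t, hj⟩ | ⟨j, t, hj⟩ | ⟨j, t, hj⟩ <;>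
  rw [hj] at e
  · have := (h.pow_mul_inj (m := 3 * j + 3) (n := 3 * k + 5)
      (x := p + (1 + π * t) * (1 + π * p)) (y := π ^ 2 * ω) (by linear_combination e)).1
    omega
  · have h1 := congrArg φ (h.pow_mul_inj (m := 3 * j + 2) (n := 3 * k + 5)
      (x := p + (1 + π ^ 2 * t) * (1 + π * p))
      (y := π ^ 2 * ω) (by linear_combination e)).2
    simp only [map_mul, map_add, map_pow, map_one] at h1 hm
    clear *- hQ hp hp2 h1 hm
    grind
  · have h1 := congrArg φ (h.pow_mul_inj (m := 3 * j + 2) (n := 3 * k + 5)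
      (x := p + (π + π ^ 2 * t) * (1 + π * p))
      (y := π ^ 2 * ω) (by linear_combination e)).2
    simp only [map_mul, map_add, map_pow, map_one] at h1 hm
    clear *- hQ hp hp2 h1 hm
    grind

theorem sq_eq_one_or_of_hasDescent {z₇ m₁ m₇ : R} (hzS : z ∈ S) (hz₇S : z₇ ∈ S) (hz0 : z ≠ 0)
    (hz₇ : 7 * z₇ = 1) (hJ : JacobiQuartic A B z w)
    (hJ₁ : JacobiQuartic A B 1 (π ^ 4 * (1 + π + π ^ 3 * m₁)))
    (hJ₇ : JacobiQuartic A B z₇ (π ^ 4 * (1 + π + π ^ 3 * m₇))) : z ^ 2 = 1 ∨ z ^ 2 = z₇ ^ 2 := by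
  rcases type_cases_of_mem h hAB hS hzS hz0 hJ with ⟨x, κ, ω, rfl, hκ⟩ | ⟨t, ht⟩
  · exfalso
    rcases exists_digits_of_mul h hAB hd hz0 hJ with ⟨k, t, hk⟩ | ⟨k, t, hk⟩ | ⟨k, t, hk⟩ <;>
    rw [hκ] at hk
    · have h1 := (h.pow_mul_inj (m := 3 * κ) (n := 3 * k + 3) (x := π ^ 2 * ω) (y := 1 + π * t) (by
        linear_combination hk)).2
      refine absurd (mul_left_cancel₀ h.ne_zero ?_) (h.ne_one (π * ω - t))
      linear_combination h1
    · have := (h.pow_mul_inj (m := 3 * κ) (n := 3 * k + 2) (x := π ^ 2 * ω)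
        (y := 1 + π ^ 2 * t) (by
        linear_combination hk)).1
      omega
    · have := (h.pow_mul_inj (m := 3 * κ) (n := 3 * k + 2) (x := π ^ 2 * ω)
        (y := π + π ^ 2 * t) (by
        linear_combination hk)).1
      omega
  · by_contra! hne
    obtain ⟨f, hf⟩ := h.exists_two_eq
    have key {z₀ t₀ m₀} := exists_sq_sub_sq_eq (z₀ := z₀) (t₀ := t₀) (m₀ := m₀) h hAB hS hsub hd
      hzS (hz := ht) (hJ := hJ)
    obtain ⟨ω₁, h1⟩ := key (z₀ := 1) (t₀ := 0) S.one_mem (by ring) hJ₁ (by simpa using hne.1)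
    obtain ⟨ω₇, h7⟩ := key (z₀ := z₇) (t₀ := -3 * (1 + π ^ 6 * f) * z₇) hz₇S
      (by linear_combination hz₇ - 3 * z₇ * hf) hJ₇ hne.2
    have h16 : (16 : R) = π ^ 12 * (1 + π ^ 6 * f) ^ 4 := by
      linear_combination (8 + 4 * (π ^ 3 * (1 + π ^ 6 * f)) + 2 * (π ^ 3 * (1 + π ^ 6 * f)) ^ 2 +
        (π ^ 3 * (1 + π ^ 6 * f)) ^ 3) * hf
    have h3 : 3 * (1 + π ^ 6 * f) ^ 4 = 49 * (π ^ 3 * (ω₇ - ω₁)) := by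
      apply mul_left_cancel₀ (pow_ne_zero 12 h.ne_zero)
      linear_combination -3 * h16 + 49 * (h7 - h1) + (7 * z₇ + 1) * hz₇
    obtain ⟨Q, _, hQ, φ, hp, hp2, -⟩ := h.exists_quotient 1 one_ne_zero (by norm_num)
    replace h3 := congrArg φ h3
    simp only [map_mul, map_add, map_sub, map_pow, map_one, map_ofNat] at h3
    have := hp2 0 one_pos
    clear *- hQ hp h3 this
    grind

end DescentOne

end Subring

end JacobiQuartic

namespace IsCubicUniformizer

variable {R : Type u} [CommRing R] {π : R} (h : IsCubicUniformizer π)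

include h

theorem exists_natCast_eq {n : ℕ} (hn : n ≠ 0) :
    ∃ k m, (n : R) = π ^ (3 * k) * (1 + π ^ 3 * m) := by
  obtain ⟨f, hf⟩ := h.exists_two_eq
  have hpow (k : ℕ) : ∃ m, (2 : R) ^ k = π ^ (3 * k) * (1 + π ^ 3 * m) := by
    induction k with
    | zero => exact ⟨0, by simp⟩
    | succ k ih =>
      obtain ⟨m, hm⟩ := ih
      refine ⟨m + π ^ 3 * f * (1 + π ^ 3 * m), ?_⟩
      rw [pow_succ, hm, hf]
      ring
  obtain ⟨k, l, ⟨j, rfl⟩, rfl⟩ := Nat.exists_eq_two_pow_mul_odd hn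
  obtain ⟨m, hm⟩ := hpow k
  refine ⟨k, m + (1 + π ^ 6 * f) * j * (1 + π ^ 3 * m), ?_⟩
  push_cast
  rw [hm]
  linear_combination π ^ (3 * k) * (1 + π ^ 3 * m) * j * hf

theorem exists_intCast_eq {n : ℤ} (hn : n ≠ 0) :
    ∃ k m, (n : R) = π ^ (3 * k) * (1 + π ^ 3 * m) := by
  obtain ⟨f, hf⟩ := h.exists_two_eq
  obtain ⟨n, rfl | rfl⟩ := n.eq_nat_or_neg <;>
    obtain ⟨k, m, hm⟩ := h.exists_natCast_eq (n := n) (by simpa using hn)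
  · exact ⟨k, m, by rw [Int.cast_natCast, hm]⟩
  · refine ⟨k, -m - (1 + π ^ 6 * f), ?_⟩
    rw [Int.cast_neg, Int.cast_natCast, hm]
    linear_combination -π ^ (3 * k) * hf

/-- A nonzero element of the form `m / n` has order divisible by three and leading digits `100`. -/
theorem exists_eq_of_mul_natCast_eq [IsDomain R] {r : R} {n : ℕ} {m : ℤ} (hr : r ≠ 0) (hn : n ≠ 0)
    (hm : m ≠ 0) (e : r * n = m) : ∃ k ω, r = π ^ (3 * k) * (1 + π ^ 3 * ω) := by
  obtain ⟨i, u, rfl⟩ := h.exists_eq_pow_mul r hr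
  obtain ⟨j, x, hx⟩ := h.exists_natCast_eq hn
  obtain ⟨l, y, hy⟩ := h.exists_intCast_eq hm
  rw [hx, hy] at e
  obtain ⟨h1, h2⟩ := h.pow_mul_inj (m := i + 3 * j) (n := 3 * l)
    (x := u + π ^ 2 * x + π ^ 3 * u * x) (y := π ^ 2 * y) (by linear_combination e)
  obtain ⟨x', hx'⟩ := h.exists_inv_pow 2 x
  refine ⟨l - j, x' + y * (1 + π ^ 3 * x'), ?_⟩
  rw [show 3 * (l - j) = i by omega]
  linear_combination π ^ i * ((1 + π ^ 3 * x') * h2 - (1 + π * u) * hx')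

end IsCubicUniformizer

namespace IsSplitMod

variable {R : Type*} [CommRing R] {π A B : R}

/-- The coefficients of the quartic attached to the trivial class. -/
theorem of_pow_three_eq {i : R} (hπ : π ^ 3 = 10) (hi : 5 * i = 1) :
    IsSplitMod π (-(10 + 2 * π)) (25 + 10 * π + 4 * π ^ 2) := by
  refine ⟨⟨π * i ^ 2 + 3 * π ^ 2 * i ^ 3, ?_⟩,
    ⟨i ^ 4 - 3 * π ^ 5 * i ^ 5 - 31 * π ^ 4 * i ^ 5, ?_⟩⟩
  · grind
  · grind

/-- The quartic attached to the class of `B`. -/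
theorem of_mul_eq {a b : R} (h : IsCubicUniformizer π) (hab : IsSplitMod π a b) (hA : A * b = a)
    (hB : B * b = 1) : IsSplitMod π A B := by
  obtain ⟨f, hf⟩ := h.exists_two_eq
  obtain ⟨c, hc⟩ := hab.exists_right_eq
  obtain ⟨e, he⟩ := hab.exists_sum_eq
  refine ⟨⟨-(1 + π ^ 6 * f) + π * (1 + π ^ 3 * c) * B - c * B, ?_⟩,
    ⟨e - (1 + π ^ 2 + π ^ 4 * e) * (1 + π ^ 3 * c) * B, ?_⟩⟩
  · linear_combination (1 - π ^ 4) * (hB - B * hc) - π ^ 4 * hf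
  · linear_combination B * hA - (A + 1) * hB + B * he +
      π ^ 8 * (1 + π ^ 2 + π ^ 4 * e) * (hB - B * hc)

end IsSplitMod

open Valuation

namespace CubeRootTenArithmetic

variable {K : Type u} [Field K] [CharZero K] (D : CubeRootTenArithmetic K)

/-- The cube root of `10` as an element of the valuation ring at the prime above `2`. -/
def uniformizer : D.v₂.integer := ⟨D.α, by
  rw [mem_integer_iff, D.v₂_alpha]
  decide⟩

local notation "π" => CubeRootTenArithmetic.uniformizer D

omit [CharZero K] in
theorem coe_uniformizer : (π : K) = D.α := rfl

omit [CharZero K] in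
@[norm_cast]
theorem coe_ofNat (n : ℕ) [n.AtLeastTwo] : ((ofNat(n) : D.v₂.integer) : K) = ofNat(n) := rfl

omit [CharZero K] in
theorem uniformizer_pow_three : π ^ 3 = 10 := Subtype.ext (by push_cast; exact D.cube)

omit [CharZero K] in
theorem exists_mul_eq_one {n : ℤ} (hn : ¬ (2 : ℤ) ∣ n) : ∃ i : D.v₂.integer, n * i = 1 := by
  have h1 := intCast_eq_one (v := D.v₂) Nat.prime_two (by exact_mod_cast D.v₂_two) hn
  have h0 : (n : K) ≠ 0 := by
    rw [← D.v₂.ne_zero_iff, h1]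
    exact one_ne_zero
  exact ⟨⟨(n : K)⁻¹, by rw [mem_integer_iff, map_inv₀, h1, inv_one]⟩,
    Subtype.ext (by push_cast; exact mul_inv_cancel₀ h0)⟩

omit [CharZero K] in
theorem uniformizer_dvd_iff (x : D.v₂.integer) : π ∣ x ↔ D.v₂ x < 1 := by
  rw [(integer.integers D.v₂).dvd_iff_le, lt_one_iff, ← D.v₂_alpha]
  rfl

theorem isCubicUniformizer : IsCubicUniformizer π where
  exists_two_eq := by
    obtain ⟨i, hi⟩ := D.exists_mul_eq_one (n := 5) (by decide)
    push_cast at hi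
    have hπ := D.uniformizer_pow_three
    exact ⟨-i ^ 3, by grind⟩
  ne_zero h := D.alpha_ne_zero (congrArg Subtype.val h)
  not_dvd_one h := by
    rw [D.uniformizer_dvd_iff] at h
    simp at h
  dvd_or_dvd_sub_one x := by
    rw [D.uniformizer_dvd_iff, D.uniformizer_dvd_iff]
    exact (mem_integer_iff _ _).1 x.2 |>.lt_or_eq.imp id fun h ↦ D.v₂_sub_one_lt h
  exists_inv x := by
    have h1 : D.v₂ ((1 + π * x : D.v₂.integer) : K) = 1 := by
      refine map_eq_one_of_sub_one_lt ?_
      simpa using (D.uniformizer_dvd_iff _).1 (dvd_mul_right π x)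
    have h0 : ((1 + π * x : D.v₂.integer) : K) ≠ 0 := by
      rw [← D.v₂.ne_zero_iff, h1]
      exact one_ne_zero
    obtain ⟨y, hy⟩ : ∃ y : D.v₂.integer, (1 + π * x) * y = 1 :=
      ⟨⟨((1 + π * x : D.v₂.integer) : K)⁻¹, by rw [mem_integer_iff, map_inv₀, h1, inv_one]⟩,
        Subtype.ext (mul_inv_cancel₀ h0)⟩
    exact ⟨-x * y, by linear_combination -π * x * hy⟩
  exists_eq_pow_mul x hx := by
    have hx0 : (x : K) ≠ 0 := by simpa using hx
    have hv0 : D.v₂ x ≠ 0 := (D.v₂.ne_zero_iff).2 hx0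
    obtain ⟨n, hn⟩ : ∃ n : ℕ, D.v₂ x = exp (-(n : ℤ)) := by
      have h1 := (mem_integer_iff _ _).1 x.2
      rw [← exp_log hv0, ← exp_zero, exp_le_exp] at h1
      exact ⟨(-log (D.v₂ x)).toNat, by rw [Int.toNat_of_nonneg (by omega), neg_neg, exp_log hv0]⟩
    have hu : D.v₂ (x / D.α ^ n : K) = 1 := by
      rw [map_div₀, map_pow, D.v₂_alpha, hn, ← exp_nsmul]
      simp
    obtain ⟨u, hu'⟩ : π ∣ (⟨x / D.α ^ n, hu.le⟩ - 1 : D.v₂.integer) := by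
      rw [D.uniformizer_dvd_iff]
      exact D.v₂_sub_one_lt hu
    refine ⟨n, u, Subtype.ext ?_⟩
    rw [← hu']
    push_cast
    rw [D.coe_uniformizer]
    have := D.alpha_ne_zero
    field_simp
    ring

section Integrality

variable {A B : D.v₂.integer} (hAB : IsSplitMod D.uniformizer A B)

include hAB

theorem v₂_le_one {z w : K} (hJ : JacobiQuartic (A : K) B z w) : D.v₂ z ≤ 1 := by
  by_contra! hz
  have hz0 : z ≠ 0 := by
    rintro rfl
    simp at hz
  have hx : D.v₂ z⁻¹ < 1 := by
    rw [map_inv₀]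
    exact inv_lt_one_of_one_lt₀ hz
  obtain ⟨x, hx'⟩ := (D.uniformizer_dvd_iff ⟨z⁻¹, hx.le⟩).2 hx
  have hx2 : z⁻¹ = π * x := congrArg Subtype.val hx'
  have hW : (w / z ^ 2) ^ 2 = ((B + A * (π * x) ^ 2 + (π * x) ^ 4 : D.v₂.integer) : K) := by
    push_cast
    rw [← hx2]
    unfold JacobiQuartic at hJ
    field_simp
    linear_combination hJ
  have hW1 : D.v₂ (w / z ^ 2) ≤ 1 := by
    have := (mem_integer_iff _ _).1 (B + A * (π * x) ^ 2 + (π * x) ^ 4 : D.v₂.integer).2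
    rw [← hW, map_pow] at this
    exact (pow_le_one_iff two_ne_zero).1 this
  exact JacobiQuartic.sq_ne_of_mul D.isCubicUniformizer hAB x ⟨_, hW1⟩ (Subtype.ext hW)

theorem exists_jacobiQuartic {z w : K} (hJ : JacobiQuartic (A : K) B z w) :
    ∃ z' w' : D.v₂.integer, z' = z ∧ w' = w ∧ JacobiQuartic A B z' w' := by
  have hz := D.v₂_le_one hAB hJ
  obtain ⟨z, rfl⟩ : ∃ z' : D.v₂.integer, z' = z := ⟨⟨z, hz⟩, rfl⟩
  have hW : w ^ 2 = ((1 + A * z ^ 2 + B * z ^ 4 : D.v₂.integer) : K) := hJ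
  have hw : D.v₂ w ≤ 1 := by
    have := (mem_integer_iff _ _).1 (1 + A * z ^ 2 + B * z ^ 4 : D.v₂.integer).2
    rw [← hW, map_pow] at this
    exact (pow_le_one_iff two_ne_zero).1 this
  exact ⟨z, ⟨w, hw⟩, rfl, rfl, Subtype.ext hW⟩

theorem exists_sub (hB : ¬ IsSquare (B : K)) (z₁ w₁ z₂ w₂ : D.v₂.integer)
    (h₁ : JacobiQuartic A B z₁ w₁) (h₂ : JacobiQuartic A B z₂ w₂) :
    ∃ z₃ w₃, JacobiQuartic A B z₃ w₃ ∧ z₃ * (1 - B * z₁ ^ 2 * z₂ ^ 2) = z₁ * w₂ - z₂ * w₁ := by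
  obtain ⟨z₃, w₃, hz, -, hJ⟩ := D.exists_jacobiQuartic hAB (JacobiQuartic.sub hB
    (congrArg Subtype.val h₁) (congrArg Subtype.val h₂))
  refine ⟨z₃, w₃, hJ, Subtype.ext ?_⟩
  push_cast
  rw [hz, div_mul_cancel₀ _ (JacobiQuartic.denom_ne_zero hB _ _)]

theorem hasDescent {E : K → K → Prop} {E' : D.v₂.integer → D.v₂.integer → Prop}
    (hE : ∀ z w, E z w → ∃ z' w' : D.v₂.integer, z' = z ∧ w' = w ∧ E' z' w')
    (hd : JacobiQuartic.HasDescent (A : K) B E) : JacobiQuartic.HasDescent A B E' := by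
  intro z w hJ
  obtain ⟨s, zε, wε, z₁, w₁, hs, hε, hJ₁, e⟩ := hd z w (congrArg Subtype.val hJ)
  obtain ⟨zε, wε, rfl, rfl, hε'⟩ := hE _ _ hε
  obtain ⟨z₁, w₁, rfl, rfl, hJ₁'⟩ := D.exists_jacobiQuartic hAB hJ₁
  obtain ⟨s, rfl, hs'⟩ : ∃ s' : D.v₂.integer, s' = s ∧ (s' = 1 ∨ s' = -1) := by
    rcases hs with rfl | rfl
    · exact ⟨1, rfl, Or.inl rfl⟩
    · exact ⟨-1, rfl, Or.inr rfl⟩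
  exact ⟨s, zε, wε, z₁, w₁, hs', hε', hJ₁', Subtype.ext (by push_cast; exact e)⟩

end Integrality

/-- The rational elements of the valuation ring at the prime above `2`. -/
def rationalIntegers : Subring D.v₂.integer := (Rat.castHom K).range.comap D.v₂.integer.subtype

theorem exists_digits_of_mem_rationalIntegers (r : D.v₂.integer) (hr : r ∈ D.rationalIntegers)
    (hr0 : r ≠ 0) : ∃ k ω, r = π ^ (3 * k) * (1 + π ^ 3 * ω) := by
  obtain ⟨q, hq⟩ := hr
  have hq : (q : K) = r := hq
  have hq0 : q ≠ 0 := by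
    rintro rfl
    exact hr0 (Subtype.ext (by rw [← hq]; simp))
  refine D.isCubicUniformizer.exists_eq_of_mul_natCast_eq (n := q.den) (m := q.num) hr0
    q.den_ne_zero (Rat.num_ne_zero.2 hq0) (Subtype.ext ?_)
  push_cast
  rw [← hq]
  exact_mod_cast q.mul_den_eq_num

omit [CharZero K] in
theorem exists_inverses : ∃ i₃ i₅ i₇ : D.v₂.integer, 3 * i₃ = 1 ∧ 5 * i₅ = 1 ∧ 7 * i₇ = 1 := by
  obtain ⟨i₃, h₃⟩ := D.exists_mul_eq_one (n := 3) (by decide)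
  obtain ⟨i₅, h₅⟩ := D.exists_mul_eq_one (n := 5) (by decide)
  obtain ⟨i₇, h₇⟩ := D.exists_mul_eq_one (n := 7) (by decide)
  exact ⟨i₃, i₅, i₇, mod_cast h₃, mod_cast h₅, mod_cast h₇⟩

theorem sq_eq_of_jacobiQuartic_one {z : ℚ} {w : K} (hz : z ≠ 0)
    (hJ : JacobiQuartic (-(10 + 2 * D.α)) D.b (z : K) w) : z ^ 2 = 1 ∨ z ^ 2 = 1 / 49 := by
  obtain ⟨i₃, i₅, i₇, h₃, h₅, h₇⟩ := D.exists_inverses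
  have hπ := D.uniformizer_pow_three
  have hAB := IsSplitMod.of_pow_three_eq hπ h₅
  have hA : ((-(10 + 2 * π) : D.v₂.integer) : K) = -(10 + 2 * D.α) := rfl
  have hB : ((25 + 10 * π + 4 * π ^ 2 : D.v₂.integer) : K) = D.b := rfl
  have c₃ : (i₃ : K) = 1 / 3 := by
    rw [eq_div_iff three_ne_zero, mul_comm]; exact congrArg Subtype.val h₃
  have c₅ : (i₅ : K) = 1 / 5 := by
    rw [eq_div_iff (by norm_num), mul_comm]; exact congrArg Subtype.val h₅
  have c₇ : (i₇ : K) = 1 / 7 := by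
    rw [eq_div_iff (by norm_num), mul_comm]; exact congrArg Subtype.val h₇
  have hd : JacobiQuartic.HasDescent (-(10 + 2 * π)) (25 + 10 * π + 4 * π ^ 2)
      fun zε wε ↦ (zε = 0 ∧ wε = 1) ∨ (∃ c d, zε = 1 + π + π ^ 2 * c ∧ wε = π * d) ∨
        ∃ p q, zε = π ^ 2 * (1 + π + π ^ 3 * p) ∧ wε = 1 + π ^ 3 * q := by
    refine D.hasDescent hAB ?_ fun z w ↦ D.descent_one
    rintro z w (⟨rfl, rfl⟩ | ⟨rfl, rfl⟩ | ⟨rfl, rfl⟩ | ⟨rfl, rfl⟩)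
    · exact ⟨0, 1, rfl, rfl, Or.inl ⟨rfl, rfl⟩⟩
    · refine ⟨-(π - 1) * i₃, (2 + 2 * π - π ^ 2) * i₃, ?_, ?_, Or.inr (Or.inl
        ⟨-π ^ 2 * i₅ - π * i₅ * i₃ * (1 - π), (π ^ 2 * i₅ + 2 - π) * i₃, ?_, ?_⟩)⟩
      · push_cast; rw [c₃, D.coe_uniformizer]; ring
      · push_cast; rw [c₃, D.coe_uniformizer]; ring
      · grind
      · grind
    · refine ⟨(5 + 5 * π + 2 * π ^ 2) * i₃ * i₅, -(110 + 50 * π + 23 * π ^ 2) * i₃ * i₅, ?_, ?_,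
        Or.inr (Or.inl ⟨-π * i₅ * i₃ * (1 + π) + 2 * i₃ * i₅,
          -(11 * π ^ 2 + 50 + 23 * π) * i₃ * i₅, ?_, ?_⟩)⟩
      · push_cast; rw [c₃, c₅, D.coe_uniformizer]; ring
      · push_cast; rw [c₃, c₅, D.coe_uniformizer]; ring
      · grind
      · grind
    · refine ⟨(π ^ 2 - 10) * i₃ * i₅, (5 - 10 * π + 2 * π ^ 2) * i₃ * i₅, ?_, ?_, Or.inr (Or.inr
        ⟨-π * i₅ - 7 * i₅ * (i₃ * i₅) * (1 - π), i₅ * (-5 - 5 * π + π ^ 2) * i₃ * i₅, ?_, ?_⟩)⟩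
      · push_cast; rw [c₃, c₅, D.coe_uniformizer]; ring
      · push_cast; rw [c₃, c₅, D.coe_uniformizer]; ring
      · grind
      · grind
  obtain ⟨z', w', hz', -, hJ'⟩ := D.exists_jacobiQuartic hAB (by rwa [hA, hB])
  have := JacobiQuartic.sq_eq_one_or_of_hasDescent D.isCubicUniformizer hAB
    D.exists_digits_of_mem_rationalIntegers (D.exists_sub hAB (by rw [hB]; exact D.not_isSquare_b))
    hd (z₇ := i₇) (m₁ := π ^ 2 * i₅ ^ 2 - 7 * i₅ * (i₃ * i₅) * (1 + π + π ^ 5 * i₅ ^ 2))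
    (m₇ := -17 * i₅ * (i₅ * i₇) - 121 * π * i₅ * (i₅ * i₇ ^ 2) - π ^ 5 * i₅ ^ 4 * i₇ ^ 2)
    ⟨z, hz'.symm⟩ ⟨1 / 7, ?_⟩ ?_ h₇ hJ' ?_ ?_
  · refine this.imp (fun h ↦ ?_) fun h ↦ ?_ <;> replace h := congrArg Subtype.val h <;>
      push_cast at h <;> rw [hz'] at h
    · exact_mod_cast h
    · rw [c₇] at h
      have h' : ((z ^ 2 : ℚ) : K) = ((1 / 49 : ℚ) : K) := by push_cast; rw [h]; norm_num
      exact_mod_cast h'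
  · simpa using c₇.symm
  · rintro rfl
    exact hz (Rat.cast_injective (α := K) (by rw [← hz', Rat.cast_zero]; rfl))
  · unfold JacobiQuartic; grind
  · unfold JacobiQuartic; grind

theorem sq_eq_of_jacobiQuartic_two {A B : K} {z : ℚ} {w : K} (hA : A * D.b = -(10 + 2 * D.α))
    (hB : B * D.b = 1) (hz : z ≠ 0) (hJ : JacobiQuartic A B (z : K) w) : z ^ 2 = 9 := by
  obtain ⟨i₃, i₅, -, h₃, h₅, -⟩ := D.exists_inverses
  have hπ := D.uniformizer_pow_three
  have h45 : (i₃ ^ 2 * i₅) * 45 = 1 := by grind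
  have c₃ : (i₃ : K) = 1 / 3 := by
    rw [eq_div_iff three_ne_zero, mul_comm]; exact congrArg Subtype.val h₃
  have c₅ : (i₅ : K) = 1 / 5 := by
    rw [eq_div_iff (by norm_num), mul_comm]; exact congrArg Subtype.val h₅
  have hBR : ((5 - 2 * π) * (i₃ ^ 2 * i₅)) * (25 + 10 * π + 4 * π ^ 2) = 1 := by grind
  obtain ⟨B, rfl, hBR⟩ : ∃ B' : D.v₂.integer, B' = B ∧ B' * (25 + 10 * π + 4 * π ^ 2) = 1 :=
    ⟨_, mul_right_cancel₀ D.b_ne_zero ((congrArg Subtype.val hBR).trans hB.symm), hBR⟩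
  obtain ⟨A, rfl, hAR⟩ : ∃ A' : D.v₂.integer, A' = A ∧
      A' * (25 + 10 * π + 4 * π ^ 2) = -(10 + 2 * π) := by
    have h : -(10 + 2 * π) * B * (25 + 10 * π + 4 * π ^ 2) = -(10 + 2 * π) := by
      rw [mul_assoc, hBR, mul_one]
    exact ⟨_, mul_right_cancel₀ D.b_ne_zero ((congrArg Subtype.val h).trans hA.symm), h⟩
  have hAB := IsSplitMod.of_mul_eq D.isCubicUniformizer (IsSplitMod.of_pow_three_eq hπ h₅) hAR hBR
  have h3 : 3 = 1 + π ^ 3 * i₅ := by grind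
  have hJ₃ : JacobiQuartic A B 3 (-(20 - 10 * π + 2 * π ^ 2) * i₃ * i₅) := by
    unfold JacobiQuartic; grind
  have hd : JacobiQuartic.HasDescent A B fun zε wε ↦ (zε = 0 ∧ wε = 1) ∨
      (∃ c, zε = 1 + π ^ 3 * c) ∧ JacobiQuartic A B zε wε := by
    refine D.hasDescent hAB ?_ fun z w ↦ D.descent_two hA hB
    rintro z w (⟨rfl, rfl⟩ | ⟨rfl, rfl⟩)
    · exact ⟨0, 1, rfl, rfl, Or.inl ⟨rfl, rfl⟩⟩
    · refine ⟨3, _, rfl, ?_, Or.inr ⟨⟨i₅, h3⟩, hJ₃⟩⟩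
      push_cast; rw [c₃, c₅, D.coe_uniformizer]; ring
  have hBsq : ¬ IsSquare (B : K) := by
    rintro ⟨r, hr⟩
    refine D.not_isSquare_b ⟨r⁻¹, ?_⟩
    rw [← mul_inv, ← hr, eq_comm, inv_eq_of_mul_eq_one_right hB]
  obtain ⟨z', w', hz', -, hJ'⟩ := D.exists_jacobiQuartic hAB hJ
  have := JacobiQuartic.sq_eq_sq_of_hasDescent D.isCubicUniformizer hAB
    D.exists_digits_of_mem_rationalIntegers (D.exists_sub hAB hBsq) hd
    ⟨z, hz'.symm⟩ ⟨3, by simpa using (D.coe_ofNat 3).symm⟩ (by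
      rintro rfl
      exact hz (Rat.cast_injective (α := K) (by rw [← hz', Rat.cast_zero]; rfl))) h3 hJ' hJ₃
  replace h := congrArg Subtype.val this
  push_cast at h
  rw [hz'] at h
  have h' : ((z ^ 2 : ℚ) : K) = ((9 : ℚ) : K) := by push_cast; rw [h]; norm_num
  exact_mod_cast h'

end CubeRootTenArithmetic

namespace CubeRootTenArithmetic

variable {K : Type*} [Field K] [CharZero K] (D : CubeRootTenArithmetic K)

include D in
/-- The rational points of `Y ^ 2 = (u ^ 2 - 5) ^ 3 + 80` have `u ∈ {±1, ±3, ±7}`. -/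
theorem sq_eq_of_sq_eq {u Y : ℚ} (h : Y ^ 2 = (u ^ 2 - 5) ^ 3 + 80) :
    u ^ 2 = 1 ∨ u ^ 2 = 9 ∨ u ^ 2 = 49 := by
  have hu : u ≠ 0 := by
    rintro rfl
    nlinarith
  have hu' : (u : K) ≠ 0 := by exact_mod_cast hu
  have hK : (Y : K) ^ 2 = ((u : K) ^ 2 - 5) ^ 3 + 80 := by
    exact_mod_cast congrArg (Rat.cast (K := K)) h
  have hfac : (Y : K) ^ 2 = ((u : K) ^ 2 - 5 + 2 * D.α) *
      ((u : K) ^ 4 - (10 + 2 * D.α) * (u : K) ^ 2 + D.b) := by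
    rw [hK, CubeRootTenArithmetic.b]
    linear_combination -8 * D.cube
  obtain ⟨t, ht, e | e⟩ := D.isSquare_or_of_sq_eq hK <;> rw [e] at hfac
  · have := D.sq_eq_of_jacobiQuartic_one (z := u⁻¹) (w := Y / (t * u ^ 2)) (inv_ne_zero hu) (by
      unfold JacobiQuartic
      push_cast
      field_simp
      linear_combination hfac)
    rcases this with h1 | h1 <;> rw [inv_pow, inv_eq_iff_eq_inv] at h1
    · exact Or.inl (h1.trans (by norm_num))
    · exact Or.inr (Or.inr (h1.trans (by norm_num)))
  · have hb := D.b_ne_zero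
    refine Or.inr (Or.inl (D.sq_eq_of_jacobiQuartic_two (A := -(10 + 2 * D.α) / D.b)
      (B := 1 / D.b) (w := Y / (D.b * t)) (by field_simp) (by field_simp) hu ?_))
    unfold JacobiQuartic
    field_simp
    linear_combination hfac

end CubeRootTenArithmetic

/-- The affine rational points on the genus-2 hyperelliptic curve
`y^2 + y = x^6 + 3x^5 - 5x^3 + 3x` are exactly twelve explicit points. -/
theorem affine_points_of_Xns3ns5_delta (x y : ℚ) :
    y ^ 2 + y = x ^ 6 + 3 * x ^ 5 - 5 * x ^ 3 + 3 * x ↔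
      (x, y) ∈ ({(0, 0), (0, -1), (1, 1), (1, -2), (-1, 0), (-1, -1),
        (-2, 1), (-2, -2), (3, 36), (3, -37), (-4, 36), (-4, -37)} : Set (ℚ × ℚ)) := by
  simp only [Set.mem_insert_iff, Set.mem_singleton_iff, Prod.mk.injEq]
  constructor
  · intro h
    obtain ⟨K, _, _, ⟨D⟩⟩ := exists_cubeRootTenArithmetic
    have hu := D.sq_eq_of_sq_eq (u := 2 * x + 1) (Y := 4 * (2 * y + 1))
      (by linear_combination 64 * h)
    have hx : x = 0 ∨ x = -1 ∨ x = 1 ∨ x = -2 ∨ x = 3 ∨ x = -4 := by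
      have : x * (x + 1) * ((x - 1) * (x + 2)) * ((x - 3) * (x + 4)) = 0 := by
        rcases hu with h1 | h1 | h1
        · linear_combination (x - 1) * (x + 2) * ((x - 3) * (x + 4)) / 4 * h1
        · linear_combination x * (x + 1) * ((x - 3) * (x + 4)) / 4 * h1
        · linear_combination x * (x + 1) * ((x - 1) * (x + 2)) / 4 * h1
      simp only [mul_eq_zero, sub_eq_zero, add_eq_zero_iff_eq_neg] at this
      tauto
    have hy (c : ℚ) (hc : y ^ 2 + y = c ^ 2 + c) : y = c ∨ y = -1 - c := by
      have : (y - c) * (y - (-1 - c)) = 0 := by linear_combination hc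
      simpa only [mul_eq_zero, sub_eq_zero] using this
    rcases hx with rfl | rfl | rfl | rfl | rfl | rfl
    · rcases hy 0 (by linear_combination h) with rfl | rfl <;> norm_num
    · rcases hy 0 (by linear_combination h) with rfl | rfl <;> norm_num
    · rcases hy 1 (by linear_combination h) with rfl | rfl <;> norm_num
    · rcases hy 1 (by linear_combination h) with rfl | rfl <;> norm_num
    · rcases hy 36 (by linear_combination h) with rfl | rfl <;> norm_num
    · rcases hy 36 (by linear_combination h) with rfl | rfl <;> norm_num
  · rintro (⟨rfl, rfl⟩ | ⟨rfl, rfl⟩ | ⟨rfl, rfl⟩ | ⟨rfl, rfl⟩ | ⟨rfl, rfl⟩ | ⟨rfl, rfl⟩ | ⟨rfl, rfl⟩ |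
      ⟨rfl, rfl⟩ | ⟨rfl, rfl⟩ | ⟨rfl, rfl⟩ | ⟨rfl, rfl⟩ | ⟨rfl, rfl⟩) <;> norm_num
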